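/- Let p < q be odd primes with q ≤ 2p + 1 and let H be a non-semisimple Hopf algebra over ℂ of dimension p·q. Let (P, π) be a projective cover of the trivial H-module. Then dim(P) < p. -/

import Mathlib

noncomputable section
open scoped TensorProduct
open Coalgebra HopfAlgebra
set_option linter.unusedSectionVars false
set_option linter.unusedSimpArgs false

namespace Sw

section
variable {V : Type*} [AddCommGroup V] [Module ℂ V] [Module.Finite ℂ V]

lemma trace_idem {P : Module.End ℂ V} (h : IsIdempotentElem P) :
    LinearMap.trace ℂ V P = (Module.finrank ℂ (LinearMap.range P) : ℂ) :=
  LinearMap.IsProj.trace ((LinearMap.isProj_range_iff_isIdempotentElem P).2 h)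

lemma avg_idem {R : Type*} [Ring R] [Algebra ℂ R] {U : R} {s : ℕ} (hs : 0 < s) (hU : U ^ s = 1) :
    U * ((s : ℂ)⁻¹ • ∑ i ∈ Finset.range s, U ^ i) = (s : ℂ)⁻¹ • ∑ i ∈ Finset.range s, U ^ i ∧
    IsIdempotentElem ((s : ℂ)⁻¹ • ∑ i ∈ Finset.range s, U ^ i) := by
  have h1 : U * ((s : ℂ)⁻¹ • ∑ i ∈ Finset.range s, U ^ i) =
      (s : ℂ)⁻¹ • ∑ i ∈ Finset.range s, U ^ i := by
    rw [mul_smul_comm, Finset.mul_sum]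
    congr 1
    simp only [← pow_succ']
    have := Finset.sum_range_succ' (fun i => U ^ i) s
    rw [Finset.sum_range_succ, hU, pow_zero] at this
    exact (add_right_cancel this).symm
  refine ⟨h1, ?_⟩
  set P := (s : ℂ)⁻¹ • ∑ i ∈ Finset.range s, U ^ i with hP
  have h2 : ∀ i, U ^ i * P = P := by
    intro i
    induction i with
    | zero => simp
    | succ n ih => rw [pow_succ, mul_assoc, h1, ih]
  change ((s : ℂ)⁻¹ • ∑ i ∈ Finset.range s, U ^ i) * P = P
  rw [smul_mul_assoc, Finset.sum_mul]
  simp only [h2]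
  rw [Finset.sum_const, Finset.card_range, ← Nat.cast_smul_eq_nsmul ℂ, smul_smul,
    inv_mul_cancel₀ (by exact_mod_cast hs.ne'), one_smul]

lemma avg_dvd {E U : Module.End ℂ V} (hE : IsIdempotentElem E) (hc : Commute E U) {s : ℕ}
    (hs : 0 < s) (hU : U ^ s = 1) (ht : ∀ i, 0 < i → i < s → LinearMap.trace ℂ V (E * U ^ i) = 0)
    {n : ℕ} (hn : LinearMap.trace ℂ V E = n) : s ∣ n := by
  obtain ⟨-, h⟩ := avg_idem (R := Module.End ℂ V) hs hU
  set P := (s : ℂ)⁻¹ • ∑ i ∈ Finset.range s, U ^ i with hP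
  have hEP : Commute E P := by
    apply Commute.smul_right
    apply Commute.sum_right
    intro i _
    exact hc.pow_right i
  have hid : IsIdempotentElem (E * P) := IsIdempotentElem.mul_of_commute hEP hE h
  have h1 := trace_idem hid
  have h2 : LinearMap.trace ℂ V (E * P) = (s : ℂ)⁻¹ * n := by
    rw [hP, mul_smul_comm, map_smul, Finset.mul_sum, map_sum, smul_eq_mul,
      Finset.sum_eq_single_of_mem 0 (Finset.mem_range.2 hs), pow_zero, mul_one, hn]
    intro i hi h0
    exact ht i (Nat.pos_of_ne_zero h0) (Finset.mem_range.1 hi)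
  rw [h2] at h1
  refine ⟨Module.finrank ℂ (LinearMap.range (E * P)), ?_⟩
  have hs' : (s : ℂ) ≠ 0 := by exact_mod_cast hs.ne'
  have : (n : ℂ) = s * Module.finrank ℂ (LinearMap.range (E * P)) := by
    rw [← h1]; field_simp
  exact_mod_cast this

lemma order_dvd_finrank {U : Module.End ℂ V} {s : ℕ}
    (hs : 0 < s) (hU : U ^ s = 1) (ht : ∀ i, 0 < i → i < s → LinearMap.trace ℂ V (U ^ i) = 0) :
    s ∣ Module.finrank ℂ V :=
  avg_dvd (E := 1) IsIdempotentElem.one (Commute.one_left U) hs hU (by simpa using ht) (by simp)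

end
end Sw

namespace Sw

section
variable {V : Type*} [AddCommGroup V] [Module ℂ V] [Module.Finite ℂ V]

lemma trace_pow_of_nilpotent_sub {g : Module.End ℂ V} {c : ℂ}
    (h : IsNilpotent (g - algebraMap ℂ (Module.End ℂ V) c)) (i : ℕ) :
    LinearMap.trace ℂ V (g ^ i) = Module.finrank ℂ V * c ^ i := by
  have hc : Commute g (algebraMap ℂ (Module.End ℂ V) c) := (Algebra.commutes c g).symm
  have h1 : IsNilpotent (g ^ i - algebraMap ℂ (Module.End ℂ V) c ^ i) := by
    rw [← hc.mul_geom_sum₂]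
    refine Commute.isNilpotent_mul_right ?_ h
    refine Commute.sum_right _ _ _ fun j _ => ?_
    refine Commute.sub_left ?_ ?_
    · exact ((Commute.refl g).pow_right _).mul_right (hc.pow_right _)
    · exact (hc.symm.pow_right _).mul_right ((Commute.refl _).pow_right _)
  have h2 := (LinearMap.isNilpotent_trace_of_isNilpotent h1).eq_zero
  rw [map_sub, sub_eq_zero] at h2
  rw [h2, ← map_pow, Algebra.algebraMap_eq_smul_one, map_smul, LinearMap.trace_one, smul_eq_mul,
    mul_comm]

/-- Power sums of eigenvalues. -/
lemma exists_spectrum (f : Module.End ℂ V) : ∃ (s : Finset ℂ) (d : ℂ → ℕ),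
    (∀ x ∈ s, f.HasEigenvalue x) ∧
    ∀ i, LinearMap.trace ℂ V (f ^ i) = ∑ x ∈ s, (d x : ℂ) * x ^ i := by
  have hint : DirectSum.IsInternal f.maxGenEigenspace :=
    (DirectSum.isInternal_submodule_iff_iSupIndep_and_iSup_eq_top _).2
      ⟨f.independent_maxGenEigenspace, f.iSup_maxGenEigenspace_eq_top⟩
  have hfin : {i | f.maxGenEigenspace i ≠ ⊥}.Finite :=
    WellFoundedGT.finite_ne_bot_of_iSupIndep hint.submodule_iSupIndep
  refine ⟨hfin.toFinset, fun x => Module.finrank ℂ (f.maxGenEigenspace x), ?_, ?_⟩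
  · intro x hx
    have hx' : f.maxGenEigenspace x ≠ ⊥ := by simpa using hx
    rw [Module.End.maxGenEigenspace_eq_genEigenspace_finrank] at hx'
    exact Module.End.hasEigenvalue_of_hasGenEigenvalue (k := Module.finrank ℂ V) hx'
  · intro i
    rw [LinearMap.trace_eq_sum_trace_restrict' hint hfin (f := f ^ i) (fun x =>
      Module.End.mapsTo_maxGenEigenspace_of_comm ((Commute.refl f).pow_right i) x)]
    refine Finset.sum_congr rfl fun x _ => ?_
    have h1 := Module.End.isNilpotent_restrict_maxGenEigenspace_sub_algebraMap f x
    have h2 := Module.End.mapsTo_maxGenEigenspace_of_comm (Commute.refl f) x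
    rw [← trace_pow_of_nilpotent_sub (g := f.restrict h2) (c := x) (by convert h1 using 1; ext; rfl)]
    exact congrArg _ (Module.End.pow_restrict i h2).symm

/-- A finite-order endomorphism whose trace is the dimension is the identity. -/
lemma eq_one_of_trace_eq {U : Module.End ℂ V} {s : ℕ} (hs : 0 < s) (hU : U ^ s = 1)
    (ht : LinearMap.trace ℂ V U = Module.finrank ℂ V) : U = 1 := by
  obtain ⟨S, d, h1, h2⟩ := exists_spectrum U
  have hnorm : ∀ x ∈ S, ‖x‖ = 1 := by
    intro x hx
    obtain ⟨v, hv⟩ := (h1 x hx).exists_hasEigenvector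
    have h3 := hv.pow_apply s
    rw [hU, Module.End.one_apply] at h3
    have : (1 - x ^ s) • v = 0 := by rw [sub_smul, one_smul, ← h3, sub_self]
    have hx1 : x ^ s = 1 := (sub_eq_zero.1 ((smul_eq_zero.1 this).resolve_right hv.2)).symm
    exact Complex.norm_eq_one_of_pow_eq_one hx1 hs.ne'
  rw [← pow_one U, h2] at ht
  have hd := h2 0
  simp only [pow_zero, LinearMap.trace_one, mul_one] at hd
  rw [hd] at ht
  have hre : ∑ x ∈ S, (d x : ℝ) * (1 - x.re) = 0 := by
    have := congrArg Complex.re ht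
    simp only [pow_one, Complex.re_sum, Complex.mul_re, Complex.natCast_im, zero_mul, sub_zero, Complex.natCast_re] at this
    simp only [mul_sub, mul_one, Finset.sum_sub_distrib, this, sub_self]
  have hle : ∀ x ∈ S, x.re ≤ 1 := fun x hx => (hnorm x hx) ▸ Complex.re_le_norm x
  have hz := (Finset.sum_eq_zero_iff_of_nonneg fun x hx =>
    mul_nonneg (Nat.cast_nonneg _) (sub_nonneg.2 (hle x hx))).1 hre
  have hx1 : ∀ i, ∀ x ∈ S, (d x : ℂ) * x ^ i = d x := by
    intro i x hx
    rcases mul_eq_zero.1 (hz x hx) with h | h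
    · have : d x = 0 := by exact_mod_cast h
      simp [this]
    · have h3 : x.re = 1 := by linarith
      have h4 : x = 1 := by
        have h5 := hnorm x hx
        have h6 := Complex.sq_norm x
        rw [h5, Complex.normSq_apply, h3] at h6
        refine Complex.ext h3 ?_
        have : x.im * x.im = 0 := by linarith
        simpa using this
      simp [h4]
  have htr : ∀ i, LinearMap.trace ℂ V (U ^ i) = Module.finrank ℂ V := by
    intro i
    rw [h2, Finset.sum_congr rfl (hx1 i), hd]
  obtain ⟨h3, h4⟩ := avg_idem hs hU
  set P := (s : ℂ)⁻¹ • ∑ i ∈ Finset.range s, U ^ i with hP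
  have h5 : LinearMap.trace ℂ V P = Module.finrank ℂ V := by
    rw [hP, map_smul, map_sum, Finset.sum_congr rfl fun i _ => htr i, Finset.sum_const,
      Finset.card_range, smul_eq_mul, nsmul_eq_mul,
      inv_mul_cancel_left₀ (by exact_mod_cast hs.ne')]
  have h6 : 1 - P = 0 := LinearMap.IsIdempotentElem.eq_zero_of_trace_eq_zero h4.one_sub (by
    rw [map_sub, LinearMap.trace_one, h5, sub_self])
  rw [sub_eq_zero] at h6
  rw [← h6, mul_one] at h3
  exact h3

/-- Vanishing sums of `2s`-th roots of unity. -/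
lemma roots_sum {s : ℕ} (hs : s.Prime) (ho : Odd s) (S : Finset ℂ) (d : ℂ → ℕ)
    (h : ∀ x ∈ S, x ^ (2 * s) = 1) (h0 : ∑ x ∈ S, (d x : ℂ) * x = 0) :
    ∃ k : ℤ, (s : ℤ) ∣ k ∧ |k| ≤ ∑ x ∈ S, (d x : ℤ) ∧ (2 : ℤ) ∣ (∑ x ∈ S, (d x : ℤ)) - k ∧
      ((∀ x ∈ S, x ^ s = 1) → k = ∑ x ∈ S, (d x : ℤ)) := by
  classical
  have : NeZero s := ⟨hs.ne_zero⟩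
  have hζ := Complex.isPrimitiveRoot_exp s hs.ne_zero
  set ζ := Complex.exp (2 * Real.pi * Complex.I / s)
  have key : ∀ x : ℂ, ∃ (e : ℤ) (a : ℕ), x ∈ S →
      (x = e * ζ ^ a ∧ (e = 1 ∨ e = -1) ∧ (x ^ s = 1 → e = 1)) := by
    intro x
    by_cases hx : x ∈ S
    · by_cases h1 : x ^ s = 1
      · obtain ⟨a, -, ha⟩ := hζ.eq_pow_of_pow_eq_one h1
        exact ⟨1, a, fun _ => ⟨by simp [ha], Or.inl rfl, fun _ => rfl⟩⟩
      · have h2 : x ^ s = -1 := by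
          have := h x hx
          rw [mul_comm, pow_mul, sq_eq_one_iff] at this
          exact this.resolve_left h1
        obtain ⟨a, -, ha⟩ := hζ.eq_pow_of_pow_eq_one (ξ := -x) (by rw [ho.neg_pow, h2, neg_neg])
        exact ⟨-1, a, fun _ => ⟨by simp [ha], Or.inr rfl, fun h3 => absurd h3 h1⟩⟩
    · exact ⟨0, 0, fun h => absurd h hx⟩
  choose e a hea using key
  let P : Polynomial ℤ := ∑ x ∈ S, Polynomial.C ((d x : ℤ) * e x) * Polynomial.X ^ (a x)
  have hP : Polynomial.aeval ζ P = 0 := by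
    rw [← h0]
    simp only [P, map_sum, map_mul, Polynomial.aeval_C, map_pow, Polynomial.aeval_X]
    refine Finset.sum_congr rfl fun x hx => ?_
    have := (hea x hx).1
    rw [mul_assoc]
    simp only [eq_intCast, Int.cast_mul, Int.cast_natCast, ← this, mul_assoc]
  have hdvd : Polynomial.cyclotomic s ℤ ∣ P := by
    rw [Polynomial.cyclotomic_eq_minpoly hζ hs.pos]
    exact minpoly.isIntegrallyClosed_dvd (hζ.isIntegral hs.pos) hP
  obtain ⟨Q, hQ⟩ := hdvd
  have hev : P.eval 1 = ∑ x ∈ S, (d x : ℤ) * e x := by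
    simp [P, Polynomial.eval_finsetSum]
  have := Fact.mk hs
  refine ⟨P.eval 1, ?_, ?_, ?_, ?_⟩
  · rw [hQ, Polynomial.eval_mul, Polynomial.eval_one_cyclotomic_prime]
    exact ⟨_, rfl⟩
  · rw [hev]
    refine (Finset.abs_sum_le_sum_abs _ _).trans (Finset.sum_le_sum fun x hx => ?_)
    rcases (hea x hx).2.1 with h | h <;> simp [h]
  · rw [hev, ← Finset.sum_sub_distrib]
    refine Finset.dvd_sum fun x hx => ?_
    rcases (hea x hx).2.1 with h | h <;> simp only [h]
    · simp
    · exact ⟨d x, by ring⟩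
  · intro h1
    rw [hev]
    refine Finset.sum_congr rfl fun x hx => ?_
    rw [(hea x hx).2.2 (h1 x hx), mul_one]

/-- Combination of `exists_spectrum` and root-of-unity arguments: an operator `F` with `F^M` equal,
up to nilpotents, to `μ` times a projection of rank `m`. -/
lemma exists_roots_of_pow {F : Module.End ℂ V} {M m : ℕ} {μ : ℂ} (hM : 0 < M) (hμ : μ ≠ 0)
    (hn : IsNilpotent (F ^ M * (F ^ M - algebraMap ℂ (Module.End ℂ V) μ)))
    (ht : LinearMap.trace ℂ V (F ^ M) = m * μ) (h0 : LinearMap.trace ℂ V F = 0) :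
    ∃ (S : Finset ℂ) (d : ℂ → ℕ), (∀ x ∈ S, x ^ M = 1) ∧ ∑ x ∈ S, (d x : ℤ) = m ∧
      ∑ x ∈ S, (d x : ℂ) * x = 0 := by
  classical
  obtain ⟨S, d, h1, h2⟩ := exists_spectrum F
  obtain ⟨c, hc⟩ := IsAlgClosed.exists_pow_nat_eq μ hM
  have hc0 : c ≠ 0 := by rintro rfl; exact hμ (by rw [← hc, zero_pow hM.ne'])
  have hx : ∀ x ∈ S, x = 0 ∨ x ^ M = μ := by
    intro x hx
    obtain ⟨v, hv⟩ := (h1 x hx).exists_hasEigenvector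
    obtain ⟨k, hk⟩ := hn
    have h3 : (F ^ M * (F ^ M - algebraMap ℂ (Module.End ℂ V) μ)) v = (x ^ M * (x ^ M - μ)) • v := by
      rw [Module.End.mul_apply, LinearMap.sub_apply, hv.pow_apply, Module.algebraMap_end_apply,
        ← sub_smul, map_smul, hv.pow_apply, smul_smul, mul_comm]
    have h4 : ∀ j, ((F ^ M * (F ^ M - algebraMap ℂ (Module.End ℂ V) μ)) ^ j) v =
        (x ^ M * (x ^ M - μ)) ^ j • v := by
      intro j
      induction j with
      | zero => simp
      | succ j ih => rw [pow_succ', Module.End.mul_apply, ih, map_smul, h3, smul_smul, pow_succ]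
    have h5 := h4 k
    rw [hk, LinearMap.zero_apply] at h5
    have h6 := eq_zero_of_pow_eq_zero ((smul_eq_zero.1 h5.symm).resolve_right hv.2)
    rcases mul_eq_zero.1 h6 with h7 | h7
    · exact Or.inl (eq_zero_of_pow_eq_zero h7)
    · exact Or.inr (sub_eq_zero.1 h7)
  have hsum : ∀ i, 0 < i → LinearMap.trace ℂ V (F ^ i) =
      ∑ x ∈ (S.erase 0).image (· / c), (d (x * c) : ℂ) * (x * c) ^ i := by
    intro i hi
    rw [h2, Finset.sum_image (by intro x _ y _ h; exact (div_left_inj' hc0).1 h)]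
    by_cases hz : (0 : ℂ) ∈ S
    · rw [← Finset.add_sum_erase _ _ hz, zero_pow hi.ne', mul_zero, zero_add]
      exact Finset.sum_congr rfl fun x _ => by rw [div_mul_cancel₀ _ hc0]
    · rw [Finset.erase_eq_of_notMem hz]
      exact Finset.sum_congr rfl fun x _ => by rw [div_mul_cancel₀ _ hc0]
  have hr : ∀ x ∈ (S.erase 0).image (· / c), x ^ M = 1 := by
    intro x hx'
    obtain ⟨y, hy, rfl⟩ := Finset.mem_image.1 hx'
    rw [Finset.mem_erase] at hy
    rw [div_pow, hc, (hx y hy.2).resolve_left hy.1, div_self hμ]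
  refine ⟨_, fun x => d (x * c), hr, ?_, ?_⟩
  · have h3 := hsum M hM
    rw [ht, Finset.sum_congr rfl (g := fun x => (d (x * c) : ℂ) * μ) (fun x hx => by
      rw [mul_pow, hr x hx, hc, one_mul]), ← Finset.sum_mul] at h3
    have := mul_right_cancel₀ hμ h3
    exact_mod_cast this.symm
  · have h3 := hsum 1 one_pos
    rw [pow_one, h0] at h3
    simp only [pow_one, ← mul_assoc, ← Finset.sum_mul] at h3
    exact (mul_eq_zero.1 h3.symm).resolve_right hc0

lemma le_of_roots_odd {F : Module.End ℂ V} {s m : ℕ} {μ : ℂ} (hs : s.Prime) (ho : Odd s)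
    (hμ : μ ≠ 0)
    (hn : IsNilpotent (F ^ (2 * s) * (F ^ (2 * s) - algebraMap ℂ (Module.End ℂ V) μ)))
    (ht : LinearMap.trace ℂ V (F ^ (2 * s)) = m * μ) (h0 : LinearMap.trace ℂ V F = 0)
    (hm : Odd m) : s ≤ m := by
  obtain ⟨S, d, h1, h2, h3⟩ := exists_roots_of_pow (mul_pos two_pos hs.pos) hμ hn ht h0
  obtain ⟨k, ⟨j, hj⟩, hk2, ⟨l, hl⟩, -⟩ := roots_sum hs ho S d h1 h3
  rw [h2] at hk2 hl
  obtain ⟨a, ha⟩ := hm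
  have hk0 : k ≠ 0 := by omega
  have hsk := Int.le_of_dvd (abs_pos.2 hk0) ((dvd_abs _ _).2 ⟨j, hj⟩)
  exact_mod_cast hsk.trans hk2

lemma dvd_of_roots {F : Module.End ℂ V} {s m : ℕ} {μ : ℂ} (hs : s.Prime) (ho : Odd s)
    (hμ : μ ≠ 0)
    (hn : IsNilpotent (F ^ s * (F ^ s - algebraMap ℂ (Module.End ℂ V) μ)))
    (ht : LinearMap.trace ℂ V (F ^ s) = m * μ) (h0 : LinearMap.trace ℂ V F = 0) : s ∣ m := by
  obtain ⟨S, d, h1, h2, h3⟩ := exists_roots_of_pow hs.pos hμ hn ht h0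
  obtain ⟨k, hk, -, -, h4⟩ := roots_sum hs ho S d
    (fun x hx => by rw [mul_comm, pow_mul, h1 x hx, one_pow]) h3
  rw [h4 h1, h2] at hk
  exact_mod_cast hk

end
end Sw

namespace Sw

/-- The irreducible representations of a finite-dimensional algebra, with primitive idempotents. -/
structure Irr (A : Type*) [Ring A] [Algebra ℂ A] where
  k : ℕ
  n : Fin k → ℕ
  ρ : ∀ i, A →ₐ[ℂ] Module.End ℂ (Fin (n i) → ℂ)
  surj : ∀ f : (∀ i, Module.End ℂ (Fin (n i) → ℂ)), ∃ a, ∀ i, ρ i a = f i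
  J : Ideal A
  memJ : ∀ a, a ∈ J ↔ ∀ i, ρ i a = 0
  nilp : IsNilpotent J
  e : Fin k → A
  idem : ∀ i, IsIdempotentElem (e i)
  v0 : ∀ i, Fin (n i) → ℂ
  ξ : ∀ i, Module.Dual ℂ (Fin (n i) → ℂ)
  hξ : ∀ i, ξ i (v0 i) = 1
  e_self : ∀ i v, ρ i (e i) v = ξ i v • v0 i
  e_ne : ∀ i j, i ≠ j → ρ j (e i) = 0

variable {A : Type*} [Ring A] [Algebra ℂ A]

lemma exists_irr [Module.Finite ℂ A] : Nonempty (Irr A) := by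
  classical
  have : IsArtinianRing A := IsArtinianRing.of_finite ℂ A
  have hnil : IsNilpotent (Ring.jacobson A) := IsSemiprimaryRing.isNilpotent
  obtain ⟨k, n, hn, ⟨E⟩⟩ := IsSemisimpleRing.exists_algEquiv_pi_matrix_of_isAlgClosed ℂ
    (A ⧸ Ring.jacobson A)
  let π : A →ₐ[ℂ] (A ⧸ Ring.jacobson A) := Ideal.Quotient.mkₐ ℂ (Ring.jacobson A)
  have hπ : Function.Surjective π := Ideal.Quotient.mkₐ_surjective _ _
  let pr : ∀ i, (∀ i, Matrix (Fin (n i)) (Fin (n i)) ℂ) →ₐ[ℂ] Module.End ℂ (Fin (n i) → ℂ) :=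
    fun i => (Matrix.toLinAlgEquiv' : _ ≃ₐ[ℂ] _).toAlgHom.comp (Pi.evalAlgHom ℂ _ i)
  let ρ : ∀ i, A →ₐ[ℂ] Module.End ℂ (Fin (n i) → ℂ) := fun i => (pr i).comp (E.toAlgHom.comp π)
  have hsurj : ∀ f : (∀ i, Module.End ℂ (Fin (n i) → ℂ)), ∃ a, ∀ i, ρ i a = f i := by
    intro f
    obtain ⟨a, ha⟩ := hπ (E.symm fun i => Matrix.toLinAlgEquiv'.symm (f i))
    refine ⟨a, fun i => ?_⟩
    change Matrix.toLinAlgEquiv' (E (π a) i) = f i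
    rw [ha, AlgEquiv.apply_symm_apply, AlgEquiv.apply_symm_apply]
  have hJ : ∀ a, a ∈ Ring.jacobson A ↔ ∀ i, ρ i a = 0 := by
    intro a
    rw [← Ideal.Quotient.eq_zero_iff_mem]
    change π a = 0 ↔ ∀ i, Matrix.toLinAlgEquiv' (E (π a) i) = 0
    constructor
    · intro h i; rw [h, map_zero]; simp
    · intro h
      rw [← map_eq_zero_iff E E.injective]
      funext i
      exact (map_eq_zero_iff _ (Matrix.toLinAlgEquiv' (R := ℂ) (n := Fin (n i))).injective).1 (h i)
  let Φ : A →+* (∀ i, Module.End ℂ (Fin (n i) → ℂ)) := RingHom.pi fun i => (ρ i).toRingHom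
  have hker : ∀ x ∈ RingHom.ker Φ, IsNilpotent x := by
    intro x hx
    obtain ⟨m, hm⟩ := hnil
    refine ⟨m, ?_⟩
    have h1 : x ∈ Ring.jacobson A := (hJ x).2 fun i => congrFun hx i
    have := Ideal.pow_mem_pow h1 m
    rwa [hm] at this
  let v0 : ∀ i, Fin (n i) → ℂ := fun i => Pi.single 0 1
  let ξ : ∀ i, Module.Dual ℂ (Fin (n i) → ℂ) := fun i => LinearMap.proj 0
  have hξ : ∀ i, ξ i (v0 i) = 1 := fun i => by simp [ξ, v0]
  let eb : ∀ i, ∀ j, Module.End ℂ (Fin (n j) → ℂ) := fun i => Pi.single i ((ξ i).smulRight (v0 i))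
  have heb : ∀ i, IsIdempotentElem (eb i) := by
    intro i
    change eb i * eb i = eb i
    rw [← Pi.single_mul]
    congr 1
    ext v
    simp [hξ]
  have : ∀ i, ∃ e : A, IsIdempotentElem e ∧ Φ e = eb i := fun i =>
    exists_isIdempotentElem_eq_of_ker_isNilpotent Φ hker (eb i)
      (by obtain ⟨a, ha⟩ := hsurj (eb i); exact ⟨a, funext ha⟩) (heb i)
  choose e he1 he2 using this
  exact ⟨⟨k, n, ρ, hsurj, Ring.jacobson A, hJ, hnil, e, he1, v0, ξ, hξ,
    fun i v => by
      have : ρ i (e i) = eb i i := congrFun (he2 i) i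
      rw [this]; simp [eb],
    fun i j hij => by
      have : ρ j (e i) = eb i j := congrFun (he2 i) j
      rw [this]; simp [eb, hij.symm]⟩⟩

namespace Irr
variable (I : Irr A)

/-- Representation space of the `i`-th irreducible representation. -/
abbrev V (i : Fin I.k) := Fin (I.n i) → ℂ

/-- Characters. -/
def chi (i : Fin I.k) : A →ₗ[ℂ] ℂ := LinearMap.trace ℂ (I.V i) ∘ₗ (I.ρ i).toLinearMap

lemma chi_apply (i) (a : A) : I.chi i a = LinearMap.trace ℂ (I.V i) (I.ρ i a) := rfl

lemma isNilpotent_of_mem {x : A} (hx : x ∈ I.J) : IsNilpotent x := by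
  obtain ⟨m, hm⟩ := I.nilp
  exact ⟨m, by have := Ideal.pow_mem_pow hx m; rwa [hm] at this⟩

lemma mem_mul_left {x : A} (hx : x ∈ I.J) (a : A) : a * x ∈ I.J := I.J.mul_mem_left a hx

lemma mem_mul_right {x : A} (hx : x ∈ I.J) (a : A) : x * a ∈ I.J :=
  (I.memJ _).2 fun i => by rw [map_mul, (I.memJ x).1 hx i, zero_mul]

lemma sub_mem {x y : A} (h : ∀ i, I.ρ i x = I.ρ i y) : x - y ∈ I.J :=
  (I.memJ _).2 fun i => by rw [map_sub, h, sub_self]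

lemma v0_ne (i) : I.v0 i ≠ 0 := by
  intro h; have := I.hξ i; rw [h, map_zero] at this; exact zero_ne_one this

lemma n_pos (i) : 0 < I.n i := by
  rcases Nat.eq_zero_or_pos (I.n i) with h | h
  · refine absurd ?_ (I.v0_ne i)
    funext x
    exact absurd x.2 (by omega)
  · exact h

lemma chi_one (i) : I.chi i 1 = I.n i := by simp [chi_apply]

lemma chi_mul (i) (a b : A) : I.chi i (a * b) = I.chi i (b * a) := by
  rw [chi_apply, chi_apply, map_mul (I.ρ i), map_mul (I.ρ i), LinearMap.trace_mul_comm]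

lemma chi_e (i j) : I.chi i (I.e j) = if i = j then 1 else 0 := by
  split_ifs with h
  · subst h
    have : I.ρ i (I.e i) = (I.ξ i).smulRight (I.v0 i) := by ext v; simp [I.e_self]
    rw [chi_apply, this, LinearMap.trace_smulRight, I.hξ]
  · rw [chi_apply, I.e_ne j i (Ne.symm h), map_zero]

lemma exists_unit (i) (v : I.V i) (φ : Module.Dual ℂ (I.V i)) :
    ∃ a : A, (∀ w, I.ρ i a w = φ w • v) ∧ ∀ j, j ≠ i → I.ρ j a = 0 := by
  classical
  obtain ⟨a, ha⟩ := I.surj (Pi.single i (φ.smulRight v))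
  exact ⟨a, fun w => by rw [ha]; simp, fun j hj => by rw [ha]; simp [hj]⟩

/-- Trace functions vanishing on the radical are combinations of irreducible characters. -/
lemma eq_sum_chi (f : A →ₗ[ℂ] ℂ) (hf : ∀ a b, f (a * b) = f (b * a)) (hJ : ∀ a ∈ I.J, f a = 0)
    (a : A) : f a = ∑ i, f (I.e i) * I.chi i a := by
  classical
  choose E hE1 hE2 using I.exists_unit
  have hfE : ∀ i v φ, f (E i v φ) = f (I.e i) * φ v := by
    intro i v φ
    have h1 : f (E i v φ) = f (E i v (I.ξ i) * I.e i * E i (I.v0 i) φ) := by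
      rw [← sub_eq_zero, ← map_sub]
      refine hJ _ (I.sub_mem fun j => ?_)
      by_cases hj : j = i
      · subst hj
        refine LinearMap.ext fun w => ?_
        refine funext fun x => ?_
        simp [hE1, I.e_self, I.hξ]
      · rw [map_mul, hE2 _ _ _ _ hj, hE2 _ _ _ _ hj, mul_zero]
    have h2 : f (I.e i * (E i (I.v0 i) φ * E i v (I.ξ i)) * I.e i) = φ v * f (I.e i) := by
      rw [← smul_eq_mul (φ v), ← map_smul, ← sub_eq_zero, ← map_sub]
      refine hJ _ (I.sub_mem fun j => ?_)
      by_cases hj : j = i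
      · subst hj
        refine LinearMap.ext fun w => ?_
        refine funext fun x => ?_
        simp [hE1, I.e_self, I.hξ]
        ring
      · rw [map_smul, map_mul, I.e_ne _ _ (Ne.symm hj), mul_zero, smul_zero]
    have h3 : E i v (I.ξ i) * I.e i * E i (I.v0 i) φ =
        (E i v (I.ξ i) * I.e i) * (I.e i * E i (I.v0 i) φ) := by
      rw [mul_assoc, mul_assoc, ← mul_assoc (I.e i) (I.e i), (I.idem i).eq]
    rw [h1, h3, hf, mul_comm (f _), ← h2]
    simp only [mul_assoc]
  have h4 : f a = f (∑ i, ∑ l : Fin (I.n i), E i (I.ρ i a (Pi.single l 1)) (LinearMap.proj l)) := by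
    rw [← sub_eq_zero, ← map_sub]
    refine hJ _ (I.sub_mem fun j => ?_)
    rw [map_sum, Finset.sum_eq_single_of_mem j (Finset.mem_univ _) (fun i _ hij => by
      rw [map_sum]; exact Finset.sum_eq_zero fun l _ => hE2 _ _ _ _ hij.symm)]
    refine LinearMap.ext fun w => ?_
    rw [map_sum, LinearMap.sum_apply]
    simp only [hE1]
    conv_lhs => rw [← LinearMap.sum_single_apply (φ := fun _ : Fin (I.n j) => ℂ) w]
    rw [map_sum]
    refine Finset.sum_congr rfl fun l _ => ?_
    rw [LinearMap.proj_apply, ← map_smul]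
    congr 1
    rw [← Pi.single_smul]; simp
  rw [h4, map_sum]
  refine Finset.sum_congr rfl fun i _ => ?_
  rw [map_sum]
  simp only [hfE]
  rw [← Finset.mul_sum]
  congr 1
  rw [chi_apply, LinearMap.trace_eq_matrix_trace ℂ (Pi.basisFun ℂ (Fin (I.n i)))]
  simp [Matrix.trace, LinearMap.toMatrix_apply]

/-- Every surjective representation is one of the `ρ i`. -/
lemma exists_conj {W : Type*} [AddCommGroup W] [Module ℂ W] [Nontrivial W]
    (σ : A →ₐ[ℂ] Module.End ℂ W) (hσ : Function.Surjective σ) :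
    ∃ i, ∃ φ : I.V i ≃ₗ[ℂ] W, ∀ a v, σ a (φ v) = φ (I.ρ i a v) := by
  classical
  have trans : ∀ w w' : W, w ≠ 0 → ∃ b, σ b w = w' := by
    intro w w' hw
    obtain ⟨φ, hφ⟩ := Module.Projective.exists_dual_eq_one ℂ hw
    obtain ⟨b, hb⟩ := hσ (φ.smulRight w')
    exact ⟨b, by rw [hb]; simp [hφ]⟩
  have hσJ : ∀ x ∈ I.J, σ x = 0 := by
    intro x hx
    ext w
    by_contra h
    obtain ⟨b, hb⟩ := trans _ w h
    obtain ⟨m, hm⟩ := I.isNilpotent_of_mem (I.mem_mul_left hx b)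
    have h1 : ∀ j, σ ((b * x) ^ j) w = w := by
      intro j
      induction j with
      | zero => simp
      | succ j ih => rw [pow_succ, map_mul, Module.End.mul_apply, map_mul, Module.End.mul_apply, hb, ih]
    have h2 := h1 m
    rw [hm, map_zero] at h2
    apply h
    rw [← h2]; simp
  obtain ⟨i, hi⟩ : ∃ i, σ (I.e i) ≠ 0 := by
    by_contra! hcon
    choose E hE1 hE2 using I.exists_unit
    have hE : ∀ i v φ, σ (E i v φ) = 0 := by
      intro i v φ
      have h1 : σ (E i v φ - E i v (I.ξ i) * I.e i * E i (I.v0 i) φ) = 0 := by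
        refine hσJ _ (I.sub_mem fun j => ?_)
        by_cases hj : j = i
        · subst hj
          refine LinearMap.ext fun w => ?_
          refine funext fun x => ?_
          simp [hE1, I.e_self, I.hξ]
        · rw [map_mul, hE2 _ _ _ _ hj, hE2 _ _ _ _ hj, mul_zero]
      rw [map_sub, map_mul, map_mul, hcon] at h1
      simpa using h1
    have h2 : σ (1 - ∑ i, ∑ l : Fin (I.n i), E i (Pi.single l 1) (LinearMap.proj l)) = 0 := by
      refine hσJ _ (I.sub_mem fun j => ?_)
      rw [map_sum, Finset.sum_eq_single_of_mem j (Finset.mem_univ _) (fun i _ hij => by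
        rw [map_sum]; exact Finset.sum_eq_zero fun l _ => hE2 _ _ _ _ hij.symm)]
      refine LinearMap.ext fun w => ?_
      rw [map_sum, LinearMap.sum_apply]
      simp only [hE1, map_one, Module.End.one_apply]
      conv_lhs => rw [← LinearMap.sum_single_apply (φ := fun _ : Fin (I.n j) => ℂ) w]
      refine Finset.sum_congr rfl fun l _ => ?_
      rw [LinearMap.proj_apply, ← Pi.single_smul]; simp
    rw [map_sub, map_sum] at h2
    simp only [map_sum, hE, Finset.sum_const_zero, sub_zero, map_one] at h2
    exact one_ne_zero h2
  obtain ⟨w, hw⟩ : ∃ w, σ (I.e i) w ≠ 0 := by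
    by_contra! h
    exact hi (LinearMap.ext h)
  set w0 := σ (I.e i) w with hw0
  have hew : σ (I.e i) w0 = w0 := by
    rw [hw0, ← Module.End.mul_apply, ← map_mul, (I.idem i).eq]
  have hkill : ∀ a, I.ρ i a (I.v0 i) = 0 → σ a w0 = 0 := by
    intro a ha
    have : σ (a * I.e i) = 0 := by
      refine hσJ _ ((I.memJ _).2 fun j => ?_)
      by_cases hj : j = i
      · subst hj
        refine LinearMap.ext fun v => ?_
        rw [map_mul, Module.End.mul_apply, I.e_self, map_smul, ha, smul_zero]; rfl
      · rw [map_mul, I.e_ne _ _ (Ne.symm hj), mul_zero]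
    rw [← hew, ← Module.End.mul_apply, ← map_mul, this]; rfl
  let ev : A →ₗ[ℂ] I.V i := (LinearMap.applyₗ (I.v0 i)) ∘ₗ (I.ρ i).toLinearMap
  have hev : ∀ a, ev a = I.ρ i a (I.v0 i) := fun _ => rfl
  have hevs : Function.Surjective ev := by
    intro v
    obtain ⟨a, ha, -⟩ := I.exists_unit i v (I.ξ i)
    exact ⟨a, by rw [hev, ha, I.hξ, one_smul]⟩
  obtain ⟨s, hs⟩ := ev.exists_rightInverse_of_surjective (LinearMap.range_eq_top.2 hevs)
  have hs' : ∀ v, I.ρ i (s v) (I.v0 i) = v := fun v => LinearMap.congr_fun hs v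
  let φ : I.V i →ₗ[ℂ] W := (LinearMap.applyₗ w0) ∘ₗ σ.toLinearMap ∘ₗ s
  have hφ : ∀ v, φ v = σ (s v) w0 := fun _ => rfl
  have hint : ∀ a v, σ a (φ v) = φ (I.ρ i a v) := by
    intro a v
    rw [hφ, hφ, ← sub_eq_zero, ← Module.End.mul_apply, ← map_mul, ← LinearMap.sub_apply, ← map_sub]
    apply hkill
    rw [map_sub, LinearMap.sub_apply, hs', map_mul, Module.End.mul_apply, hs', sub_self]
  have hφ0 : φ (I.v0 i) = w0 := by
    have := hkill (s (I.v0 i) - 1) (by rw [map_sub, LinearMap.sub_apply, hs']; simp)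
    rw [map_sub, LinearMap.sub_apply, sub_eq_zero] at this
    rw [hφ, this]; simp
  have hinj : Function.Injective φ := by
    rw [injective_iff_map_eq_zero]
    intro v hv
    by_contra h
    obtain ⟨ψ, hψ⟩ := Module.Projective.exists_dual_eq_one ℂ h
    obtain ⟨a, ha, -⟩ := I.exists_unit i (I.v0 i) ψ
    have := hint a v
    rw [hv, map_zero, ha, hψ, one_smul, hφ0] at this
    exact hw this.symm
  have hsurj : Function.Surjective φ := by
    intro w'
    obtain ⟨b, hb⟩ := trans w0 w' hw
    exact ⟨I.ρ i b (I.v0 i), by rw [← hint, hφ0, hb]⟩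
  exact ⟨i, LinearEquiv.ofBijective φ ⟨hinj, hsurj⟩, hint⟩

end Irr
end Sw

namespace Sw

section
variable {A M M' : Type*} [AddCommGroup A] [Module ℂ A] [AddCommGroup M] [Module ℂ M]
  [AddCommGroup M'] [Module ℂ M']

/-- A function of two variables that is linear in each of them. -/
structure Bil (F : A → A → M) : Prop where
  addl : ∀ x x' y, F (x + x') y = F x y + F x' y
  addr : ∀ x y y', F x (y + y') = F x y + F x y'
  smull : ∀ (c : ℂ) x y, F (c • x) y = c • F x y
  smulr : ∀ (c : ℂ) x y, F x (c • y) = c • F x y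

/-- The bilinear map underlying a `Bil` function. -/
def Bil.toLin {F : A → A → M} (h : Bil F) : A ⊗[ℂ] A →ₗ[ℂ] M :=
  TensorProduct.lift (LinearMap.mk₂ ℂ F h.addl h.smull h.addr h.smulr)

@[simp] lemma Bil.toLin_tmul {F : A → A → M} (h : Bil F) (x y : A) :
    h.toLin (x ⊗ₜ y) = F x y := by simp [Bil.toLin]

/-- A function of three variables that is linear in each of them. -/
structure Tri (F : A → A → A → M) : Prop where
  add1 : ∀ x x' y z, F (x + x') y z = F x y z + F x' y z
  smul1 : ∀ (c : ℂ) x y z, F (c • x) y z = c • F x y z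
  add2 : ∀ x y y' z, F x (y + y') z = F x y z + F x y' z
  smul2 : ∀ (c : ℂ) x y z, F x (c • y) z = c • F x y z
  add3 : ∀ x y z z', F x y (z + z') = F x y z + F x y z'
  smul3 : ∀ (c : ℂ) x y z, F x y (c • z) = c • F x y z

/-- The trilinear map underlying a `Tri` function. -/
def Tri.toLin {F : A → A → A → M} (h : Tri F) : A ⊗[ℂ] (A ⊗[ℂ] A) →ₗ[ℂ] M :=
  TensorProduct.lift
    { toFun := fun x => Bil.toLin (F := F x) ⟨h.add2 x, h.add3 x,
        fun c => h.smul2 c x, fun c => h.smul3 c x⟩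
      map_add' := fun x x' => by
        apply TensorProduct.ext'; intro y z; simp [h.add1]
      map_smul' := fun c x => by
        apply TensorProduct.ext'; intro y z; simp [h.smul1] }

@[simp] lemma Tri.toLin_tmul {F : A → A → A → M} (h : Tri F) (x y z : A) :
    h.toLin (x ⊗ₜ (y ⊗ₜ z)) = F x y z := by simp [Tri.toLin]

variable [Coalgebra ℂ A]

/-- Sweedler summation: `sw a F` is `∑ F a₁ a₂`. -/
def sw (a : A) (F : A → A → M) : M :=
  ∑ i ∈ (Repr.arbitrary ℂ a).index, F ((Repr.arbitrary ℂ a).left i) ((Repr.arbitrary ℂ a).right i)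

lemma sw_eq (a : A) {F : A → A → M} (h : Bil F) : sw a F = h.toLin (comul a) := by
  conv_rhs => rw [← (Repr.arbitrary ℂ a).eq]
  simp [sw, map_sum]

lemma sw_add {F : A → A → M} (h : Bil F) (a b : A) : sw (a + b) F = sw a F + sw b F := by
  simp [sw_eq _ h]

lemma sw_smul {F : A → A → M} (h : Bil F) (c : ℂ) (a : A) : sw (c • a) F = c • sw a F := by
  simp [sw_eq _ h]

lemma sw_add_fun (a : A) (F G : A → A → M) :
    sw a (fun x y => F x y + G x y) = sw a F + sw a G := Finset.sum_add_distrib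

lemma sw_smul_fun (a : A) (c : ℂ) (F : A → A → M) :
    sw a (fun x y => c • F x y) = c • sw a F := by simp [sw, Finset.smul_sum]

lemma map_sw {F' : Type*} [FunLike F' M M'] [AddMonoidHomClass F' M M'] (f : F') (a : A)
    (F : A → A → M) : f (sw a F) = sw a (fun x y => f (F x y)) := by
  simp [sw, map_sum]

lemma sw_comm (a b : A) (F : A → A → A → A → M) :
    sw a (fun x y => sw b (fun u v => F x y u v)) =
      sw b (fun u v => sw a (fun x y => F x y u v)) := Finset.sum_comm

lemma sw_congr {a : A} {F G : A → A → M} (h : ∀ x y, F x y = G x y) : sw a F = sw a G := by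
  simp [sw, h]

/-- Coassociativity. -/
lemma sw_assoc (a : A) {F : A → A → A → M} (h : Tri F) :
    sw a (fun x z => sw x (fun u v => F u v z)) = sw a (fun x z => sw z (fun u v => F x u v)) := by
  have := congrArg h.toLin (sum_tmul_tmul_eq (Repr.arbitrary ℂ a)
    (fun i => Repr.arbitrary ℂ _) (fun i => Repr.arbitrary ℂ _))
  simpa [map_sum, sw] using this

lemma sw_counit_left (f : A →ₗ[ℂ] M) (a : A) :
    sw a (fun x y => counit (R := ℂ) x • f y) = f a := by
  conv_rhs => rw [← sum_counit_smul (Repr.arbitrary ℂ a)]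
  simp [sw, map_sum]

lemma sw_counit_right (f : A →ₗ[ℂ] M) (a : A) :
    sw a (fun x y => counit (R := ℂ) y • f x) = f a := by
  have := congrArg (TensorProduct.lift ((LinearMap.lsmul ℂ M).flip ∘ₗ f))
    (lTensor_counit_comul (R := ℂ) a)
  rw [← (Repr.arbitrary ℂ a).eq] at this
  simp only [map_sum, LinearMap.lTensor_tmul, TensorProduct.lift.tmul, LinearMap.comp_apply,
    LinearMap.flip_apply, LinearMap.lsmul_apply, one_smul] at this
  exact this

lemma sw_counit_left' (a : A) : sw a (fun x y => counit (R := ℂ) x • y) = a :=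
  sw_counit_left LinearMap.id a

lemma sw_counit_right' (a : A) : sw a (fun x y => counit (R := ℂ) y • x) = a :=
  sw_counit_right LinearMap.id a

lemma comul_eq_sw (a : A) : comul (R := ℂ) a = sw a (fun x y => x ⊗ₜ[ℂ] y) :=
  ((Repr.arbitrary ℂ a).eq).symm

lemma ext_sw {a : A} {t : A ⊗[ℂ] A} (e : comul (R := ℂ) a = t) {F : A → A → M} (h : Bil F) :
    sw a F = h.toLin t := by rw [sw_eq _ h, e]

end

section
variable {A M : Type*} [Ring A] [HopfAlgebra ℂ A] [AddCommGroup M] [Module ℂ M]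

scoped instance hopfModule {A : Type*} [Ring A] [HopfAlgebra ℂ A] : Module ℂ A := Algebra.toModule

scoped instance hopfMulAction {A : Type*} [Ring A] [HopfAlgebra ℂ A] : MulAction ℂ A :=
  hopfModule.toDistribMulAction.toMulAction

lemma mul_sw (b a : A) (F : A → A → A) : b * sw a F = sw a (fun x y => b * F x y) := by
  simp [sw, Finset.mul_sum]

lemma sw_mul' (b a : A) (F : A → A → A) : sw a F * b = sw a (fun x y => F x y * b) := by
  simp [sw, Finset.sum_mul]

lemma sw_mul {F : A → A → M} (h : Bil F) (a b : A) :
    sw (a * b) F = sw a (fun x y => sw b (fun u v => F (x * u) (y * v))) := by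
  rw [sw_eq _ h, Bialgebra.comul_mul, comul_eq_sw a, comul_eq_sw b]
  simp [sw, Finset.sum_mul_sum, map_sum]

lemma sw_one {F : A → A → M} (h : Bil F) : sw (1 : A) F = F 1 1 := by
  rw [sw_eq _ h, Bialgebra.comul_one, Algebra.TensorProduct.one_def]; simp

lemma sw_antipode_left (f : A →ₗ[ℂ] M) (a : A) :
    sw a (fun x y => f (antipode ℂ x * y)) = counit (R := ℂ) a • f 1 := by
  rw [← map_smul, ← sum_antipode_mul_eq_smul (Repr.arbitrary ℂ a)]; simp [sw, map_sum]

lemma sw_antipode_right (f : A →ₗ[ℂ] M) (a : A) :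
    sw a (fun x y => f (x * antipode ℂ y)) = counit (R := ℂ) a • f 1 := by
  rw [← map_smul, ← sum_mul_antipode_eq_smul (Repr.arbitrary ℂ a)]; simp [sw, map_sum]

lemma sw_antipode_left' (a : A) :
    sw a (fun x y => antipode ℂ x * y) = counit (R := ℂ) a • 1 :=
  sw_antipode_left LinearMap.id a

lemma sw_antipode_right' (a : A) :
    sw a (fun x y => x * antipode ℂ y) = counit (R := ℂ) a • 1 :=
  sw_antipode_right LinearMap.id a

end
end Sw

namespace Sw
variable {A W : Type*} [Ring A] [HopfAlgebra ℂ A] [AddCommGroup W] [Module ℂ W]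

lemma counit_algHom (β : A →ₐ[ℂ] ℂ) (a : A) : sw a (fun x y => β (antipode ℂ x) * β y) = counit (R := ℂ) a := by
  simpa using sw_antipode_left β.toLinearMap a

lemma counit_algHom' (β : A →ₐ[ℂ] ℂ) (a : A) : sw a (fun x y => β x * β (antipode ℂ y)) = counit (R := ℂ) a := by
  simpa using sw_antipode_right β.toLinearMap a

/-- `a ↦ β(a₁) a₂` -/
def ell (β : A →ₐ[ℂ] ℂ) : A →ₐ[ℂ] A :=
  AlgHom.ofLinearMap
    { toFun := fun a => sw a fun x y => β x • y
      map_add' := fun a b => sw_add (by constructor <;> intros <;> simp [add_smul, smul_smul, mul_comm]) a b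
      map_smul' := fun c a => sw_smul (by constructor <;> intros <;> simp [add_smul, smul_smul, mul_comm]) c a }
    (by
      simp only [LinearMap.coe_mk, AddHom.coe_mk]
      rw [sw_one (by constructor <;> intros <;> simp [add_smul, smul_smul, mul_comm])]; simp)
    (by
      intro a b
      simp only [LinearMap.coe_mk, AddHom.coe_mk]
      rw [sw_mul (by constructor <;> intros <;> simp [add_smul, smul_smul, mul_comm]), sw_mul']
      simp only [mul_sw]
      refine sw_congr fun x y => sw_congr fun u v => ?_
      simp [smul_smul, mul_comm])

/-- `a ↦ a₁ β(a₂)` -/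
def arr (β : A →ₐ[ℂ] ℂ) : A →ₐ[ℂ] A :=
  AlgHom.ofLinearMap
    { toFun := fun a => sw a fun x y => β y • x
      map_add' := fun a b => sw_add (by constructor <;> intros <;> simp [add_smul, smul_smul, mul_comm]) a b
      map_smul' := fun c a => sw_smul (by constructor <;> intros <;> simp [add_smul, smul_smul, mul_comm]) c a }
    (by
      simp only [LinearMap.coe_mk, AddHom.coe_mk]
      rw [sw_one (by constructor <;> intros <;> simp [add_smul, smul_smul, mul_comm])]; simp)
    (by
      intro a b
      simp only [LinearMap.coe_mk, AddHom.coe_mk]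
      rw [sw_mul (by constructor <;> intros <;> simp [add_smul, smul_smul, mul_comm]), sw_mul']
      simp only [mul_sw]
      refine sw_congr fun x y => sw_congr fun u v => ?_
      simp [smul_smul, mul_comm])

lemma ell_apply (β : A →ₐ[ℂ] ℂ) (a : A) : ell β a = sw a fun x y => β x • y := rfl
lemma arr_apply (β : A →ₐ[ℂ] ℂ) (a : A) : arr β a = sw a fun x y => β y • x := rfl

/-- Sweedler sums of `ell β a`. -/
lemma sw_ell {M : Type*} [AddCommGroup M] [Module ℂ M] (β : A →ₐ[ℂ] ℂ) (a : A) {F : A → A → M}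
    (h : Bil F) : sw (ell β a) F = sw a fun x y => F (ell β x) y := by
  obtain ⟨h1, h2, h3, h4⟩ := h
  have e1 : sw (ell β a) F = sw a fun x y => sw y fun u v => β x • F u v := by
    rw [sw_eq _ ⟨h1, h2, h3, h4⟩, ell_apply, map_sw, map_sw]
    refine sw_congr fun x y => ?_
    rw [sw_smul_fun, sw_eq y ⟨h1, h2, h3, h4⟩]; simp
  rw [e1, ← sw_assoc]
  · refine sw_congr fun x y => ?_
    rw [ell_apply]
    have := map_sw (M' := M) (⟨⟨fun z => F z y, by simp [h1]⟩, by simp [h3]⟩ : A →ₗ[ℂ] M) x (fun x y => β x • y)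
    simp only [LinearMap.coe_mk, AddHom.coe_mk, h3] at this
    exact this.symm
  · constructor <;> intros <;> simp [h1, h2, h3, h4, add_smul, smul_smul, mul_comm]

lemma sw_arr {M : Type*} [AddCommGroup M] [Module ℂ M] (β : A →ₐ[ℂ] ℂ) (a : A) {F : A → A → M}
    (h : Bil F) : sw (arr β a) F = sw a fun x y => F x (arr β y) := by
  obtain ⟨h1, h2, h3, h4⟩ := h
  have e1 : sw (arr β a) F = sw a fun x y => sw x fun u v => β y • F u v := by
    rw [sw_eq _ ⟨h1, h2, h3, h4⟩, arr_apply, map_sw, map_sw]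
    refine sw_congr fun x y => ?_
    rw [sw_smul_fun, sw_eq x ⟨h1, h2, h3, h4⟩]; simp
  rw [e1, sw_assoc]
  · refine sw_congr fun x y => ?_
    rw [arr_apply]
    have := map_sw (M' := M) (⟨⟨fun z => F x z, by simp [h2]⟩, by simp [h4]⟩ : A →ₗ[ℂ] M) y (fun x y => β y • x)
    simp only [LinearMap.coe_mk, AddHom.coe_mk, h4] at this
    exact this.symm
  · constructor <;> intros <;> simp [h1, h2, h3, h4, add_smul, smul_smul, mul_comm]

lemma counit_ell (β : A →ₐ[ℂ] ℂ) (a : A) : counit (R := ℂ) (ell β a) = β a := by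
  rw [ell_apply, map_sw]
  simpa [mul_comm] using sw_counit_right β.toLinearMap a

lemma counit_arr (β : A →ₐ[ℂ] ℂ) (a : A) : counit (R := ℂ) (arr β a) = β a := by
  rw [arr_apply, map_sw]
  simpa [mul_comm] using sw_counit_left β.toLinearMap a

/-- Reduce a multilinearity goal. -/
lemma ell_arr (β γ : A →ₐ[ℂ] ℂ) (a : A) : ell β (arr γ a) = arr γ (ell β a) := by
  rw [ell_apply, sw_arr _ _ (by constructor <;> intros <;> simp [add_smul, smul_smul, mul_comm]),
    ell_apply, map_sw]
  simp

/-- The convolution inverse `β ∘ S` of a character. -/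
def cinv (β : A →ₐ[ℂ] ℂ) : A →ₐ[ℂ] ℂ :=
  AlgHom.ofLinearMap (β.toLinearMap ∘ₗ antipode ℂ) (by simp)
    (by intro a b; simp [HopfAlgebra.antipode_mul_antidistrib, mul_comm])

lemma cinv_apply (β : A →ₐ[ℂ] ℂ) (a : A) : cinv β a = β (antipode ℂ a) := rfl

lemma ell_ell (β γ : A →ₐ[ℂ] ℂ) (a : A) :
    ell β (ell γ a) = sw a fun x y => (β (ell γ x)) • y := by
  rw [ell_apply, sw_ell _ _ (by constructor <;> intros <;> simp [add_smul, smul_smul, mul_comm])]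

lemma arr_arr (β γ : A →ₐ[ℂ] ℂ) (a : A) :
    arr β (arr γ a) = sw a fun x y => (β (arr γ y)) • x := by
  rw [arr_apply, sw_arr _ _ (by constructor <;> intros <;> simp [add_smul, smul_smul, mul_comm])]

lemma ell_cinv_ell (β : A →ₐ[ℂ] ℂ) (a : A) : ell (cinv β) (ell β a) = a := by
  rw [ell_ell]
  conv_rhs => rw [← sw_counit_left' a]
  refine sw_congr fun x y => ?_
  rw [← counit_algHom' β x, ell_apply, map_sw]
  simp [cinv_apply]

lemma ell_ell_cinv (β : A →ₐ[ℂ] ℂ) (a : A) : ell β (ell (cinv β) a) = a := by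
  rw [ell_ell]
  conv_rhs => rw [← sw_counit_left' a]
  refine sw_congr fun x y => ?_
  rw [← counit_algHom β x, ell_apply, map_sw]
  simp [cinv_apply]

lemma arr_cinv_arr (β : A →ₐ[ℂ] ℂ) (a : A) : arr (cinv β) (arr β a) = a := by
  rw [arr_arr]
  conv_rhs => rw [← sw_counit_right' a]
  refine sw_congr fun x y => ?_
  rw [← counit_algHom β y, arr_apply, map_sw]
  simp [cinv_apply, mul_comm]

lemma arr_arr_cinv (β : A →ₐ[ℂ] ℂ) (a : A) : arr β (arr (cinv β) a) = a := by
  rw [arr_arr]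
  conv_rhs => rw [← sw_counit_right' a]
  refine sw_congr fun x y => ?_
  rw [← counit_algHom' β y, arr_apply, map_sw]
  simp [cinv_apply, mul_comm]

/-- `ell` as an automorphism. -/
def ellE (β : A →ₐ[ℂ] ℂ) : A ≃ₐ[ℂ] A :=
  AlgEquiv.ofAlgHom (ell β) (ell (cinv β)) (AlgHom.ext (ell_ell_cinv β)) (AlgHom.ext (ell_cinv_ell β))

/-- `arr` as an automorphism. -/
def arrE (β : A →ₐ[ℂ] ℂ) : A ≃ₐ[ℂ] A :=
  AlgEquiv.ofAlgHom (arr β) (arr (cinv β)) (AlgHom.ext (arr_arr_cinv β)) (AlgHom.ext (arr_cinv_arr β))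

@[simp] lemma ellE_apply (β : A →ₐ[ℂ] ℂ) (a : A) : ellE β a = ell β a := rfl
@[simp] lemma arrE_apply (β : A →ₐ[ℂ] ℂ) (a : A) : arrE β a = arr β a := rfl

/-- Uniqueness of convolution inverses. -/
lemma conv_inv_unique {B : Type*} [Ring B] [Algebra ℂ B] (f g h : A →ₗ[ℂ] B)
    (h1 : ∀ a, sw a (fun x y => f x * g y) = counit (R := ℂ) a • 1)
    (h2 : ∀ a, sw a (fun x y => g x * h y) = counit (R := ℂ) a • 1) : f = h := by
  ext a
  have e := sw_assoc a (F := fun u v w => f u * g v * h w)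
    (by constructor <;> intros <;> simp [mul_add, add_mul])
  have e1 : ∀ x z : A, sw x (fun u v => f u * g v * h z) = counit (R := ℂ) x • h z := by
    intro x z
    have := h1 x
    apply_fun (· * h z) at this
    simpa [sw, Finset.sum_mul] using this
  have e2 : ∀ x z : A, sw z (fun u v => f x * g u * h v) = counit (R := ℂ) z • f x := by
    intro x z
    have := h2 z
    apply_fun (f x * ·) at this
    simpa [sw, Finset.mul_sum, mul_assoc] using this
  simp only [e1, e2] at e
  rw [sw_counit_left, sw_counit_right] at e
  exact e.symm

lemma ell_antipode (β : A →ₐ[ℂ] ℂ) (a : A) :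
    ell β (antipode ℂ a) = antipode ℂ (arr (cinv β) a) := by
  have := conv_inv_unique (antipode ℂ ∘ₗ (arr (cinv β)).toLinearMap) (ell β).toLinearMap
    ((ell β).toLinearMap ∘ₗ antipode ℂ) ?_ ?_
  · exact (congrArg (fun f => f a) this).symm
  · intro a
    simp only [LinearMap.comp_apply, AlgHom.toLinearMap_apply]
    rw [← sw_antipode_left' a]
    have e2 := sw_assoc a (F := fun u v w => cinv β v • (antipode ℂ u * ell β w))
      (by constructor <;> intros <;> simp [mul_add, add_mul, add_smul, smul_smul, mul_comm])
    have e3 : ∀ x z : A, sw x (fun u v => cinv β v • (antipode ℂ u * ell β z)) = antipode ℂ (arr (cinv β) x) * ell β z := by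
      intro x z
      rw [arr_apply, map_sw, sw_mul']; simp
    simp only [e3] at e2
    rw [e2]
    refine sw_congr fun x y => ?_
    conv_rhs => rw [← ell_ell_cinv β y]
    rw [ell_apply (cinv β), map_sw, mul_sw]
    simp
  · intro a
    have := sw_antipode_right (ell β).toLinearMap a
    simpa using this

lemma arr_antipode (β : A →ₐ[ℂ] ℂ) (a : A) :
    arr β (antipode ℂ a) = antipode ℂ (ell (cinv β) a) := by
  have := conv_inv_unique ((arr β).toLinearMap ∘ₗ antipode ℂ) (arr β).toLinearMap
    (antipode ℂ ∘ₗ (ell (cinv β)).toLinearMap) ?_ ?_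
  · exact (congrArg (fun f => f a) this)
  · intro a
    have := sw_antipode_left (arr β).toLinearMap a
    simpa using this
  · intro a
    simp only [LinearMap.comp_apply, AlgHom.toLinearMap_apply]
    rw [← sw_antipode_right' a]
    have e2 := sw_assoc a (F := fun u v w => cinv β v • (arr β u * antipode ℂ w))
      (by constructor <;> intros <;> simp [mul_add, add_mul, add_smul, smul_smul, mul_comm])
    have e3 : ∀ x z : A, sw z (fun u v => cinv β u • (arr β x * antipode ℂ v)) = arr β x * antipode ℂ (ell (cinv β) z) := by
      intro x z
      rw [ell_apply, map_sw, mul_sw]; simp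
    simp only [e3] at e2
    rw [← e2]
    refine sw_congr fun x y => ?_
    conv_rhs => rw [← arr_arr_cinv β x]
    rw [arr_apply (cinv β), map_sw, sw_mul']
    simp

lemma cinv_cinv (β : A →ₐ[ℂ] ℂ) : cinv (cinv β) = β := by
  have := conv_inv_unique β.toLinearMap (cinv β).toLinearMap (cinv (cinv β)).toLinearMap
    (fun a => by simpa [cinv_apply] using counit_algHom' β a)
    (fun a => by simpa [cinv_apply] using counit_algHom' (cinv β) a)
  exact (AlgHom.toLinearMap_injective this).symm

lemma ell_antipode_sq (β : A →ₐ[ℂ] ℂ) (a : A) :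
    ell β (antipode ℂ (antipode ℂ a)) = antipode ℂ (antipode ℂ (ell β a)) := by
  rw [ell_antipode, arr_antipode, cinv_cinv]

lemma arr_antipode_sq (β : A →ₐ[ℂ] ℂ) (a : A) :
    arr β (antipode ℂ (antipode ℂ a)) = antipode ℂ (antipode ℂ (arr β a)) := by
  rw [arr_antipode, ell_antipode, cinv_cinv]

end Sw

namespace Sw
variable {A W : Type*} [Ring A] [HopfAlgebra ℂ A] [AddCommGroup W] [Module ℂ W]

/-- `a ⊗ w ↦ a₁ ⊗ φ(a₂) w` -/
def th (φ : A →ₗ[ℂ] Module.End ℂ W) : A ⊗[ℂ] W →ₗ[ℂ] A ⊗[ℂ] W :=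
  TensorProduct.lift (LinearMap.mk₂ ℂ (fun a w => sw a fun x y => x ⊗ₜ[ℂ] φ y w)
    (fun a b w => sw_add (by constructor <;> intros <;> simp [TensorProduct.add_tmul, TensorProduct.tmul_add, TensorProduct.smul_tmul']) a b)
    (fun c a w => sw_smul (by constructor <;> intros <;> simp [TensorProduct.add_tmul, TensorProduct.tmul_add, TensorProduct.smul_tmul']) c a)
    (fun a w w' => by simp [TensorProduct.tmul_add, sw_add_fun])
    (fun c a w => by simp [sw_smul_fun]))

lemma th_tmul (φ : A →ₗ[ℂ] Module.End ℂ W) (a : A) (w : W) :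
    th φ (a ⊗ₜ w) = sw a fun x y => x ⊗ₜ[ℂ] φ y w := by simp [th]

/-- `a ⊗ w ↦ a₂ ⊗ φ(a₁) w` -/
def th' (φ : A →ₗ[ℂ] Module.End ℂ W) : A ⊗[ℂ] W →ₗ[ℂ] A ⊗[ℂ] W :=
  TensorProduct.lift (LinearMap.mk₂ ℂ (fun a w => sw a fun x y => y ⊗ₜ[ℂ] φ x w)
    (fun a b w => sw_add (by constructor <;> intros <;> simp [TensorProduct.add_tmul, TensorProduct.tmul_add, TensorProduct.smul_tmul']) a b)
    (fun c a w => sw_smul (by constructor <;> intros <;> simp [TensorProduct.add_tmul, TensorProduct.tmul_add, TensorProduct.smul_tmul']) c a)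
    (fun a w w' => by simp [TensorProduct.tmul_add, sw_add_fun])
    (fun c a w => by simp [sw_smul_fun]))

lemma th'_tmul (φ : A →ₗ[ℂ] Module.End ℂ W) (a : A) (w : W) :
    th' φ (a ⊗ₜ w) = sw a fun x y => y ⊗ₜ[ℂ] φ x w := by simp [th']

lemma th_comp (φ ψ : A →ₗ[ℂ] Module.End ℂ W)
    (h : ∀ a, sw a (fun x y => φ x * ψ y) = counit (R := ℂ) a • 1) : th φ ∘ₗ th ψ = LinearMap.id := by
  apply TensorProduct.ext'
  intro a w
  simp only [LinearMap.comp_apply, th_tmul, map_sw, LinearMap.id_apply]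
  rw [sw_assoc a (F := fun u v y => u ⊗ₜ[ℂ] (φ v (ψ y w)))
    (by constructor <;> intros <;> simp [TensorProduct.add_tmul, TensorProduct.tmul_add, TensorProduct.smul_tmul'])]
  have e : ∀ x y : A, sw y (fun u v => x ⊗ₜ[ℂ] (φ u (ψ v w))) = counit (R := ℂ) y • (x ⊗ₜ[ℂ] w) := by
    intro x y
    have := congrArg (fun f : Module.End ℂ W => x ⊗ₜ[ℂ] f w) (h y)
    simpa [sw, TensorProduct.tmul_sum] using this
  simp only [e]
  exact sw_counit_right ((TensorProduct.mk ℂ A W).flip w) a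

lemma th'_comp (φ ψ : A →ₗ[ℂ] Module.End ℂ W)
    (h : ∀ a, sw a (fun x y => φ y * ψ x) = counit (R := ℂ) a • 1) : th' φ ∘ₗ th' ψ = LinearMap.id := by
  apply TensorProduct.ext'
  intro a w
  simp only [LinearMap.comp_apply, th'_tmul, map_sw, LinearMap.id_apply]
  rw [← sw_assoc a (F := fun u v y => y ⊗ₜ[ℂ] (φ v (ψ u w)))
    (by constructor <;> intros <;> simp [TensorProduct.add_tmul, TensorProduct.tmul_add, TensorProduct.smul_tmul'])]
  have e : ∀ x y : A, sw y (fun u v => x ⊗ₜ[ℂ] (φ v (ψ u w))) = counit (R := ℂ) y • (x ⊗ₜ[ℂ] w) := by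
    intro x y
    have := congrArg (fun f : Module.End ℂ W => x ⊗ₜ[ℂ] f w) (h y)
    simpa [sw, TensorProduct.tmul_sum] using this
  simp only [e]
  exact sw_counit_left ((TensorProduct.mk ℂ A W).flip w) a

lemma th_bij [Module.Finite ℂ A] [Module.Finite ℂ W] (σ : A →ₐ[ℂ] Module.End ℂ W) :
    ∃ e : (A ⊗[ℂ] W) ≃ₗ[ℂ] (A ⊗[ℂ] W), e.toLinearMap = th σ.toLinearMap := by
  have h : th σ.toLinearMap ∘ₗ th (σ.toLinearMap ∘ₗ antipode ℂ) = LinearMap.id := th_comp _ _ fun a => by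
    simpa using sw_antipode_right σ.toLinearMap a
  exact ⟨LinearEquiv.ofLinearMap _ _ h ((LinearMap.comp_eq_id_comm _ _).1 h), rfl⟩

lemma trace_conj_of_comm {E : Type*} [AddCommGroup E] [Module ℂ E] [Module.Finite ℂ E]
    (e : E ≃ₗ[ℂ] E) (f g : E →ₗ[ℂ] E) (h : f ∘ₗ e.toLinearMap = e.toLinearMap ∘ₗ g) :
    LinearMap.trace ℂ E f = LinearMap.trace ℂ E g := by
  have : f = e.conj g := by
    ext x
    have := congrArg (fun k => k (e.symm x)) h
    simpa [LinearEquiv.conj_apply] using this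
  rw [this, LinearMap.trace_conj']

/-- Semilinear endomorphisms for the left translation by a character. -/
lemma trace_semilinear_ell [Module.Finite ℂ A] [Module.Finite ℂ W] (σ : A →ₐ[ℂ] Module.End ℂ W)
    (β : A →ₐ[ℂ] ℂ) (ψ : Module.End ℂ W) (h : ∀ a w, ψ (σ a w) = σ (ell β a) (ψ w)) :
    (Module.finrank ℂ A : ℂ) * LinearMap.trace ℂ W ψ =
      LinearMap.trace ℂ A (arr (cinv β)).toLinearMap * LinearMap.trace ℂ W ψ := by
  obtain ⟨e, he⟩ := th_bij σ
  have key : TensorProduct.map (arr (cinv β)).toLinearMap ψ ∘ₗ e.toLinearMap =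
      e.toLinearMap ∘ₗ TensorProduct.map LinearMap.id ψ := by
    rw [he]
    apply TensorProduct.ext'
    intro a w
    simp only [LinearMap.comp_apply, th_tmul, map_sw, TensorProduct.map_tmul,
      AlgHom.toLinearMap_apply, h, LinearMap.id_apply]
    have e2 := sw_assoc a (F := fun u v y => cinv β v • (u ⊗ₜ[ℂ] (σ (ell β y) (ψ w))))
      (by constructor <;> intros <;> simp [TensorProduct.add_tmul, TensorProduct.tmul_add, TensorProduct.smul_tmul', add_smul, smul_smul, mul_comm])
    have e3 : ∀ x y : A, sw x (fun u v => cinv β v • (u ⊗ₜ[ℂ] (σ (ell β y) (ψ w)))) =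
        arr (cinv β) x ⊗ₜ[ℂ] (σ (ell β y) (ψ w)) := by
      intro x y
      rw [arr_apply, ← TensorProduct.mk_apply, ← LinearMap.flip_apply, map_sw]
      simp [TensorProduct.smul_tmul']
    have e4 : ∀ x y : A, sw y (fun u v => cinv β u • (x ⊗ₜ[ℂ] (σ (ell β v) (ψ w)))) =
        x ⊗ₜ[ℂ] (σ y (ψ w)) := by
      intro x y
      conv_rhs => rw [← ell_ell_cinv β y, ell_apply (cinv β)]
      have := map_sw (((TensorProduct.mk ℂ A W) x) ∘ₗ (σ.toLinearMap.flip (ψ w)) ∘ₗ (ell β).toLinearMap) y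
        (fun x y => cinv β x • y)
      simp at this
      simp [this]
    simp only [e3, e4] at e2
    exact e2
  have := trace_conj_of_comm e _ _ key
  rw [LinearMap.trace_tensorProduct', LinearMap.trace_tensorProduct'] at this
  simpa using this.symm

lemma trace_semilinear_arr [Module.Finite ℂ A] [Module.Finite ℂ W] (σ : A →ₐ[ℂ] Module.End ℂ W)
    (β : A →ₐ[ℂ] ℂ) (ψ : Module.End ℂ W) (h : ∀ a w, ψ (σ a w) = σ (arr β a) (ψ w)) :
    (Module.finrank ℂ A : ℂ) * LinearMap.trace ℂ W ψ =
      LinearMap.trace ℂ A (arr β).toLinearMap * LinearMap.trace ℂ W ψ := by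
  obtain ⟨e, he⟩ := th_bij σ
  have key : TensorProduct.map LinearMap.id ψ ∘ₗ e.toLinearMap =
      e.toLinearMap ∘ₗ TensorProduct.map (arr β).toLinearMap ψ := by
    rw [he]
    apply TensorProduct.ext'
    intro a w
    simp only [LinearMap.comp_apply, th_tmul, map_sw, TensorProduct.map_tmul,
      AlgHom.toLinearMap_apply, h, LinearMap.id_apply]
    rw [sw_arr]
    constructor <;> intros <;> simp [TensorProduct.add_tmul, TensorProduct.tmul_add, TensorProduct.smul_tmul']
  have := trace_conj_of_comm e _ _ key
  rw [LinearMap.trace_tensorProduct', LinearMap.trace_tensorProduct'] at this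
  simpa using this

/-- Trace of right multiplication. -/
def tr (a : A) : ℂ := LinearMap.trace ℂ A (LinearMap.mulRight ℂ a)

/-- If `τ` is antimultiplicative with character `χ`, then `t * χ = (dim W) t`. -/
lemma tr_conv [Module.Finite ℂ A] [Module.Finite ℂ W] (τ : A →ₗ[ℂ] Module.End ℂ W)
    (hm : ∀ a b, τ (a * b) = τ b * τ a) (h1 : τ 1 = 1)
    (hS : Function.Surjective (antipode ℂ (A := A))) (a : A) :
    sw a (fun x y => tr x * LinearMap.trace ℂ W (τ y)) = (Module.finrank ℂ W : ℂ) * tr a := by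
  have hSi : Function.Injective (antipode ℂ (A := A)) := LinearMap.injective_iff_surjective.2 hS
  let S : A ≃ₗ[ℂ] A := LinearEquiv.ofBijective (antipode ℂ) ⟨hSi, hS⟩
  have hSS : ∀ x, antipode ℂ (S.symm x) = x := fun x => S.apply_symm_apply x
  have h : th τ ∘ₗ th (τ ∘ₗ S.symm.toLinearMap) = LinearMap.id := th_comp _ _ fun a => by
    have : sw a (fun x y => S.symm y * x) = counit (R := ℂ) a • 1 := by
      apply hSi
      rw [map_sw]
      simp [HopfAlgebra.antipode_mul_antidistrib, hSS, sw_antipode_left']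
    have := congrArg τ this
    rw [map_sw] at this
    simpa [hm, h1] using this
  let e : (A ⊗[ℂ] W) ≃ₗ[ℂ] (A ⊗[ℂ] W) := LinearEquiv.ofLinearMap _ _ h ((LinearMap.comp_eq_id_comm _ _).1 h)
  have key : (sw a fun x y => TensorProduct.map (LinearMap.mulRight ℂ x) (τ y)) ∘ₗ e.toLinearMap =
      e.toLinearMap ∘ₗ TensorProduct.map (LinearMap.mulRight ℂ a) LinearMap.id := by
    apply TensorProduct.ext'
    intro b w
    have : e.toLinearMap = th τ := rfl
    simp only [this, LinearMap.comp_apply, th_tmul, map_sw, TensorProduct.map_tmul, LinearMap.mulRight_apply, LinearMap.id_apply]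
    rw [sw_mul]
    · refine sw_congr fun x y => ?_
      simp [sw, LinearMap.sum_apply, hm]
    · constructor <;> intros <;> simp [TensorProduct.add_tmul, TensorProduct.tmul_add, TensorProduct.smul_tmul']
  have := trace_conj_of_comm e _ _ key
  rw [map_sw, LinearMap.trace_tensorProduct'] at this
  simp only [LinearMap.trace_tensorProduct'] at this
  simpa [tr, mul_comm] using this

lemma conv_tr [Module.Finite ℂ A] [Module.Finite ℂ W] (τ : A →ₗ[ℂ] Module.End ℂ W)
    (hm : ∀ a b, τ (a * b) = τ b * τ a) (h1 : τ 1 = 1) (a : A) :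
    sw a (fun x y => LinearMap.trace ℂ W (τ x) * tr y) = (Module.finrank ℂ W : ℂ) * tr a := by
  have h : th' τ ∘ₗ th' (τ ∘ₗ antipode ℂ) = LinearMap.id := th'_comp _ _ fun a => by
    have := congrArg τ (sw_antipode_left' a)
    rw [map_sw] at this
    simpa [hm, h1] using this
  let e : (A ⊗[ℂ] W) ≃ₗ[ℂ] (A ⊗[ℂ] W) := LinearEquiv.ofLinearMap _ _ h ((LinearMap.comp_eq_id_comm _ _).1 h)
  have key : (sw a fun x y => TensorProduct.map (LinearMap.mulRight ℂ y) (τ x)) ∘ₗ e.toLinearMap =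
      e.toLinearMap ∘ₗ TensorProduct.map (LinearMap.mulRight ℂ a) LinearMap.id := by
    apply TensorProduct.ext'
    intro b w
    have : e.toLinearMap = th' τ := rfl
    simp only [this, LinearMap.comp_apply, th'_tmul, map_sw, TensorProduct.map_tmul, LinearMap.mulRight_apply, LinearMap.id_apply]
    rw [sw_mul]
    · refine sw_congr fun x y => ?_
      simp [sw, LinearMap.sum_apply, hm]
    · constructor <;> intros <;> simp [TensorProduct.add_tmul, TensorProduct.tmul_add, TensorProduct.smul_tmul']
  have := trace_conj_of_comm e _ _ key
  rw [map_sw, LinearMap.trace_tensorProduct'] at this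
  simp only [LinearMap.trace_tensorProduct'] at this
  simpa [tr, mul_comm] using this

end Sw

namespace Sw

/-- The linear dual of `A`, with the convolution product. -/
def Du (A : Type*) [Ring A] [HopfAlgebra ℂ A] := WithConv (A →ₗ[ℂ] ℂ)

variable {A : Type*} [Ring A] [HopfAlgebra ℂ A]

instance : Ring (Du A) := inferInstanceAs (Ring (WithConv (A →ₗ[ℂ] ℂ)))

instance duAlgebra : Algebra ℂ (Du A) := inferInstanceAs (Algebra ℂ (WithConv (A →ₗ[ℂ] ℂ)))

instance duModule : Module ℂ (Du A) := Algebra.toModule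

/-- Functionals on `A` as elements of `Du A`. -/
def toDu : (A →ₗ[ℂ] ℂ) ≃ₗ[ℂ] Du A where
  toFun f := WithConv.toConv f
  invFun f := WithConv.ofConv f
  map_add' _ _ := rfl
  map_smul' _ _ := rfl
  left_inv _ := rfl
  right_inv _ := rfl

instance : FunLike (Du A) A ℂ where
  coe f := toDu.symm f
  coe_injective _ _ h := (toDu (A := A)).symm.injective (DFunLike.coe_injective h)

instance : LinearMapClass (Du A) ℂ A ℂ where
  map_add f := map_add (toDu.symm f)
  map_smulₛₗ f := map_smul (toDu.symm f)

lemma du_ext {f g : Du A} (h : ∀ x, f x = g x) : f = g := by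
  exact DFunLike.ext _ _ h

lemma du_mul_apply (f g : Du A) (x : A) : (f * g) x = sw x (fun a b => f a * g b) := by
  exact Coalgebra.Repr.convMul_apply (Repr.arbitrary ℂ x) f g

lemma du_one_apply (x : A) : (1 : Du A) x = counit (R := ℂ) x := by
  exact LinearMap.convOne_apply x

lemma du_add_apply (f g : Du A) (x : A) : (f + g) x = f x + g x := rfl
lemma du_smul_apply (c : ℂ) (f : Du A) (x : A) : (c • f) x = c * f x := rfl
lemma du_zero_apply (x : A) : (0 : Du A) x = 0 := rfl

variable [Module.Finite ℂ A]

instance du_finite : Module.Finite ℂ (Du A) := Module.Finite.equiv (toDu (A := A))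

lemma finrank_du : Module.finrank ℂ (Du A) = Module.finrank ℂ A := by
  rw [← LinearEquiv.finrank_eq (toDu (A := A))]; exact Subspace.dual_finrank_eq

/-- Pairs of dual elements as functionals on the tensor square. -/
def E2 : Du A ⊗[ℂ] Du A ≃ₗ[ℂ] Module.Dual ℂ (A ⊗[ℂ] A) :=
  TensorProduct.congr toDu.symm toDu.symm ≪≫ₗ TensorProduct.dualDistribEquiv ℂ A A

lemma E2_tmul (f g : Du A) (x y : A) : E2 (f ⊗ₜ[ℂ] g) (x ⊗ₜ y) = f x * g y := by
  simp [E2]; rfl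

lemma E2_ext {s t : Du A ⊗[ℂ] Du A} (h : ∀ x y, E2 s (x ⊗ₜ y) = E2 t (x ⊗ₜ y)) : s = t := by
  apply (E2 (A := A)).injective
  apply TensorProduct.ext'
  exact h

/-- Triples of dual elements as functionals on the tensor cube. -/
def E3 : Du A ⊗[ℂ] (Du A ⊗[ℂ] Du A) ≃ₗ[ℂ] Module.Dual ℂ (A ⊗[ℂ] (A ⊗[ℂ] A)) :=
  TensorProduct.congr toDu.symm E2 ≪≫ₗ TensorProduct.dualDistribEquiv ℂ A (A ⊗[ℂ] A)

lemma E3_tmul (f : Du A) (t : Du A ⊗[ℂ] Du A) (x : A) (y : A ⊗[ℂ] A) :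
    E3 (f ⊗ₜ[ℂ] t) (x ⊗ₜ y) = f x * E2 t y := by
  simp [E3]; left; rfl

/-- Comultiplication of the dual. -/
def duComul : Du A →ₗ[ℂ] Du A ⊗[ℂ] Du A :=
  E2.symm.toLinearMap ∘ₗ (LinearMap.mul' ℂ A).dualMap ∘ₗ toDu.symm.toLinearMap

lemma E2_duComul (f : Du A) (x y : A) : E2 (duComul f) (x ⊗ₜ y) = f (x * y) := by
  simp [duComul]; rfl

/-- Counit of the dual. -/
def duCounit : Du A →ₗ[ℂ] ℂ where
  toFun f := f 1
  map_add' _ _ := rfl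
  map_smul' _ _ := rfl

lemma E3_lTensor (t : Du A ⊗[ℂ] Du A) (x y z : A) :
    E3 (duComul.lTensor (Du A) t) (x ⊗ₜ (y ⊗ₜ z)) = E2 t (x ⊗ₜ (y * z)) := by
  induction t with
  | zero => simp [du_zero_apply]
  | add s t hs ht => simp only [map_add, LinearMap.add_apply, hs, ht]
  | tmul f g => rw [LinearMap.lTensor_tmul, E3_tmul, E2_duComul, E2_tmul]

lemma E3_assoc (s : Du A ⊗[ℂ] Du A) (g : Du A) (x y z : A) :
    E3 (TensorProduct.assoc ℂ _ _ _ (s ⊗ₜ[ℂ] g)) (x ⊗ₜ (y ⊗ₜ z)) = E2 s (x ⊗ₜ y) * g z := by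
  induction s with
  | zero => simp [du_zero_apply]
  | add s t hs ht => simp only [TensorProduct.add_tmul, map_add, LinearMap.add_apply, hs, ht, add_mul]
  | tmul f g => rw [TensorProduct.assoc_tmul, E3_tmul, E2_tmul, E2_tmul, mul_assoc]

lemma E3_rTensor (t : Du A ⊗[ℂ] Du A) (x y z : A) :
    E3 (TensorProduct.assoc ℂ _ _ _ (duComul.rTensor (Du A) t)) (x ⊗ₜ (y ⊗ₜ z))
      = E2 t ((x * y) ⊗ₜ z) := by
  induction t with
  | zero => simp [du_zero_apply]
  | add s t hs ht => simp only [map_add, LinearMap.add_apply, hs, ht]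
  | tmul f g => rw [LinearMap.rTensor_tmul, E3_assoc, E2_duComul, E2_tmul]

instance duCoalgebra : Coalgebra ℂ (Du A) where
  comul := duComul
  counit := duCounit
  coassoc := by
    ext1 f
    apply (E3 (A := A)).injective
    apply TensorProduct.ext_threefold'
    intro x y z
    change E3 (TensorProduct.assoc ℂ _ _ _ (duComul.rTensor (Du A) (duComul f))) _ =
      E3 (duComul.lTensor (Du A) (duComul f)) _
    rw [E3_rTensor, E3_lTensor, E2_duComul, E2_duComul, mul_assoc]
  rTensor_counit_comp_comul := by
    ext1 f
    apply (TensorProduct.lid ℂ (Du A)).injective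
    apply du_ext
    intro x
    have key : ∀ t : Du A ⊗[ℂ] Du A,
        (TensorProduct.lid ℂ (Du A) (duCounit.rTensor (Du A) t)) x = E2 t (1 ⊗ₜ x) := by
      intro t
      induction t with
      | zero => simp [du_zero_apply]
      | add s t hs ht => simp only [map_add, LinearMap.add_apply, du_add_apply, hs, ht]
      | tmul f g => rw [LinearMap.rTensor_tmul, E2_tmul, TensorProduct.lid_tmul]; rfl
    change (TensorProduct.lid ℂ (Du A) (duCounit.rTensor (Du A) (duComul f))) x = _
    rw [key, E2_duComul, one_mul]; simp
  lTensor_counit_comp_comul := by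
    ext1 f
    apply (TensorProduct.rid ℂ (Du A)).injective
    apply du_ext
    intro x
    have key : ∀ t : Du A ⊗[ℂ] Du A,
        (TensorProduct.rid ℂ (Du A) (duCounit.lTensor (Du A) t)) x = E2 t (x ⊗ₜ 1) := by
      intro t
      induction t with
      | zero => simp [du_zero_apply]
      | add s t hs ht => simp only [map_add, LinearMap.add_apply, du_add_apply, hs, ht]
      | tmul f g =>
        rw [LinearMap.lTensor_tmul, E2_tmul, TensorProduct.rid_tmul, mul_comm]; rfl
    change (TensorProduct.rid ℂ (Du A) (duCounit.lTensor (Du A) (duComul f))) x = _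
    rw [key, E2_duComul, mul_one]; simp

lemma E2_mul (s t : Du A ⊗[ℂ] Du A) (x y : A) :
    E2 (s * t) (x ⊗ₜ y) =
      sw x (fun a b => sw y (fun c d => E2 s (a ⊗ₜ c) * E2 t (b ⊗ₜ d))) := by
  induction s with
  | zero => simp [sw, du_zero_apply]
  | add s s' hs hs' => simp only [map_add, LinearMap.add_apply, hs, hs', add_mul, sw_add_fun]
  | tmul f g =>
    induction t with
    | zero => simp [sw, du_zero_apply]
    | add s s' hs hs' => simp only [map_add, LinearMap.add_apply, hs, hs', mul_add, sw_add_fun]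
    | tmul f' g' =>
      rw [Algebra.TensorProduct.tmul_mul_tmul, E2_tmul, du_mul_apply, du_mul_apply]
      simp only [E2_tmul]
      simp only [sw, Finset.sum_mul_sum]
      refine Finset.sum_congr rfl fun i _ => Finset.sum_congr rfl fun j _ => by ring

instance duBialgebra : Bialgebra ℂ (Du A) :=
  Bialgebra.mk' ℂ (Du A)
    (by change (1 : Du A) 1 = 1; rw [du_one_apply]; simp)
    (by
      intro f g
      change (f * g) 1 = f 1 * g 1
      rw [du_mul_apply, sw_one]
      constructor <;> intros <;> simp [add_mul, mul_add, mul_assoc, mul_left_comm])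
    (by
      apply E2_ext; intro x y
      change E2 (duComul 1) _ = _
      rw [E2_duComul, Algebra.TensorProduct.one_def, E2_tmul, du_one_apply, du_one_apply,
        du_one_apply, Bialgebra.counit_mul])
    (by
      intro f g
      apply E2_ext; intro x y
      change E2 (duComul (f * g)) _ = E2 (duComul f * duComul g) _
      rw [E2_duComul, E2_mul, du_mul_apply, sw_mul]
      · simp only [E2_duComul]
      constructor <;> intros <;> simp [add_mul, mul_add, mul_assoc, mul_left_comm])

/-- Antipode of the dual. -/
def duAntipode : Du A →ₗ[ℂ] Du A :=
  toDu.toLinearMap ∘ₗ (antipode ℂ (A := A)).dualMap ∘ₗ toDu.symm.toLinearMap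

lemma duAntipode_apply (f : Du A) (x : A) : duAntipode f x = f (antipode ℂ x) := rfl

lemma du_algebraMap_apply (c : ℂ) (x : A) :
    (algebraMap ℂ (Du A) c) x = c * counit (R := ℂ) x := by
  rw [Algebra.algebraMap_eq_smul_one, du_smul_apply, du_one_apply]

instance duHopf : HopfAlgebra ℂ (Du A) where
  antipode := duAntipode
  mul_antipode_rTensor_comul := by
    ext1 f
    apply du_ext
    intro x
    have key : ∀ t : Du A ⊗[ℂ] Du A,
        (LinearMap.mul' ℂ (Du A) (duAntipode.rTensor (Du A) t)) x =
          sw x (fun a b => E2 t (antipode ℂ a ⊗ₜ b)) := by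
      intro t
      induction t with
      | zero => simp [sw, du_zero_apply]
      | add s t hs ht =>
        simp only [map_add, LinearMap.add_apply, du_add_apply, hs, ht, sw_add_fun]
      | tmul f g =>
        rw [LinearMap.rTensor_tmul, LinearMap.mul'_apply, du_mul_apply]
        simp only [E2_tmul, duAntipode_apply]
    change (LinearMap.mul' ℂ (Du A) (duAntipode.rTensor (Du A) (duComul f))) x =
      algebraMap ℂ (Du A) (f 1) x
    rw [key, du_algebraMap_apply]
    simp only [E2_duComul]
    have := sw_antipode_left (toDu.symm f) x
    rw [smul_eq_mul, mul_comm] at this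
    exact this
  mul_antipode_lTensor_comul := by
    ext1 f
    apply du_ext
    intro x
    have key : ∀ t : Du A ⊗[ℂ] Du A,
        (LinearMap.mul' ℂ (Du A) (duAntipode.lTensor (Du A) t)) x =
          sw x (fun a b => E2 t (a ⊗ₜ antipode ℂ b)) := by
      intro t
      induction t with
      | zero => simp [sw, du_zero_apply]
      | add s t hs ht =>
        simp only [map_add, LinearMap.add_apply, du_add_apply, hs, ht, sw_add_fun]
      | tmul f g =>
        rw [LinearMap.lTensor_tmul, LinearMap.mul'_apply, du_mul_apply]
        simp only [E2_tmul, duAntipode_apply]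
    change (LinearMap.mul' ℂ (Du A) (duAntipode.lTensor (Du A) (duComul f))) x =
      algebraMap ℂ (Du A) (f 1) x
    rw [key, du_algebraMap_apply]
    simp only [E2_duComul]
    have := sw_antipode_right (toDu.symm f) x
    rw [smul_eq_mul, mul_comm] at this
    exact this

lemma du_counit (f : Du A) : counit (R := ℂ) f = f 1 := rfl

end Sw

namespace Sw

variable {A : Type*} [Ring A] [HopfAlgebra ℂ A]

/-- `Λ` is a left integral. -/
def IsLInt (L : A) : Prop := ∀ h, h * L = counit (R := ℂ) h • L

/-- `m` is a left integral of the dual of `A`. -/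
def IsLCoint (m : A →ₗ[ℂ] ℂ) : Prop := ∀ a, sw a (fun x y => m y • x) = m a • (1 : A)

variable [Module.Finite ℂ A]

/-- Tensors in `A ⊗ A*` as endomorphisms. -/
def tensorEnd : A ⊗[ℂ] Module.Dual ℂ A ≃ₗ[ℂ] Module.End ℂ A :=
  TensorProduct.comm ℂ A (Module.Dual ℂ A) ≪≫ₗ dualTensorHomEquiv ℂ A A

lemma tensorEnd_tmul (a : A) (m : Module.Dual ℂ A) (x : A) :
    tensorEnd (a ⊗ₜ[ℂ] m) x = m x • a := by
  simp [tensorEnd]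

/-- `A` acting on its dual through the antipode. -/
def dualAct : A →ₐ[ℂ] Module.End ℂ (Module.Dual ℂ A) :=
  AlgHom.ofLinearMap
    { toFun := fun h => (LinearMap.mulLeft ℂ (antipode ℂ h)).dualMap
      map_add' := fun x y => by ext m a; simp [add_mul]
      map_smul' := fun c x => by ext m a; simp }
    (by ext m a; simp)
    (by intro x y; ext m a; simp [antipode_mul_antidistrib, mul_assoc])

lemma dualAct_apply (h : A) (m : Module.Dual ℂ A) (x : A) :
    dualAct h m x = m (antipode ℂ h * x) := rfl

lemma exists_lInt [Nontrivial A] : ∃ L : A, L ≠ 0 ∧ IsLInt L := by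
  obtain ⟨e, he⟩ := th_bij (dualAct (A := A))
  have hb : Function.Bijective (th (dualAct (A := A)).toLinearMap) := he ▸ e.bijective
  set T := th (dualAct (A := A)).toLinearMap with hT
  obtain ⟨t, ht⟩ := hb.2 (tensorEnd.symm LinearMap.id)
  have ht0 : t ≠ 0 := by
    rintro rfl
    rw [map_zero] at ht
    have := congrArg tensorEnd ht
    rw [map_zero, LinearEquiv.apply_symm_apply] at this
    have := LinearMap.congr_fun this 1
    simp at this
  have h1 : ∀ (h : A) (s : A ⊗[ℂ] Module.Dual ℂ A),
      T ((LinearMap.mulLeft ℂ h).rTensor _ s) =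
        sw h (fun u v => TensorProduct.map (LinearMap.mulLeft ℂ u) (dualAct v) (T s)) := by
    intro h s
    induction s with
    | zero => simp [sw]
    | add s t hs ht => simp only [map_add, hs, ht, sw_add_fun]
    | tmul a m =>
      rw [LinearMap.rTensor_tmul, hT, th_tmul, th_tmul, LinearMap.mulLeft_apply, sw_mul]
      · refine sw_congr fun u v => ?_
        rw [map_sw]
        simp
      · constructor <;> intros <;> simp [TensorProduct.add_tmul, TensorProduct.tmul_add, TensorProduct.smul_tmul']
  have h2 : ∀ h : A, sw h (fun u v => TensorProduct.map (LinearMap.mulLeft ℂ u) (dualAct v)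
      (tensorEnd.symm LinearMap.id)) = counit (R := ℂ) h • (tensorEnd.symm LinearMap.id) := by
    intro h
    have key : ∀ (u v : A) (s : A ⊗[ℂ] Module.Dual ℂ A),
        tensorEnd (TensorProduct.map (LinearMap.mulLeft ℂ u) (dualAct v) s) =
        LinearMap.mulLeft ℂ u ∘ₗ tensorEnd s ∘ₗ LinearMap.mulLeft ℂ (antipode ℂ v) := by
      intro u v s
      induction s with
      | zero => simp
      | add s t hs ht => simp only [map_add, hs, ht, LinearMap.comp_add, LinearMap.add_comp]
      | tmul a m =>
        ext x
        simp [tensorEnd_tmul, dualAct_apply]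
    apply tensorEnd.injective
    rw [map_sw, map_smul]
    simp only [key, LinearEquiv.apply_symm_apply]
    ext x
    have := sw_antipode_right (LinearMap.mulRight ℂ x) h
    simp only [LinearMap.mulRight_apply, one_mul] at this
    rw [LinearMap.smul_apply, LinearMap.id_apply, ← this]
    simp [sw, LinearMap.sum_apply, mul_assoc]
  have h3 : ∀ h : A, (LinearMap.mulLeft ℂ h).rTensor _ t = counit (R := ℂ) h • t := by
    intro h
    apply hb.1
    rw [h1, show T t = _ from ht, h2, map_smul, show T t = _ from ht]
  obtain ⟨f, hf⟩ : ∃ f : Module.Dual ℂ (Module.Dual ℂ A),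
      TensorProduct.rid ℂ A (f.lTensor A t) ≠ 0 := by
    by_contra! hc
    apply ht0
    have : ∀ s : A ⊗[ℂ] Module.Dual ℂ A, ∀ x,
        TensorProduct.rid ℂ A ((Module.Dual.eval ℂ A x).lTensor A s) = tensorEnd s x := by
      intro s x
      induction s with
      | zero => simp
      | add s t hs ht => simp only [map_add, hs, ht, LinearMap.add_apply]
      | tmul a m => simp [tensorEnd_tmul]
    apply tensorEnd.injective
    ext x
    rw [← this, hc]; simp
  refine ⟨_, hf, fun h => ?_⟩
  have key : ∀ s : A ⊗[ℂ] Module.Dual ℂ A,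
      h * TensorProduct.rid ℂ A (f.lTensor A s) =
      TensorProduct.rid ℂ A (f.lTensor A ((LinearMap.mulLeft ℂ h).rTensor _ s)) := by
    intro s
    induction s with
    | zero => simp
    | add s t hs ht => simp only [map_add, mul_add, hs, ht]
    | tmul a m => simp
  rw [key, h3]; simp

end Sw

namespace Sw

variable {A : Type*} [Ring A] [HopfAlgebra ℂ A]

lemma coint_mul_antipode {m : A →ₗ[ℂ] ℂ} (hm : IsLCoint m) (a b : A) :
    sw a (fun x y => m (y * b) • antipode ℂ x) = sw b (fun x y => m (a * y) • x) := by
  calc sw a (fun x y => m (y * b) • antipode ℂ x)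
      = sw a (fun x z => sw z (fun u v => sw b (fun c d => m (v * d) • (antipode ℂ x * u * c)))) := by
        refine sw_congr fun x z => ?_
        conv_lhs => rw [← mul_one (antipode ℂ x)]
        rw [← mul_smul_comm, ← hm, sw_mul, mul_sw]
        · simp only [mul_sw, mul_smul_comm, mul_assoc]
        · constructor <;> intros <;> simp [add_smul, smul_smul, mul_comm]
    _ = sw a (fun x z => sw x (fun u v => sw b (fun c d => m (z * d) • (antipode ℂ u * v * c)))) := by
        rw [sw_assoc a (F := fun u v z => sw b (fun c d => m (z * d) • (antipode ℂ u * v * c)))]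
        constructor <;> intros <;>
          simp [add_smul, smul_smul, mul_comm, add_mul, mul_add, sw_add_fun, ← sw_smul_fun]
    _ = sw a (fun x z => sw b (fun c d => m (z * d) • (counit (R := ℂ) x • c))) := by
        refine sw_congr fun x z => ?_
        rw [sw_comm]
        refine sw_congr fun c d => ?_
        rw [sw_smul_fun, ← sw_mul', sw_antipode_left', smul_one_mul]
    _ = sw b (fun c d => sw a (fun x z => m (z * d) • (counit (R := ℂ) x • c))) := sw_comm _ _ _
    _ = _ := by
        refine sw_congr fun c d => ?_
        have := sw_counit_left ((m ∘ₗ LinearMap.mulRight ℂ d).smulRight c) a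
        simp only [LinearMap.smulRight_apply, LinearMap.comp_apply, LinearMap.mulRight_apply] at this
        rw [← this]
        exact sw_congr fun x y => smul_comm _ _ _

/-- The version with a right cointegral property `m(a₁)a₂ = m(a) g`. -/
lemma coint_mul_antipode' {m : A →ₗ[ℂ] ℂ} {g : A} (hm : ∀ a, sw a (fun x y => m x • y) = m a • g)
    (a b : A) :
    sw b (fun x y => m (a * x) • (g * antipode ℂ y)) = sw a (fun x y => m (x * b) • y) := by
  calc sw b (fun x y => m (a * x) • (g * antipode ℂ y))
      = sw b (fun x z => sw x (fun c d => sw a (fun u v => m (u * c) • (v * d * antipode ℂ z)))) := by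
        refine sw_congr fun x z => ?_
        rw [← smul_mul_assoc, ← hm, sw_mul, sw_mul', sw_comm]
        · simp only [sw_mul', smul_mul_assoc]
        · constructor <;> intros <;> simp [add_smul, smul_smul, mul_comm]
    _ = sw b (fun x z => sw z (fun c d => sw a (fun u v => m (u * x) • (v * c * antipode ℂ d)))) := by
        rw [sw_assoc b (F := fun c d z => sw a (fun u v => m (u * c) • (v * d * antipode ℂ z)))]
        constructor <;> intros <;>
          simp [add_smul, smul_smul, mul_comm, add_mul, mul_add, sw_add_fun, ← sw_smul_fun]
    _ = sw b (fun x z => sw a (fun u v => m (u * x) • (counit (R := ℂ) z • v))) := by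
        refine sw_congr fun x z => ?_
        rw [sw_comm]
        refine sw_congr fun c d => ?_
        simp only [mul_assoc]
        rw [sw_smul_fun, ← mul_sw, sw_antipode_right', mul_smul_one]
    _ = sw a (fun u v => sw b (fun x z => m (u * x) • (counit (R := ℂ) z • v))) := sw_comm _ _ _
    _ = _ := by
        refine sw_congr fun c d => ?_
        have := sw_counit_right ((m ∘ₗ LinearMap.mulLeft ℂ c).smulRight d) b
        simp only [LinearMap.smulRight_apply, LinearMap.comp_apply, LinearMap.mulLeft_apply] at this
        rw [← this]
        exact sw_congr fun x y => smul_comm _ _ _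

variable [Module.Finite ℂ A]

lemma lCoint_iff (m : A →ₗ[ℂ] ℂ) : IsLCoint m ↔ IsLInt (toDu m) := by
  constructor
  · intro h f
    apply du_ext
    intro a
    have := congrArg f (h a)
    rw [map_sw, map_smul, smul_eq_mul, mul_comm] at this
    rw [du_mul_apply, du_smul_apply, du_counit]
    refine Eq.trans (sw_congr fun x y => ?_) this
    rw [map_smul, smul_eq_mul, mul_comm]; rfl
  · intro h a
    rw [← sub_eq_zero]
    refine (Module.forall_dual_apply_eq_zero_iff ℂ _).mp fun f => ?_
    have := DFunLike.congr_fun (h (toDu f)) a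
    rw [du_mul_apply, du_smul_apply, du_counit] at this
    rw [map_sub, sub_eq_zero, map_sw, map_smul, smul_eq_mul, mul_comm]
    refine Eq.trans (sw_congr fun x y => ?_) this
    rw [map_smul, smul_eq_mul, mul_comm]; rfl

lemma du_nontrivial [Nontrivial A] : Nontrivial (Du A) := by
  refine ⟨⟨1, 0, fun h => ?_⟩⟩
  have := DFunLike.congr_fun h (1 : A)
  rw [du_one_apply, Bialgebra.counit_one] at this
  exact one_ne_zero this

lemma exists_lCoint [Nontrivial A] : ∃ m : A →ₗ[ℂ] ℂ, m ≠ 0 ∧ IsLCoint m := by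
  have : Nontrivial (Du A) := du_nontrivial
  obtain ⟨L, h0, hL⟩ := exists_lInt (A := Du A)
  exact ⟨toDu.symm L, fun h => h0 (toDu.symm.injective (by simpa using h)), (lCoint_iff _).2 hL⟩

/-- `b ↦ m(· b)` -/
def dualR (m : A →ₗ[ℂ] ℂ) : A →ₗ[ℂ] Module.Dual ℂ A := ((LinearMap.mul ℂ A).compr₂ m).flip
/-- `c ↦ m(c ·)` -/
def dualL (m : A →ₗ[ℂ] ℂ) : A →ₗ[ℂ] Module.Dual ℂ A := (LinearMap.mul ℂ A).compr₂ m

lemma dualR_apply (m : A →ₗ[ℂ] ℂ) (a b : A) : dualR m b a = m (a * b) := rfl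
lemma dualL_apply (m : A →ₗ[ℂ] ℂ) (a b : A) : dualL m a b = m (a * b) := rfl

lemma dualR_bij {m : A →ₗ[ℂ] ℂ} (hm : IsLCoint m) (h0 : m ≠ 0) : Function.Bijective (dualR m) := by
  have fr : Module.finrank ℂ A = Module.finrank ℂ (Module.Dual ℂ A) := Subspace.dual_finrank_eq.symm
  suffices hinj : Function.Injective (dualR m) from
    ⟨hinj, (LinearMap.injective_iff_surjective_of_finrank_eq_finrank fr).1 hinj⟩
  have hz : ∀ b, (∀ a, m (a * b) = 0) → ∀ a, sw b (fun x y => m (a * y) • x) = 0 := by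
    intro b hb a
    rw [← coint_mul_antipode hm]
    calc _ = (0 : A →ₗ[ℂ] A) 0 := ?_
      _ = 0 := rfl
    have : ∀ c : A, m (c * b) • (1 : A) = 0 := fun c => by rw [hb, zero_smul]
    simp [sw, hb]
  have heps : ∀ b, (∀ a, m (a * b) = 0) → counit (R := ℂ) b = 0 := by
    intro b hb
    obtain ⟨a, ha⟩ : ∃ a, m a ≠ 0 := by
      by_contra! hc; exact h0 (LinearMap.ext hc)
    have ht : sw b (fun x y => x ⊗ₜ[ℂ] dualR m y) = 0 := by
      apply tensorEnd.injective
      ext c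
      rw [map_zero, map_sw, LinearMap.zero_apply, ← hz b hb c]
      simp [sw, LinearMap.sum_apply, tensorEnd_tmul, dualR_apply]
    have := congrArg (TensorProduct.lift (LinearMap.flip (LinearMap.id (R := ℂ) (M := Module.Dual ℂ A)) ∘ₗ
      LinearMap.mulLeft ℂ a ∘ₗ antipode ℂ)) ht
    rw [map_sw] at this
    simp only [TensorProduct.lift.tmul, LinearMap.comp_apply, LinearMap.flip_apply,
      LinearMap.id_apply, dualR_apply, LinearMap.mulLeft_apply, map_zero] at this
    have h2 := sw_antipode_left (m ∘ₗ LinearMap.mulLeft ℂ a) b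
    simp only [LinearMap.comp_apply, LinearMap.mulLeft_apply, ← mul_assoc, mul_one] at h2
    rw [this, smul_eq_mul] at h2
    exact (mul_eq_zero.1 h2.symm).resolve_right ha
  obtain ⟨c, hc⟩ : ∃ c, ∀ b, counit (R := ℂ) b = m (c * b) := by
    have : (counit : A →ₗ[ℂ] ℂ) ∈ LinearMap.range (dualL m) := by
      rw [← Subspace.dualCoannihilator_dualAnnihilator_eq (W := LinearMap.range (dualL m)),
        Submodule.mem_dualAnnihilator]
      intro b hb
      apply heps
      intro a
      exact (Submodule.mem_dualCoannihilator _).1 hb _ ⟨a, rfl⟩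
    obtain ⟨c, hc⟩ := this
    exact ⟨c, fun b => by rw [← hc]; rfl⟩
  rw [injective_iff_map_eq_zero]
  intro b hb
  have hb' : ∀ a, m (a * b) = 0 := fun a => by rw [← dualR_apply, hb]; rfl
  rw [← sw_counit_right' b]
  simp only [hc]
  exact hz b hb' c

lemma dualL_bij {m : A →ₗ[ℂ] ℂ} (hm : IsLCoint m) (h0 : m ≠ 0) : Function.Bijective (dualL m) := by
  have fr : Module.finrank ℂ A = Module.finrank ℂ (Module.Dual ℂ A) := Subspace.dual_finrank_eq.symm
  suffices hinj : Function.Injective (dualL m) from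
    ⟨hinj, (LinearMap.injective_iff_surjective_of_finrank_eq_finrank fr).1 hinj⟩
  rw [injective_iff_map_eq_zero]
  intro c hc
  refine (Module.forall_dual_apply_eq_zero_iff ℂ _).mp fun f => ?_
  obtain ⟨b, rfl⟩ := (dualR_bij hm h0).2 f
  rw [dualR_apply, ← dualL_apply, hc]; rfl

/-- A dual pair of integrals with modular data. -/
structure IntData (A : Type*) [Ring A] [HopfAlgebra ℂ A] where
  lam : A →ₗ[ℂ] ℂ
  L : A
  g : A
  al : A →ₐ[ℂ] ℂ
  coint : IsLCoint lam
  lam_mul_L : ∀ x, lam (x * L) = counit (R := ℂ) x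
  lint : IsLInt L
  L_mul : ∀ h, L * h = al h • L
  lam_g : ∀ a, sw a (fun x y => lam x • y) = lam a • g
  comul_g : comul (R := ℂ) g = g ⊗ₜ g
  counit_g : counit (R := ℂ) g = 1

lemma lint_unique [Nontrivial A] {L : A} (hL : IsLInt L) (h0 : L ≠ 0) {L' : A} (hL' : IsLInt L') :
    ∃ c : ℂ, L' = c • L := by
  obtain ⟨m, hm0, hm⟩ := exists_lCoint (A := A)
  have hb := dualR_bij hm hm0
  have h1 : ∀ L'' : A, IsLInt L'' → dualR m L'' = m L'' • (counit : A →ₗ[ℂ] ℂ) := by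
    intro L'' h
    ext x
    rw [dualR_apply, h, map_smul, LinearMap.smul_apply, smul_eq_mul, smul_eq_mul, mul_comm]
  have h2 : m L ≠ 0 := by
    intro h
    apply h0
    apply hb.1
    rw [h1 L hL, h, zero_smul, map_zero]
  refine ⟨m L' / m L, hb.1 ?_⟩
  rw [map_smul, h1 L hL, h1 L' hL', smul_smul, div_mul_cancel₀ _ h2]

end Sw

namespace Sw

variable {A : Type*} [Ring A] [HopfAlgebra ℂ A] [Module.Finite ℂ A]

lemma exists_intData [Nontrivial A] : Nonempty (IntData A) := by
  obtain ⟨m, hm0, hm⟩ := exists_lCoint (A := A)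
  have hR := dualR_bij hm hm0
  have hL := dualL_bij hm hm0
  obtain ⟨L, hLe⟩ := hR.2 (counit : A →ₗ[ℂ] ℂ)
  have hml : ∀ x, m (x * L) = counit (R := ℂ) x := fun x => by rw [← dualR_apply, hLe]
  have hlint : IsLInt L := by
    intro h
    apply hR.1
    ext x
    rw [dualR_apply, map_smul, LinearMap.smul_apply, dualR_apply, ← mul_assoc, hml, hml,
      Bialgebra.counit_mul, smul_eq_mul, mul_comm]
  have hmL : m L = 1 := by rw [← one_mul L, hml, Bialgebra.counit_one]
  have hL0 : L ≠ 0 := by rintro rfl; simp at hmL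
  have hLr : ∀ h, L * h = m (L * h) • L := by
    intro h
    obtain ⟨c, hc⟩ := lint_unique hlint hL0 (L' := L * h) (fun x => by
      rw [← mul_assoc, hlint, smul_mul_assoc])
    rw [hc, map_smul, hmL, smul_eq_mul, mul_one]
  let al : A →ₐ[ℂ] ℂ := AlgHom.ofLinearMap (m ∘ₗ LinearMap.mulLeft ℂ L) (by simpa using hmL) (by
    intro x y
    simp only [LinearMap.comp_apply, LinearMap.mulLeft_apply]
    rw [← mul_assoc, hLr x, smul_mul_assoc, map_smul, map_smul, hmL, smul_eq_mul, smul_eq_mul, mul_one])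
  let g : A := sw L (fun x y => m x • y)
  have : Nontrivial (Du A) := du_nontrivial
  have hg : ∀ a, sw a (fun x y => m x • y) = m a • g := by
    have hfun : ∀ f : A →ₗ[ℂ] ℂ, ∃ c : ℂ, ∀ a, sw a (fun x y => m x * f y) = c * m a := by
      intro f
      have h1 := (lCoint_iff m).1 hm
      obtain ⟨c, hc⟩ := lint_unique h1 (by simpa using hm0) (L' := toDu m * toDu f) (fun x => by
        rw [← mul_assoc, h1, smul_mul_assoc])
      refine ⟨c, fun a => ?_⟩
      have := DFunLike.congr_fun hc a
      rw [du_mul_apply, du_smul_apply] at this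
      exact this
    intro a
    rw [← sub_eq_zero]
    refine (Module.forall_dual_apply_eq_zero_iff ℂ _).mp fun f => ?_
    obtain ⟨c, hc⟩ := hfun f
    rw [map_sub, sub_eq_zero, map_sw, map_smul, map_sw]
    simp only [map_smul, smul_eq_mul]
    rw [hc, hc, hmL]; ring
  have hcg : comul (R := ℂ) g = g ⊗ₜ g := by
    have h1 := sw_assoc L (F := fun u v z => m u • (v ⊗ₜ[ℂ] z)) (by
      constructor <;> intros <;> simp [add_smul, smul_smul, mul_comm, TensorProduct.add_tmul, TensorProduct.tmul_add, TensorProduct.smul_tmul'])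
    have h2 : sw L (fun x z => sw z (fun u v => m x • (u ⊗ₜ[ℂ] v))) = comul (R := ℂ) g := by
      rw [map_sw]
      refine sw_congr fun x z => ?_
      rw [map_smul, comul_eq_sw, sw_smul_fun]
    have h3 : sw L (fun x z => sw x (fun u v => m u • (v ⊗ₜ[ℂ] z))) = g ⊗ₜ g := by
      have : ∀ x z : A, sw x (fun u v => m u • (v ⊗ₜ[ℂ] z)) = m x • (g ⊗ₜ[ℂ] z) := by
        intro x z
        have := congrArg (fun t => t ⊗ₜ[ℂ] z) (hg x)
        simp only [sw, TensorProduct.sum_tmul, TensorProduct.smul_tmul'] at this ⊢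
        exact this
      simp only [this]
      have := congrArg (fun t => g ⊗ₜ[ℂ] t) (hg L)
      simp only [sw, TensorProduct.tmul_sum, TensorProduct.tmul_smul, hmL, one_smul] at this ⊢
      exact this
    rw [← h2, ← h1, h3]
  refine ⟨⟨m, L, g, al, hm, hml, hlint, hLr, hg, hcg, ?_⟩⟩
  rw [map_sw]
  simp only [map_smul, smul_eq_mul]
  have := sw_counit_right m L
  rw [hmL] at this
  rw [← this]
  exact sw_congr fun x y => mul_comm _ _

namespace IntData
variable (D : IntData A)

lemma lam_L : D.lam D.L = 1 := by rw [← one_mul D.L, D.lam_mul_L, Bialgebra.counit_one]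
lemma lam_ne : D.lam ≠ 0 := by intro h; have := D.lam_L; rw [h] at this; simp at this
lemma L_ne : D.L ≠ 0 := by intro h; have := D.lam_L; rw [h] at this; simp at this

lemma lam_L_mul (h : A) : D.lam (D.L * h) = D.al h := by
  rw [D.L_mul, map_smul, D.lam_L, smul_eq_mul, mul_one]

lemma antipode_eq (a : A) : antipode ℂ a = sw D.L (fun x y => D.lam (a * y) • x) := by
  rw [← coint_mul_antipode D.coint]
  simp only [D.lam_mul_L]
  exact (sw_counit_right (antipode ℂ) a).symm

lemma arr_eq (b : A) : arr D.al b = sw D.L (fun x y => D.lam (y * b) • antipode ℂ x) := by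
  rw [coint_mul_antipode D.coint, arr_apply]
  simp only [D.lam_L_mul]

lemma antipode_surjective (D : IntData A) : Function.Surjective (antipode ℂ (A := A)) := by
  intro b
  refine ⟨sw D.L (fun x y => D.lam (y * arr (cinv D.al) b) • x), ?_⟩
  rw [map_sw]
  simp only [map_smul]
  rw [← D.arr_eq, arr_arr_cinv]

lemma antipode_injective (D : IntData A) : Function.Injective (antipode ℂ (A := A)) :=
  LinearMap.injective_iff_surjective.2 D.antipode_surjective

lemma ell_eq (b : A) : D.g * antipode ℂ (ell D.al b) = sw D.L (fun x y => D.lam (x * b) • y) := by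
  rw [← coint_mul_antipode' D.lam_g]
  simp only [D.lam_L_mul]
  rw [ell_apply, map_sw, mul_sw]
  simp only [map_smul, mul_smul_comm]

lemma self_eq (a : A) : a = sw D.L (fun x y => D.lam (a * x) • (D.g * antipode ℂ y)) := by
  rw [coint_mul_antipode' D.lam_g]
  simp only [D.lam_mul_L]
  exact (sw_counit_left' a).symm

lemma antipode_g_mul : antipode ℂ D.g * D.g = 1 := by
  have := sw_antipode_left' D.g
  rw [D.counit_g, one_smul, ext_sw D.comul_g (F := fun x y => antipode ℂ x * y)
    (by constructor <;> intros <;> simp [add_mul, mul_add])] at this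
  simpa using this

lemma g_mul_antipode : D.g * antipode ℂ D.g = 1 := by
  have := sw_antipode_right' D.g
  rw [D.counit_g, one_smul, ext_sw D.comul_g (F := fun x y => x * antipode ℂ y)
    (by constructor <;> intros <;> simp [add_mul, mul_add])] at this
  simpa using this

lemma antipode_sq_eq (b : A) : antipode ℂ (antipode ℂ (ell D.al b)) * antipode ℂ D.g =
    sw D.L (fun x y => D.lam (x * b) • antipode ℂ y) := by
  rw [← antipode_mul_antidistrib, D.ell_eq, map_sw]
  simp only [map_smul]

/-- Radford's formula. -/
lemma radford (y : A) :
    D.g * antipode ℂ (antipode ℂ (antipode ℂ (antipode ℂ (ell D.al y)))) = arr D.al y * D.g := by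
  have hR := dualR_bij D.coint D.lam_ne
  have hN : ∀ a : A, ∃ n, ∀ b, D.lam (a * b) = D.lam (b * n) := by
    intro a
    obtain ⟨n, hn⟩ := hR.2 (dualL D.lam a)
    exact ⟨n, fun b => by rw [← dualR_apply D.lam b n, hn]; rfl⟩
  choose N hN using hN
  have h1 : ∀ a, antipode ℂ (antipode ℂ a) = arr D.al (N a) := by
    intro a
    rw [D.antipode_eq a, D.arr_eq, map_sw]
    exact sw_congr fun x y => by rw [map_smul, hN]
  have h2 : ∀ a, D.g * (antipode ℂ (antipode ℂ (ell D.al (N a)))) = a * D.g := by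
    intro a
    have e1 := D.ell_eq (N a)
    simp only [← hN] at e1
    have e2 := D.self_eq a
    have e3 : D.g * antipode ℂ (D.g * antipode ℂ (ell D.al (N a))) = a := by
      conv_rhs => rw [e2]
      rw [e1, map_sw, mul_sw]
      simp only [map_smul, mul_smul_comm]
    rw [antipode_mul_antidistrib] at e3
    rw [← mul_one (antipode ℂ (antipode ℂ _)), ← D.antipode_g_mul, ← mul_assoc, ← mul_assoc,
      mul_assoc D.g, e3]
  have h3 := h2 (arr D.al y)
  have h4 : N (arr D.al y) = antipode ℂ (antipode ℂ y) := by
    have := h1 (arr D.al y)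
    rw [← arr_antipode_sq] at this
    have h5 := congrArg (arr (cinv D.al)) this
    rw [arr_cinv_arr, arr_cinv_arr] at h5
    exact h5.symm
  rw [h4] at h3
  rw [← ell_antipode_sq, ← ell_antipode_sq]
  rw [← ell_antipode_sq] at h3
  exact h3

lemma trace_eq (β : A →ₐ[ℂ] ℂ) (c : A) (F : Module.End ℂ A)
    (hF : ∀ x, F x = antipode ℂ (antipode ℂ (ell β x)) * antipode ℂ c) :
    LinearMap.trace ℂ A F = β D.L * D.lam c := by
  have h1 : F = sw D.L (fun x y => (D.lam ∘ₗ LinearMap.mulLeft ℂ c ∘ₗ LinearMap.mulRight ℂ y ∘ₗ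
      antipode ℂ ∘ₗ (ell β).toLinearMap).smulRight x) := by
    ext x
    rw [hF, ← antipode_mul_antidistrib, D.antipode_eq]
    simp [sw, LinearMap.sum_apply, mul_assoc]
  have h2 : LinearMap.trace ℂ A F =
      sw D.L (fun x y => D.lam (c * (antipode ℂ (ell β x) * y))) := by
    rw [h1, map_sw]
    refine sw_congr fun x y => ?_
    rw [LinearMap.trace_smulRight]
    simp
  rw [h2]
  have h3 := sw_ell β D.L (F := fun x y => D.lam (c * (antipode ℂ x * y)))
    (by constructor <;> intros <;> simp [mul_add, add_mul])
  rw [← h3]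
  have h4 := sw_antipode_left (D.lam ∘ₗ LinearMap.mulLeft ℂ c) (ell β D.L)
  simp only [LinearMap.comp_apply, LinearMap.mulLeft_apply, mul_one] at h4
  rw [h4, counit_ell, smul_eq_mul]

end IntData
end Sw

namespace Sw

variable {A : Type*} [Ring A] [HopfAlgebra ℂ A]

lemma lint_move {M : Type*} [AddCommGroup M] [Module ℂ M] {L : A} (hL : IsLInt L) {F : A → A → M}
    (hF : Bil F) (h : A) :
    sw L (fun x y => F (h * x) (antipode ℂ y)) = sw L (fun x y => F x (antipode ℂ y * h)) := by
  obtain ⟨f1, f2, f3, f4⟩ := hF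
  have e1 : sw h (fun u v => sw (u * L) (fun x y => F x (antipode ℂ y * v))) =
      sw L (fun x y => F x (antipode ℂ y * h)) := by
    have : ∀ u v : A, sw (u * L) (fun x y => F x (antipode ℂ y * v)) =
        counit (R := ℂ) u • sw L (fun x y => F x (antipode ℂ y * v)) := by
      intro u v
      rw [hL, sw_smul]
      constructor <;> intros <;> simp [f1, f2, f3, f4, add_mul]
    simp only [this]
    exact sw_counit_left
      { toFun := fun v => sw L (fun x y => F x (antipode ℂ y * v))
        map_add' := by intros; simp [mul_add, f2, sw_add_fun]
        map_smul' := by intros; simp [f4, sw_smul_fun] } h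
  rw [← e1]
  have e2 : ∀ u v : A, sw (u * L) (fun x y => F x (antipode ℂ y * v)) =
      sw u (fun a b => sw L (fun c d => F (a * c) (antipode ℂ d * (antipode ℂ b * v)))) := by
    intro u v
    rw [sw_mul]
    · simp only [antipode_mul_antidistrib, mul_assoc]
    constructor <;> intros <;> simp [f1, f2, f3, f4, add_mul]
  simp only [e2]
  rw [sw_assoc h (F := fun a b v => sw L (fun c d => F (a * c) (antipode ℂ d * (antipode ℂ b * v))))]
  · have e3 : ∀ a z : A, sw z (fun b v => sw L (fun c d => F (a * c) (antipode ℂ d * (antipode ℂ b * v))))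
        = counit (R := ℂ) z • sw L (fun c d => F (a * c) (antipode ℂ d)) := by
      intro a z
      have := sw_antipode_left (M := M)
        { toFun := fun k => sw L (fun c d => F (a * c) (antipode ℂ d * k))
          map_add' := by intros; simp [mul_add, f2, sw_add_fun]
          map_smul' := by intros; simp [f4, sw_smul_fun] } z
      simpa using this
    simp only [e3]
    exact (sw_counit_right
      { toFun := fun a => sw L (fun c d => F (a * c) (antipode ℂ d))
        map_add' := by intros; simp [add_mul, f1, sw_add_fun]
        map_smul' := by intros; simp [f3, sw_smul_fun] } h).symm
  · constructor <;> intros <;> simp [add_mul, mul_add, f1, f2, f3, f4, sw_add_fun, sw_smul_fun]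

lemma maschke {L : A} (hL : IsLInt L) (h0 : counit (R := ℂ) L ≠ 0) : IsSemisimpleRing A := by
  refine { exists_isCompl := fun I => ?_ }
  obtain ⟨f, hf⟩ := (I.restrictScalars ℂ).exists_isCompl
  let P : A →ₗ[ℂ] A := (I.restrictScalars ℂ).subtype ∘ₗ Submodule.projectionOnto _ _ hf
  have hPI : ∀ x, P x ∈ I := fun x => (Submodule.projectionOnto _ _ hf x).2
  have hPid : ∀ x ∈ I, P x = x := fun x hx => by
    have := Submodule.projectionOnto_apply_left hf ⟨x, hx⟩
    simp only [P, LinearMap.comp_apply]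
    rw [this]; rfl
  let Q : A →ₗ[A] A :=
    { toFun := fun x => (counit (R := ℂ) L)⁻¹ • sw L (fun u v => u * P (antipode ℂ v * x))
      map_add' := by intros; simp [mul_add, sw_add_fun]
      map_smul' := fun h x => by
        rw [RingHom.id_apply, smul_eq_mul, smul_eq_mul, mul_smul_comm, mul_sw]
        congr 1
        have := lint_move hL (F := fun a b => a * P (b * x))
          (by constructor <;> intros <;> simp [add_mul, mul_add]) h
        simp only [mul_assoc] at this
        rw [this] }
  have hQ : ∀ x, Q x = (counit (R := ℂ) L)⁻¹ • sw L (fun u v => u * P (antipode ℂ v * x)) := fun _ => rfl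
  have hQI : ∀ x, Q x ∈ I := by
    intro x
    rw [hQ]
    refine (I.restrictScalars ℂ).smul_mem _ ?_
    exact I.sum_mem fun i _ => I.smul_mem _ (hPI _)
  have hQid : ∀ x ∈ I, Q x = x := by
    intro x hx
    rw [hQ]
    have : sw L (fun u v => u * P (antipode ℂ v * x)) = counit (R := ℂ) L • x := by
      have h1 := sw_antipode_right (LinearMap.mulRight ℂ x) L
      simp only [LinearMap.mulRight_apply, one_mul] at h1
      rw [← h1]
      refine sw_congr fun u v => ?_
      rw [hPid (antipode ℂ v * x) (I.smul_mem _ hx), mul_assoc]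
    rw [this, smul_smul, inv_mul_cancel₀ h0, one_smul]
  exact ⟨_, LinearMap.isCompl_of_proj (f := Q.codRestrict I hQI)
    (fun x => Subtype.ext (hQid x x.2))⟩

variable [Module.Finite ℂ A]

/-- Reduction of the semisimplicity of `A` to the triviality of modular functions of `A`, `A*`. -/
lemma semisimple_of_unimodular [Nontrivial A] (hodd : Odd (Module.finrank ℂ A))
    (hA : ∀ (L : A) (al : A →ₐ[ℂ] ℂ), L ≠ 0 → IsLInt L → (∀ h, L * h = al h • L) →
      ∀ x, al x = counit (R := ℂ) x)
    (hD : ∀ (L : Du A) (al : Du A →ₐ[ℂ] ℂ), L ≠ 0 → IsLInt L → (∀ h, L * h = al h • L) →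
      ∀ x, al x = counit (R := ℂ) x) : IsSemisimpleRing A := by
  obtain ⟨D⟩ := exists_intData (A := A)
  have hal := hA D.L D.al D.L_ne D.lint D.L_mul
  have hg : D.g = 1 := by
    let ev : Du A →ₐ[ℂ] ℂ := AlgHom.ofLinearMap
      { toFun := fun f => f D.g, map_add' := fun _ _ => rfl, map_smul' := fun _ _ => rfl }
      (by change (1 : Du A) D.g = 1; rw [du_one_apply, D.counit_g])
      (fun f g => by
        change (f * g) D.g = f D.g * g D.g
        rw [du_mul_apply, ext_sw D.comul_g (F := fun a b => f a * g b)
          (by constructor <;> intros <;> simp [add_mul, mul_add, mul_assoc, mul_left_comm])]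
        simp)
    have h1 := hD (toDu D.lam) ev (by simpa using D.lam_ne) ((lCoint_iff _).1 D.coint) (fun f => by
      apply du_ext
      intro a
      rw [du_mul_apply, du_smul_apply]
      have := congrArg f (D.lam_g a)
      rw [map_sw, map_smul, smul_eq_mul, mul_comm] at this
      refine Eq.trans (sw_congr fun x y => ?_) this
      rw [map_smul, smul_eq_mul]; rfl)
    rw [← sub_eq_zero]
    refine (Module.forall_dual_apply_eq_zero_iff ℂ _).mp fun f => ?_
    rw [map_sub, sub_eq_zero]
    exact h1 (toDu f)
  have hell : ∀ x, ell D.al x = x := fun x => by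
    rw [ell_apply]; simp only [hal]; exact sw_counit_left' x
  have harr : ∀ x, arr D.al x = x := fun x => by
    rw [arr_apply]; simp only [hal]; exact sw_counit_right' x
  have hS : ∀ x : A, antipode ℂ (antipode ℂ (antipode ℂ (antipode ℂ x))) = x := by
    intro x
    have := D.radford x
    rwa [hg, one_mul, mul_one, hell, harr] at this
  apply maschke D.lint
  intro h0
  let S2 : Module.End ℂ A := antipode ℂ ∘ₗ antipode ℂ
  have hS2 : S2 * S2 = 1 := by ext x; exact hS x
  have htr : LinearMap.trace ℂ A S2 = 0 := by
    have := D.trace_eq (Bialgebra.counitAlgHom ℂ A) 1 S2 (fun x => by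
      rw [antipode_one, mul_one, ell_apply]
      change _ = antipode ℂ (antipode ℂ (sw x fun x y => counit (R := ℂ) x • y))
      rw [sw_counit_left']; rfl)
    rw [this]
    change counit (R := ℂ) D.L * _ = 0
    rw [h0, zero_mul]
  refine (Nat.not_even_iff_odd.2 hodd) (even_iff_two_dvd.2 (order_dvd_finrank (U := S2) two_pos
    (by rw [pow_two, hS2]) fun i h1 h2 => ?_))
  rw [show i = 1 by omega, pow_one, htr]

end Sw

namespace Sw

variable {A : Type} [Ring A] [HopfAlgebra ℂ A]

lemma tr_mul_comm (a b : A) : tr (a * b) = tr (b * a) := by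
  unfold tr
  rw [LinearMap.mulRight_mul, LinearMap.mulRight_mul]
  exact LinearMap.trace_mul_comm ℂ _ _

/-- The trace form as a linear functional. -/
def trL : A →ₗ[ℂ] ℂ := LinearMap.trace ℂ A ∘ₗ (LinearMap.mul ℂ A).flip

lemma trL_apply (a : A) : trL a = tr a := rfl

lemma tr_nilp [Module.Finite ℂ A] {a : A} (ha : IsNilpotent a) : tr a = 0 := by
  have h : IsNilpotent (LinearMap.mulRight ℂ a) := by
    obtain ⟨m, hm⟩ := ha
    exact ⟨m, by rw [LinearMap.pow_mulRight, hm, LinearMap.mulRight_zero_eq_zero]⟩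
  exact (LinearMap.isNilpotent_trace_of_isNilpotent h).eq_zero

lemma tr_equiv [Module.Finite ℂ A] (T : A ≃ₐ[ℂ] A) (a : A) : tr (T a) = tr a := by
  refine trace_conj_of_comm T.toLinearEquiv _ _ ?_
  ext x
  simp

lemma tr_one [Module.Finite ℂ A] : tr (1 : A) = Module.finrank ℂ A := by
  rw [tr, LinearMap.mulRight_one]; exact LinearMap.trace_id ℂ A

lemma mulRight_idem {e : A} (he : IsIdempotentElem e) : IsIdempotentElem (LinearMap.mulRight ℂ e) := by
  rw [IsIdempotentElem, Module.End.mul_eq_comp, ← LinearMap.mulRight_mul, he.eq]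

lemma mulRight_pow' (a : A) (k : ℕ) : LinearMap.mulRight ℂ a ^ k = LinearMap.mulRight ℂ (a ^ k) := by
  rw [LinearMap.pow_mulRight]

/-- Convolution of linear functionals. -/
def cv (f g : A →ₗ[ℂ] ℂ) : A →ₗ[ℂ] ℂ where
  toFun a := sw a fun x y => f x * g y
  map_add' := sw_add (by constructor <;> intros <;> simp [mul_add, add_mul, mul_left_comm, mul_assoc])
  map_smul' := sw_smul (by constructor <;> intros <;> simp [mul_add, add_mul, mul_left_comm, mul_assoc])

lemma cv_apply (f g : A →ₗ[ℂ] ℂ) (a : A) : cv f g a = sw a fun x y => f x * g y := rfl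

lemma cv_one (f g : A →ₗ[ℂ] ℂ) : cv f g 1 = f 1 * g 1 := by
  rw [cv_apply, sw_one]
  constructor <;> intros <;> simp [mul_add, add_mul, mul_left_comm, mul_assoc]

lemma cv_algHom_left (β : A →ₐ[ℂ] ℂ) (f : A →ₗ[ℂ] ℂ) (a : A) :
    cv β.toLinearMap f a = f (ell β a) := by
  rw [cv_apply, ell_apply, map_sw]; simp

lemma cv_algHom_right (β : A →ₐ[ℂ] ℂ) (f : A →ₗ[ℂ] ℂ) (a : A) :
    cv f β.toLinearMap a = f (arr β a) := by
  rw [cv_apply, arr_apply, map_sw]; simp [mul_comm]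

lemma cv_sum_left {ι : Type*} (s : Finset ι) (c : ι → ℂ) (f : ι → A →ₗ[ℂ] ℂ) (g : A →ₗ[ℂ] ℂ) (a : A) :
    cv (∑ i ∈ s, c i • f i) g a = ∑ i ∈ s, c i * cv (f i) g a := by
  simp only [cv_apply, sw, Finset.sum_mul, Finset.mul_sum, LinearMap.sum_apply, LinearMap.smul_apply,
    smul_eq_mul]
  rw [Finset.sum_comm]
  simp [mul_assoc]

lemma cv_sum_right {ι : Type*} (s : Finset ι) (c : ι → ℂ) (f : ι → A →ₗ[ℂ] ℂ) (g : A →ₗ[ℂ] ℂ) (a : A) :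
    cv g (∑ i ∈ s, c i • f i) a = ∑ i ∈ s, c i * cv g (f i) a := by
  simp only [cv_apply, sw, Finset.sum_mul, Finset.mul_sum, LinearMap.sum_apply, LinearMap.smul_apply,
    smul_eq_mul]
  rw [Finset.sum_comm]
  simp [mul_left_comm]

/-- Characters of finite-dimensional representations. -/
def IsChar (f : A →ₗ[ℂ] ℂ) : Prop :=
  ∃ (W : Type) (_ : AddCommGroup W) (_ : Module ℂ W) (_ : Module.Finite ℂ W)
    (σ : A →ₐ[ℂ] Module.End ℂ W), ∀ a, f a = LinearMap.trace ℂ W (σ a)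

/-- The tensor product of two representations. -/
def tens {W W' : Type*} [AddCommGroup W] [Module ℂ W] [AddCommGroup W'] [Module ℂ W']
    (σ : A →ₐ[ℂ] Module.End ℂ W) (τ : A →ₐ[ℂ] Module.End ℂ W') : A →ₐ[ℂ] Module.End ℂ (W ⊗[ℂ] W') :=
  (Module.endTensorEndAlgHom (R := ℂ) (A := ℂ) (M := W) (N := W')).comp ((Algebra.TensorProduct.map σ τ).comp (Bialgebra.comulAlgHom ℂ A))

lemma tens_apply {W W' : Type*} [AddCommGroup W] [Module ℂ W] [AddCommGroup W'] [Module ℂ W']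
    (σ : A →ₐ[ℂ] Module.End ℂ W) (τ : A →ₐ[ℂ] Module.End ℂ W') (a : A) :
    tens σ τ a = sw a fun x y => TensorProduct.map (σ x) (τ y) := by
  simp only [tens, AlgHom.comp_apply, Bialgebra.comulAlgHom_apply]
  rw [comul_eq_sw, map_sw, map_sw]
  rfl

lemma IsChar.cv {f g : A →ₗ[ℂ] ℂ} (hf : IsChar f) (hg : IsChar g) : IsChar (cv f g) := by
  obtain ⟨W, _, _, _, σ, hσ⟩ := hf
  obtain ⟨W', _, _, _, τ, hτ⟩ := hg
  refine ⟨W ⊗[ℂ] W', inferInstance, inferInstance, inferInstance, tens σ τ, fun a => ?_⟩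
  rw [tens_apply, map_sw, cv_apply]
  refine sw_congr fun x y => ?_
  rw [LinearMap.trace_tensorProduct', hσ, hτ]

lemma isChar_chi (I : Irr A) (i : Fin I.k) : IsChar (I.chi i) :=
  ⟨I.V i, inferInstance, inferInstance, inferInstance, I.ρ i, fun _ => rfl⟩

lemma IsChar.mul_comm {f : A →ₗ[ℂ] ℂ} (hf : IsChar f) (a b : A) : f (a * b) = f (b * a) := by
  obtain ⟨W, _, _, _, σ, hσ⟩ := hf
  rw [hσ, hσ, map_mul σ, map_mul σ, LinearMap.trace_mul_comm]

lemma IsChar.nilp {f : A →ₗ[ℂ] ℂ} (hf : IsChar f) {a : A} (ha : IsNilpotent a) : f a = 0 := by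
  obtain ⟨W, _, _, _, σ, hσ⟩ := hf
  rw [hσ]
  exact (LinearMap.isNilpotent_trace_of_isNilpotent (ha.map σ)).eq_zero

lemma IsChar.idem {f : A →ₗ[ℂ] ℂ} (hf : IsChar f) {a : A} (ha : IsIdempotentElem a) :
    ∃ b : ℕ, f a = b := by
  obtain ⟨W, _, _, _, σ, hσ⟩ := hf
  exact ⟨_, (hσ a).trans (trace_idem (ha.map σ))⟩

namespace Irr
variable (I : Irr A)

lemma IsChar_eq_sum {f : A →ₗ[ℂ] ℂ} (hf : IsChar f) (a : A) :
    f a = ∑ i, f (I.e i) * I.chi i a :=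
  I.eq_sum_chi f hf.mul_comm (fun _ ha => hf.nilp (I.isNilpotent_of_mem ha)) a

/-- Dimension of the indecomposable projective with top `V i`. -/
def m (i : Fin I.k) : ℕ := Module.finrank ℂ (LinearMap.range (LinearMap.mulRight ℂ (I.e i)))

variable [Module.Finite ℂ A]

lemma tr_e (i) : tr (I.e i) = I.m i := trace_idem (mulRight_idem (I.idem i))

lemma tr_eq (a : A) : tr a = ∑ i, (I.m i : ℂ) * I.chi i a := by
  have := I.eq_sum_chi trL tr_mul_comm (fun a ha => tr_nilp (I.isNilpotent_of_mem ha)) a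
  simpa [trL_apply, tr_e] using this

lemma trL_eq : (trL : A →ₗ[ℂ] ℂ) = ∑ i, (I.m i : ℂ) • I.chi i := by
  ext a; rw [trL_apply, I.tr_eq]; simp

lemma finrank_eq : Module.finrank ℂ A = ∑ i, I.m i * I.n i := by
  have := I.tr_eq 1
  rw [tr_one] at this
  simp only [chi_one] at this
  exact_mod_cast this

/-- The quotient map from the indecomposable projective to the simple module. -/
def top (i) : LinearMap.range (LinearMap.mulRight ℂ (I.e i)) →ₗ[ℂ] I.V i :=
  ((I.ρ i).toLinearMap.flip (I.v0 i)) ∘ₗ Submodule.subtype _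

lemma top_surjective (i) : Function.Surjective (I.top i) := by
  intro v
  obtain ⟨a, ha, -⟩ := I.exists_unit i v (I.ξ i)
  refine ⟨⟨a * I.e i, a, rfl⟩, ?_⟩
  change I.ρ i (a * I.e i) (I.v0 i) = v
  rw [map_mul (I.ρ i), Module.End.mul_apply, I.e_self, I.hξ, one_smul, ha, I.hξ, one_smul]

lemma n_le_m (i) : I.n i ≤ I.m i := by
  have := LinearMap.finrank_le_finrank_of_surjective (I.top_surjective i)
  simpa [m] using this

lemma m_pos (i) : 0 < I.m i := (I.n_pos i).trans_le (I.n_le_m i)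

/-- If `m i = n i` then `a * e i` depends on `ρ i a` only. -/
lemma mul_e_eq_zero {i} (h : I.m i = I.n i) {a : A} (ha : I.ρ i a = 0) : a * I.e i = 0 := by
  have hf : Module.finrank ℂ (LinearMap.range (LinearMap.mulRight ℂ (I.e i))) =
      Module.finrank ℂ (I.V i) := by simpa [m] using h
  have hinj := (LinearMap.injective_iff_surjective_of_finrank_eq_finrank hf).2 (I.top_surjective i)
  have : (⟨a * I.e i, a, rfl⟩ : LinearMap.range (LinearMap.mulRight ℂ (I.e i))) = 0 := by
    apply hinj
    rw [map_zero]
    change I.ρ i (a * I.e i) (I.v0 i) = 0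
    rw [map_mul (I.ρ i), ha]; simp
  exact congrArg Subtype.val this

lemma cv_chi_tr (i) (a : A) : cv (I.chi i) trL a = I.n i * tr a := by
  have := conv_tr (W := Module.Dual ℂ (I.V i)) (Module.Dual.transpose ∘ₗ (I.ρ i).toLinearMap)
    (fun a b => by rw [LinearMap.comp_apply, AlgHom.toLinearMap_apply, map_mul (I.ρ i)]; rfl)
    (by rw [LinearMap.comp_apply, AlgHom.toLinearMap_apply, map_one (I.ρ i)]; rfl) a
  rw [cv_apply]
  simp only [LinearMap.comp_apply, AlgHom.toLinearMap_apply, LinearMap.trace_transpose'] at this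
  simpa [trL_apply, chi_apply] using this

lemma cv_tr_chi (hS : Function.Surjective (antipode ℂ (A := A))) (i) (a : A) :
    cv trL (I.chi i) a = I.n i * tr a := by
  have := tr_conv (W := Module.Dual ℂ (I.V i)) (Module.Dual.transpose ∘ₗ (I.ρ i).toLinearMap)
    (fun a b => by rw [LinearMap.comp_apply, AlgHom.toLinearMap_apply, map_mul (I.ρ i)]; rfl)
    (by rw [LinearMap.comp_apply, AlgHom.toLinearMap_apply, map_one (I.ρ i)]; rfl) hS a
  rw [cv_apply]
  simp only [LinearMap.comp_apply, AlgHom.toLinearMap_apply, LinearMap.trace_transpose'] at this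
  simpa [trL_apply, chi_apply] using this

end Irr
end Sw

namespace Sw

variable {A : Type} [Ring A] [HopfAlgebra ℂ A]

namespace Irr
variable (I : Irr A)

lemma chi_inj {i j} (h : ∀ a, I.chi i a = I.chi j a) : i = j := by
  by_contra hij
  have := h (I.e i)
  rw [chi_e, chi_e, if_pos rfl, if_neg (Ne.symm hij)] at this
  exact one_ne_zero this

lemma rho_surj (i) : Function.Surjective (I.ρ i) := by
  classical
  intro f
  obtain ⟨a, ha⟩ := I.surj (Pi.single i f)
  exact ⟨a, by rw [ha]; simp⟩

instance (i : Fin I.k) : Nontrivial (I.V i) := ⟨_, _, I.v0_ne i⟩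

lemma exists_perm (T : A ≃ₐ[ℂ] A) (i) :
    ∃ j, ∃ φ : I.V j ≃ₗ[ℂ] I.V i, ∀ a v, I.ρ i (T a) (φ v) = φ (I.ρ j a v) :=
  I.exists_conj ((I.ρ i).comp T.toAlgHom) ((I.rho_surj i).comp T.surjective)

/-- The permutation of the simple modules given by twisting with an automorphism. -/
def perm (T : A ≃ₐ[ℂ] A) (i : Fin I.k) : Fin I.k := (I.exists_perm T i).choose

/-- The intertwiner of the twist. -/
def tw (T : A ≃ₐ[ℂ] A) (i : Fin I.k) : I.V (I.perm T i) ≃ₗ[ℂ] I.V i :=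
  (I.exists_perm T i).choose_spec.choose

lemma tw_spec (T : A ≃ₐ[ℂ] A) (i) (a : A) (v) :
    I.ρ i (T a) (I.tw T i v) = I.tw T i (I.ρ (I.perm T i) a v) :=
  (I.exists_perm T i).choose_spec.choose_spec a v

lemma chi_perm (T : A ≃ₐ[ℂ] A) (i) (a : A) : I.chi (I.perm T i) a = I.chi i (T a) := by
  rw [chi_apply, chi_apply]
  rw [← LinearMap.trace_conj' (I.ρ (I.perm T i) a) (I.tw T i)]
  congr 1
  refine LinearMap.ext fun v => ?_
  obtain ⟨w, rfl⟩ := (I.tw T i).surjective v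
  rw [tw_spec, LinearEquiv.conj_apply_apply, LinearEquiv.symm_apply_apply]

lemma n_perm (T : A ≃ₐ[ℂ] A) (i) : I.n (I.perm T i) = I.n i := by
  have := I.chi_perm T i 1
  rw [map_one T, chi_one, chi_one] at this
  exact_mod_cast this

lemma perm_eq {T : A ≃ₐ[ℂ] A} {i j} (h : ∀ a, I.chi j a = I.chi i (T a)) : I.perm T i = j :=
  I.chi_inj fun a => by rw [chi_perm, h]

lemma perm_mul (T U : A ≃ₐ[ℂ] A) (i) : I.perm (T * U) i = I.perm U (I.perm T i) :=
  I.perm_eq fun a => by rw [chi_perm, chi_perm]; rfl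

lemma perm_one (i) : I.perm 1 i = i := I.perm_eq fun _ => rfl

lemma perm_inj (T : A ≃ₐ[ℂ] A) : Function.Injective (I.perm T) := by
  intro i j h
  have := congrArg (I.perm T⁻¹) h
  rwa [← perm_mul, ← perm_mul, mul_inv_cancel, perm_one, perm_one] at this

lemma m_perm [Module.Finite ℂ A] (T : A ≃ₐ[ℂ] A) (i) : I.m (I.perm T i) = I.m i := by
  have h := tr_equiv T (I.e (I.perm T i))
  rw [tr_e, tr_eq I, Finset.sum_eq_single i, ← chi_perm, chi_e, if_pos rfl, mul_one] at h
  · exact_mod_cast h.symm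
  · intro j _ hj
    rw [← chi_perm, chi_e, if_neg (fun h => hj (I.perm_inj T h)), mul_zero]
  · simp

/-- Automorphisms whose twist fixes the simple module `V i`. -/
def stab (i : Fin I.k) : Subgroup (A ≃ₐ[ℂ] A) where
  carrier := {T | I.perm T i = i}
  one_mem' := I.perm_one i
  mul_mem' {T U} hT hU := by
    change I.perm (T * U) i = i
    rw [perm_mul, show I.perm T i = i from hT, show I.perm U i = i from hU]
  inv_mem' {T} hT := by
    apply I.perm_inj T
    rw [← perm_mul, inv_mul_cancel, perm_one, show I.perm T i = i from hT]

lemma mem_stab {T : A ≃ₐ[ℂ] A} {i} : T ∈ I.stab i ↔ I.perm T i = i := Iff.rfl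

/-- The weight of a simple module: its contribution to `dim A`. -/
def w (i : Fin I.k) : ℕ := I.m i * I.n i

lemma w_perm [Module.Finite ℂ A] (T : A ≃ₐ[ℂ] A) (i) : I.w (I.perm T i) = I.w i := by
  rw [w, w, m_perm, n_perm]

lemma exists_idx (β : A →ₐ[ℂ] ℂ) : ∃ i, ∃ φ : I.V i ≃ₗ[ℂ] ℂ,
    ∀ a v, β a * (φ v) = φ (I.ρ i a v) := by
  have hs : Function.Surjective ((Algebra.ofId ℂ (Module.End ℂ ℂ)).comp β) := by
    intro f
    refine ⟨algebraMap ℂ A (f 1), ?_⟩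
    ext
    simp [Algebra.ofId_apply]
  obtain ⟨i, φ, h⟩ := I.exists_conj _ hs
  exact ⟨i, φ, fun a v => by rw [← h]; simp [Algebra.ofId_apply, Module.algebraMap_end_apply]⟩

/-- The index of a one-dimensional representation. -/
def idx (β : A →ₐ[ℂ] ℂ) : Fin I.k := (I.exists_idx β).choose

lemma rho_idx (β : A →ₐ[ℂ] ℂ) (a : A) : I.ρ (I.idx β) a = β a • 1 := by
  obtain ⟨φ, h⟩ := (I.exists_idx β).choose_spec
  refine LinearMap.ext fun v => φ.injective ?_
  exact (h a v).symm.trans (map_smul φ (β a) v).symm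

lemma n_idx (β : A →ₐ[ℂ] ℂ) : I.n (I.idx β) = 1 := by
  obtain ⟨φ, h⟩ := (I.exists_idx β).choose_spec
  exact (Module.finrank_fin_fun ℂ).symm.trans (φ.finrank_eq.trans (Module.finrank_self ℂ))

lemma chi_idx (β : A →ₐ[ℂ] ℂ) (a : A) : I.chi (I.idx β) a = β a := by
  rw [chi_apply, rho_idx, map_smul, LinearMap.trace_one, Module.finrank_fin_fun, n_idx]; simp

lemma idx_inj {β γ : A →ₐ[ℂ] ℂ} (h : I.idx β = I.idx γ) : β = γ := by
  ext a
  rw [← I.chi_idx, h, chi_idx]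

/-- One-dimensional simple modules come from algebra homomorphisms. -/
lemma exists_of_n_eq_one {i} (h : I.n i = 1) : ∃ β : A →ₐ[ℂ] ℂ, I.idx β = i := by
  have key : ∀ a, I.ρ i a = I.chi i a • 1 := by
    intro a
    have : Module.finrank ℂ (I.V i) = 1 := by simp [h]
    obtain ⟨c, hc⟩ : ∃ c : ℂ, I.ρ i a = c • 1 := by
      obtain ⟨v, hv, hv2⟩ := finrank_eq_one_iff'.1 this
      obtain ⟨c, hc⟩ := hv2 (I.ρ i a v)
      refine ⟨c, LinearMap.ext fun w => ?_⟩
      obtain ⟨d, rfl⟩ := hv2 w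
      rw [map_smul, ← hc]; simp [smul_comm d c]
    rw [chi_apply, hc, map_smul, LinearMap.trace_one, this]; simp
  have hne : (1 : Module.End ℂ (I.V i)) ≠ 0 := one_ne_zero
  let β : A →ₐ[ℂ] ℂ := AlgHom.ofLinearMap (I.chi i) (by rw [chi_one, h]; simp) fun a b => by
    have := map_mul (I.ρ i) a b
    rw [key, key a, key b, smul_mul_smul_comm, mul_one] at this
    exact smul_left_injective ℂ hne this
  exact ⟨β, I.chi_inj fun a => by rw [chi_idx]; rfl⟩

end Irr

lemma ell_counit : ell (Bialgebra.counitAlgHom ℂ A) = AlgHom.id ℂ A := by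
  ext a
  rw [ell_apply]; exact sw_counit_left' a

lemma arr_counit : arr (Bialgebra.counitAlgHom ℂ A) = AlgHom.id ℂ A := by
  ext a
  rw [arr_apply]; exact sw_counit_right' a

/-- Convolution powers of a one-dimensional representation. -/
def pw (β : A →ₐ[ℂ] ℂ) (i : ℕ) : A →ₐ[ℂ] ℂ :=
  (Bialgebra.counitAlgHom ℂ A).comp (ellE β ^ i : A ≃ₐ[ℂ] A).toAlgHom

lemma pw_apply (β : A →ₐ[ℂ] ℂ) (i : ℕ) (a : A) :
    pw β i a = counit (R := ℂ) ((ellE β ^ i : A ≃ₐ[ℂ] A) a) := rfl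

lemma ell_pw (β : A →ₐ[ℂ] ℂ) (i : ℕ) (a : A) : ell (pw β i) a = (ellE β ^ i : A ≃ₐ[ℂ] A) a := by
  induction i generalizing a with
  | zero =>
    have : pw β 0 = Bialgebra.counitAlgHom ℂ A := rfl
    rw [this, ell_counit]; rfl
  | succ i ih =>
    rw [pow_succ, AlgEquiv.mul_apply, ellE_apply, ← ih, ell_ell, ell_apply]
    refine sw_congr fun x y => ?_
    rw [pw_apply, pw_apply, pow_succ]; rfl

lemma ellE_pw (β : A →ₐ[ℂ] ℂ) (i : ℕ) : ellE (pw β i) = ellE β ^ i := by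
  ext a; exact ell_pw β i a

lemma ellE_comm_arrE (β γ : A →ₐ[ℂ] ℂ) : Commute (ellE β) (arrE γ) := by
  ext a; exact ell_arr β γ a

lemma pw_eq_arr (β : A →ₐ[ℂ] ℂ) (i : ℕ) (a : A) :
    pw β i a = counit (R := ℂ) ((arrE β ^ i : A ≃ₐ[ℂ] A) a) := by
  induction i generalizing a with
  | zero => rfl
  | succ i ih =>
    rw [pow_succ, AlgEquiv.mul_apply, ← ih, pw_apply, pw_apply, pow_succ', AlgEquiv.mul_apply,
      ellE_apply, counit_ell, ← AlgEquiv.mul_apply, ((ellE_comm_arrE β β).pow_left i).eq,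
      AlgEquiv.mul_apply, arrE_apply, counit_arr]

lemma arr_pw (β : A →ₐ[ℂ] ℂ) (i : ℕ) (a : A) : arr (pw β i) a = (arrE β ^ i : A ≃ₐ[ℂ] A) a := by
  induction i generalizing a with
  | zero =>
    have : pw β 0 = Bialgebra.counitAlgHom ℂ A := rfl
    rw [this, arr_counit]; rfl
  | succ i ih =>
    rw [pow_succ, AlgEquiv.mul_apply, arrE_apply, ← ih, arr_arr, arr_apply]
    refine sw_congr fun x y => ?_
    rw [pw_eq_arr, pw_eq_arr, pow_succ]; rfl

lemma arrE_pw (β : A →ₐ[ℂ] ℂ) (i : ℕ) : arrE (pw β i) = arrE β ^ i := by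
  ext a; exact arr_pw β i a

lemma ellE_eq_one {β : A →ₐ[ℂ] ℂ} : ellE β = 1 ↔ β = Bialgebra.counitAlgHom ℂ A := by
  constructor
  · intro h
    ext a
    rw [← counit_ell, ← ellE_apply, h]; rfl
  · rintro rfl
    ext a
    rw [ellE_apply, ell_counit]; rfl

lemma arrE_eq_one {β : A →ₐ[ℂ] ℂ} : arrE β = 1 ↔ β = Bialgebra.counitAlgHom ℂ A := by
  constructor
  · intro h
    ext a
    rw [← counit_arr, ← arrE_apply, h]; rfl
  · rintro rfl
    ext a
    rw [arrE_apply, arr_counit]; rfl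

lemma ellE_pow_eq_one {β : A →ₐ[ℂ] ℂ} {i : ℕ} : ellE β ^ i = 1 ↔ arrE β ^ i = 1 := by
  rw [← ellE_pw, ← arrE_pw, ellE_eq_one, arrE_eq_one]

variable [Module.Finite ℂ A]

lemma isOfFinOrder_ellE (β : A →ₐ[ℂ] ℂ) : IsOfFinOrder (ellE β) := by
  obtain ⟨I⟩ := exists_irr (A := A)
  have : Finite (A →ₐ[ℂ] ℂ) := Finite.of_injective I.idx fun _ _ => I.idx_inj
  rw [← finite_powers]
  refine (Set.finite_range (ellE (A := A))).subset ?_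
  rintro _ ⟨i, rfl⟩
  exact ⟨_, ellE_pw β i⟩

/-- Twisted endomorphisms for a nontrivial character are traceless. -/
lemma trace_arr_ne {β : A →ₐ[ℂ] ℂ} (hβ : β ≠ Bialgebra.counitAlgHom ℂ A) :
    LinearMap.trace ℂ A (arr β).toLinearMap ≠ Module.finrank ℂ A := by
  intro h
  obtain ⟨s, hs, h1⟩ := isOfFinOrder_iff_pow_eq_one.1 (isOfFinOrder_ellE β)
  rw [ellE_pow_eq_one] at h1
  have h2 : ∀ i : ℕ, (arr β).toLinearMap ^ i = (arrE β ^ i : A ≃ₐ[ℂ] A).toLinearMap := by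
    intro i
    induction i with
    | zero => rfl
    | succ i ih => rw [pow_succ, ih, pow_succ]; rfl
  have := eq_one_of_trace_eq (U := (arr β).toLinearMap) hs (by rw [h2, h1]; rfl) h
  apply hβ
  rw [← arrE_eq_one]
  ext a
  exact LinearMap.congr_fun this a

variable {W : Type*} [AddCommGroup W] [Module ℂ W] [Module.Finite ℂ W]

lemma cinv_ne {β : A →ₐ[ℂ] ℂ} (hβ : β ≠ Bialgebra.counitAlgHom ℂ A) :
    cinv β ≠ Bialgebra.counitAlgHom ℂ A := by
  intro h
  apply hβ
  rw [← cinv_cinv β, h]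
  ext a
  exact counit_antipode a

lemma trace_eq_zero_ell {β : A →ₐ[ℂ] ℂ} (hβ : β ≠ Bialgebra.counitAlgHom ℂ A)
    (σ : A →ₐ[ℂ] Module.End ℂ W) (ψ : Module.End ℂ W)
    (h : ∀ a w, ψ (σ a w) = σ (ell β a) (ψ w)) : LinearMap.trace ℂ W ψ = 0 := by
  have := trace_semilinear_ell σ β ψ h
  rw [← sub_eq_zero, ← sub_mul] at this
  exact (mul_eq_zero.1 this).resolve_left (sub_ne_zero.2 (trace_arr_ne (cinv_ne hβ)).symm)

lemma trace_eq_zero_arr {β : A →ₐ[ℂ] ℂ} (hβ : β ≠ Bialgebra.counitAlgHom ℂ A)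
    (σ : A →ₐ[ℂ] Module.End ℂ W) (ψ : Module.End ℂ W)
    (h : ∀ a w, ψ (σ a w) = σ (arr β a) (ψ w)) : LinearMap.trace ℂ W ψ = 0 := by
  have := trace_semilinear_arr σ β ψ h
  rw [← sub_eq_zero, ← sub_mul] at this
  exact (mul_eq_zero.1 this).resolve_left (sub_ne_zero.2 (trace_arr_ne hβ).symm)

end Sw

namespace Sw

variable {A : Type} [Ring A] [HopfAlgebra ℂ A] [Module.Finite ℂ A]

section groupLike

lemma sw_groupLike {u : A} (hu : IsGroupLikeElem ℂ u) {M : Type*} [AddCommGroup M] [Module ℂ M]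
    {F : A → A → M} (h : Bil F) : sw u F = F u u := by
  rw [sw_eq _ h, hu.comul_eq_tmul_self, h.toLin_tmul]

lemma finite_groupLike : Finite (GroupLike ℂ A) :=
  (linearIndep_groupLikeVal (R := ℂ) (A := A)).finite

lemma isOfFinOrder_groupLike {u : A} (hu : IsGroupLikeElem ℂ u) : IsOfFinOrder u := by
  have := finite_groupLike (A := A)
  have h := isOfFinOrder_of_finite (⟨u, hu⟩ : GroupLike ℂ A)
  rw [isOfFinOrder_iff_pow_eq_one] at h ⊢
  obtain ⟨n, hn, h⟩ := h
  exact ⟨n, hn, congrArg GroupLike.val h⟩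

/-- Nontrivial group-likes are traceless. -/
lemma tr_groupLike {u : A} (hu : IsGroupLikeElem ℂ u) (h1 : u ≠ 1) : tr u = 0 := by
  have h := conv_tr (W := A) (LinearMap.mul ℂ A).flip (fun a b => by ext x; simp [mul_assoc])
    (by ext x; simp) u
  rw [sw_groupLike hu] at h
  · change tr u * tr u = _ at h
    rw [← sub_eq_zero, ← sub_mul] at h
    refine (mul_eq_zero.1 h).resolve_left fun h2 => h1 ?_
    obtain ⟨s, hs, h3⟩ := isOfFinOrder_iff_pow_eq_one.1 (isOfFinOrder_groupLike hu)
    have := eq_one_of_trace_eq (U := LinearMap.mulRight ℂ u) hs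
      (by rw [mulRight_pow', h3, LinearMap.mulRight_one]; rfl) (sub_eq_zero.1 h2)
    simpa using LinearMap.congr_fun this 1
  · simp only [← trL_apply]
    constructor <;> intros <;> simp [mul_add, add_mul, mul_left_comm, mul_assoc]

lemma orderOf_groupLike_dvd {u : A} (hu : IsGroupLikeElem ℂ u) : orderOf u ∣ Module.finrank ℂ A := by
  refine order_dvd_finrank (U := LinearMap.mulRight ℂ u) (isOfFinOrder_groupLike hu).orderOf_pos
    (by rw [mulRight_pow', pow_orderOf_eq_one, LinearMap.mulRight_one]; rfl) fun i hi his => ?_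
  rw [mulRight_pow']
  exact tr_groupLike hu.pow (pow_ne_one_of_lt_orderOf hi.ne' his)

lemma ell_groupLike (β : A →ₐ[ℂ] ℂ) {u : A} (hu : IsGroupLikeElem ℂ u) : ell β u = β u • u := by
  rw [ell_apply, sw_groupLike hu]
  constructor <;> intros <;> simp [add_smul, smul_smul, mul_comm]

lemma pw_groupLike (β : A →ₐ[ℂ] ℂ) {u : A} (hu : IsGroupLikeElem ℂ u) (i : ℕ) :
    pw β i u = β u ^ i := by
  induction i with
  | zero => exact hu.counit_eq_one
  | succ i ih =>
    rw [pw_apply, pow_succ, AlgEquiv.mul_apply, ellE_apply, ell_groupLike β hu, map_smul, map_smul,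
      ← pw_apply, ih, smul_eq_mul, pow_succ']

end groupLike

lemma orderOf_ellE_dvd (β : A →ₐ[ℂ] ℂ) : orderOf (ellE β) ∣ Module.finrank ℂ A := by
  have h2 : ∀ i : ℕ, (ell β).toLinearMap ^ i = (ellE β ^ i : A ≃ₐ[ℂ] A).toLinearMap := by
    intro i
    induction i with
    | zero => rfl
    | succ i ih => rw [pow_succ, ih, pow_succ]; rfl
  refine order_dvd_finrank (U := (ell β).toLinearMap) (isOfFinOrder_ellE β).orderOf_pos
    (by rw [h2, pow_orderOf_eq_one]; rfl) fun i hi his => ?_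
  rw [h2]
  have h3 : pw β i ≠ Bialgebra.counitAlgHom ℂ A := by
    rw [Ne, ← ellE_eq_one, ellE_pw]
    exact pow_ne_one_of_lt_orderOf hi.ne' his
  refine trace_eq_zero_ell h3 (Algebra.lmul ℂ A) _ fun a w => ?_
  rw [ell_pw]
  simp

lemma pw_inj (β : A →ₐ[ℂ] ℂ) {i j : ℕ} (hi : i < orderOf (ellE β)) (hj : j < orderOf (ellE β))
    (h : pw β i = pw β j) : i = j := by
  have h2 : ellE β ^ i = ellE β ^ j := by rw [← ellE_pw, h, ellE_pw]
  exact pow_injOn_Iio_orderOf hi hj h2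

namespace Irr
variable (I : Irr A)

/-- The index of the trivial module. -/
def triv : Fin I.k := I.idx (Bialgebra.counitAlgHom ℂ A)

lemma perm_ell_triv (β : A →ₐ[ℂ] ℂ) : I.perm (ellE β) I.triv = I.idx β :=
  I.perm_eq fun a => by rw [triv, chi_idx, chi_idx]; exact (counit_ell β a).symm

lemma m_idx (β : A →ₐ[ℂ] ℂ) : I.m (I.idx β) = I.m I.triv := by rw [← perm_ell_triv, m_perm]

lemma w_idx (β : A →ₐ[ℂ] ℂ) : I.w (I.idx β) = I.m I.triv := by rw [w, m_idx, n_idx, mul_one]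

lemma finrank_eq_w : Module.finrank ℂ A = ∑ i, I.w i := I.finrank_eq

/-- Multiplicities of simple modules in tensor products. -/
def mult (i j l : Fin I.k) : ℕ := (((isChar_chi I i).cv (isChar_chi I j)).idem (I.idem l)).choose

lemma cv_e (i j l) : cv (I.chi i) (I.chi j) (I.e l) = I.mult i j l :=
  (((isChar_chi I i).cv (isChar_chi I j)).idem (I.idem l)).choose_spec

lemma sum_mult (i j) : ∑ l, I.mult i j l * I.n l = I.n i * I.n j := by
  have := I.IsChar_eq_sum ((isChar_chi I i).cv (isChar_chi I j)) 1
  rw [cv_one] at this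
  simp only [cv_e, chi_one] at this
  exact_mod_cast this.symm

lemma mult_le (i j l) : I.mult i j l * I.n l ≤ I.n i * I.n j := by
  rw [← sum_mult]
  exact Finset.single_le_sum (f := fun l => I.mult i j l * I.n l) (fun _ _ => Nat.zero_le _)
    (Finset.mem_univ l)

lemma sum_m_mult (j l) (hS : Function.Surjective (antipode ℂ (A := A))) :
    ∑ i, I.m i * I.mult i j l = I.n j * I.m l := by
  have := I.cv_tr_chi hS j (I.e l)
  rw [I.trL_eq, cv_sum_left, tr_e] at this
  simp only [cv_e] at this
  exact_mod_cast this

lemma sum_m_mult' (j l) : ∑ i, I.m i * I.mult j i l = I.n j * I.m l := by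
  have := I.cv_chi_tr j (I.e l)
  rw [I.trL_eq, cv_sum_right, tr_e] at this
  simp only [cv_e] at this
  exact_mod_cast this

lemma mult_idx_left (β : A →ₐ[ℂ] ℂ) (j l) :
    I.mult (I.idx β) j l = if I.perm (ellE β) j = l then 1 else 0 := by
  have h : I.chi (I.idx β) = β.toLinearMap := LinearMap.ext fun a => I.chi_idx β a
  have := I.cv_e (I.idx β) j l
  rw [h, cv_algHom_left, ← ellE_apply, ← chi_perm, chi_e] at this
  split_ifs at this ⊢ <;> exact_mod_cast this.symm

lemma w_ge (hS : Function.Surjective (antipode ℂ (A := A))) (j) : I.m I.triv ≤ I.w j := by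
  have h := I.sum_m_mult j j hS
  have h1 : I.mult I.triv j j = 1 := by
    have h2 : ellE (Bialgebra.counitAlgHom ℂ A) = 1 := ellE_eq_one.2 rfl
    rw [triv, mult_idx_left, h2, perm_one, if_pos rfl]
  have := Finset.single_le_sum (f := fun i => I.m i * I.mult i j j) (fun _ _ => Nat.zero_le _)
    (Finset.mem_univ I.triv)
  rw [h] at this
  simp only [h1, mul_one] at this
  rw [w, mul_comm]; exact this

lemma exists_tw {T : A ≃ₐ[ℂ] A} {x} (h : T ∈ I.stab x) :
    ∃ φ : I.V x ≃ₗ[ℂ] I.V x, ∀ a v, I.ρ x (T a) (φ v) = φ (I.ρ x a v) := by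
  have h1 : ∃ j, j = I.perm T x ∧ ∃ φ : I.V j ≃ₗ[ℂ] I.V x, ∀ a v, I.ρ x (T a) (φ v) = φ (I.ρ j a v) :=
    ⟨_, rfl, I.tw T x, I.tw_spec T x⟩
  obtain ⟨j, hj, h2⟩ := h1
  rw [I.mem_stab.1 h] at hj
  subst hj
  exact h2

/-- Operators commuting with an irreducible representation are scalars. -/
lemma schur {x} (f : Module.End ℂ (I.V x)) (h : ∀ a, f * I.ρ x a = I.ρ x a * f) :
    ∃ μ : ℂ, f = algebraMap ℂ _ μ := by
  obtain ⟨μ, hμ⟩ := Module.End.exists_eigenvalue f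
  obtain ⟨v, hv⟩ := hμ.exists_hasEigenvector
  refine ⟨μ, LinearMap.ext fun w => ?_⟩
  obtain ⟨φ, hφ⟩ := Module.Projective.exists_dual_eq_one ℂ hv.2
  obtain ⟨a, ha⟩ := I.rho_surj x (φ.smulRight w)
  have h1 : I.ρ x a v = w := by rw [ha]; simp [hφ]
  rw [← h1, ← Module.End.mul_apply, h, Module.End.mul_apply, hv.apply_eq_smul]
  simp

lemma tr_mem {a : A} (h : a ∈ I.J) : tr a = 0 := tr_nilp (I.isNilpotent_of_mem h)

/-- A twisted multiplication operator attached to a finite-order automorphism fixing `V x`. -/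
lemma exists_twisted {T : A ≃ₐ[ℂ] A} {x} (h : T ∈ I.stab x) {M : ℕ} (hM : 0 < M) (hT : T ^ M = 1) :
    ∃ (F : Module.End ℂ A) (c : A) (μ : ℂ), (∀ a, F a = T a * c) ∧ μ ≠ 0 ∧
      IsNilpotent (F ^ M * (F ^ M - algebraMap ℂ (Module.End ℂ A) μ)) ∧
      LinearMap.trace ℂ A (F ^ M) = I.m x * μ := by
  obtain ⟨φ, hφ⟩ := I.exists_tw h
  obtain ⟨a0, ha0⟩ := I.rho_surj x φ.toLinearMap
  set c := a0 * I.e x with hc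
  let F : Module.End ℂ A := LinearMap.mulRight ℂ c ∘ₗ T.toLinearMap
  have hF : ∀ a, F a = T a * c := fun a => rfl
  have hFk : ∀ k a, (F ^ k) a = (T ^ k) a * (F ^ k) 1 := by
    intro k
    induction k with
    | zero => intro a; simp
    | succ k ih =>
      intro a
      rw [pow_succ', Module.End.mul_apply, ih a, Module.End.mul_apply, hF, hF, map_mul T, pow_succ', AlgEquiv.mul_apply,
        mul_assoc]
  have hE : I.ρ x (I.e x) * I.ρ x (I.e x) = I.ρ x (I.e x) := by
    rw [← map_mul (I.ρ x), (I.idem x).eq]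
  have hρ : ∀ k, I.ρ x ((F ^ (k + 1)) 1) = φ.toLinearMap ^ (k + 1) * I.ρ x (I.e x) := by
    intro k
    have step : ∀ a, I.ρ x (F a) = φ.toLinearMap * I.ρ x a * I.ρ x (I.e x) := by
      intro a
      rw [hF, hc, map_mul (I.ρ x), map_mul (I.ρ x), ha0, ← mul_assoc]
      congr 1
      exact LinearMap.ext fun v => hφ a v
    induction k with
    | zero => rw [zero_add, pow_one, pow_one, step, map_one (I.ρ x), mul_one]
    | succ k ih =>
      rw [pow_succ', Module.End.mul_apply, step, ih, pow_succ' φ.toLinearMap (k + 1), mul_assoc, mul_assoc, hE,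
        mul_assoc]
  have hφk : ∀ k a, φ.toLinearMap ^ k * I.ρ x a = I.ρ x ((T ^ k) a) * φ.toLinearMap ^ k := by
    intro k
    induction k with
    | zero => intro a; simp
    | succ k ih =>
      intro a
      have h1 : ∀ b, φ.toLinearMap * I.ρ x b = I.ρ x (T b) * φ.toLinearMap := fun b =>
        LinearMap.ext fun v => (hφ b v).symm
      rw [pow_succ', mul_assoc, ih, ← mul_assoc, h1, mul_assoc, pow_succ' T, AlgEquiv.mul_apply]
  obtain ⟨μ, hμ⟩ := I.schur (φ.toLinearMap ^ M) fun a => by rw [hφk, hT]; rfl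
  have hμ0 : μ ≠ 0 := by
    rintro rfl
    rw [map_zero] at hμ
    have h1 : IsNilpotent φ.toLinearMap := ⟨M, hμ⟩
    have h2 : IsUnit φ.toLinearMap := (Module.End.isUnit_iff _).2 φ.bijective
    exact h1.not_isUnit h2
  set u := (F ^ M) 1 with hu
  have hFM : F ^ M = LinearMap.mulRight ℂ u := by
    ext a
    rw [hFk, hT]; rfl
  have huJ : u - μ • I.e x ∈ I.J := by
    refine I.sub_mem fun i => ?_
    rw [map_smul]
    by_cases hi : i = x
    · subst hi
      obtain ⟨k, rfl⟩ : ∃ k, M = k + 1 := ⟨M - 1, by omega⟩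
      rw [hu, hρ, hμ, Algebra.algebraMap_eq_smul_one, smul_one_mul]
    · obtain ⟨k, rfl⟩ : ∃ k, M = k + 1 := ⟨M - 1, by omega⟩
      rw [hu, pow_succ', Module.End.mul_apply, hF, hc, map_mul (I.ρ i), map_mul (I.ρ i), I.e_ne x i (Ne.symm hi)]
      simp
  refine ⟨F, c, μ, hF, hμ0, ?_, ?_⟩
  · have h1 : F ^ M * (F ^ M - algebraMap ℂ (Module.End ℂ A) μ) =
        LinearMap.mulRight ℂ ((u - μ • 1) * u) := by
      rw [hFM]
      ext a
      simp [mul_sub, sub_mul, mul_assoc, Module.algebraMap_end_apply]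
    have h2 : (u - μ • 1) * u ∈ I.J := by
      have h3 : (u - μ • 1) * u = (u - μ • I.e x) * u + (μ • (I.e x - 1)) * (u - μ • I.e x) := by
        simp only [sub_mul, mul_sub, smul_sub, smul_mul_assoc, mul_smul_comm, (I.idem x).eq, one_mul]
        abel
      rw [h3]
      exact I.J.add_mem (I.mem_mul_right huJ _) (I.mem_mul_left huJ _)
    rw [h1]
    obtain ⟨r, hr⟩ := I.isNilpotent_of_mem h2
    exact ⟨r, by rw [mulRight_pow', hr, LinearMap.mulRight_zero_eq_zero]⟩
  · rw [hFM]
    have h1 := I.tr_mem huJ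
    rw [← trL_apply, map_sub, map_smul, sub_eq_zero, trL_apply, trL_apply, tr_e] at h1
    rw [mul_comm]
    exact h1

end Irr
end Sw

namespace Sw

variable {A : Type} [Ring A] [HopfAlgebra ℂ A] [Module.Finite ℂ A]

namespace Irr
variable (I : Irr A)

lemma card_mul_le {ι : Type*} (t : Finset ι) (f : ι → Fin I.k) (hf : Set.InjOn f t) {c : ℕ}
    (hc : ∀ i ∈ t, c ≤ I.w (f i)) : t.card * c ≤ Module.finrank ℂ A := by
  classical
  rw [I.finrank_eq_w, ← smul_eq_mul, ← Finset.sum_const]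
  calc ∑ i ∈ t, c ≤ ∑ i ∈ t, I.w (f i) := Finset.sum_le_sum hc
    _ = ∑ j ∈ t.image f, I.w j := (Finset.sum_image hf).symm
    _ ≤ _ := Finset.sum_le_sum_of_subset (Finset.subset_univ _)

lemma sum_m_le_tr {e : A} (he : IsIdempotentElem e) (t : Finset (Fin I.k))
    (h : ∀ i ∈ t, I.chi i e = 1) {n : ℕ} (hn : tr e = n) : ∑ i ∈ t, I.m i ≤ n := by
  choose b hb using fun i => (isChar_chi I i).idem he
  have h1 := I.tr_eq e
  rw [hn] at h1
  simp only [hb] at h1 h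
  have h2 : n = ∑ i, I.m i * b i := by exact_mod_cast h1
  rw [h2]
  calc ∑ i ∈ t, I.m i = ∑ i ∈ t, I.m i * b i := Finset.sum_congr rfl fun i hi => by
        have : b i = 1 := by exact_mod_cast h i hi
        rw [this, mul_one]
    _ ≤ _ := Finset.sum_le_sum_of_subset (Finset.subset_univ _)

lemma orderOf_mul_le (β : A →ₐ[ℂ] ℂ) : orderOf (ellE β) * I.m I.triv ≤ Module.finrank ℂ A := by
  have := I.card_mul_le (Finset.range (orderOf (ellE β))) (fun i => I.idx (pw β i))
    (fun i hi j hj h => pw_inj β (by simpa using hi) (by simpa using hj) (I.idx_inj h))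
    (c := I.m I.triv) (fun i _ => (I.w_idx _).ge)
  rwa [Finset.card_range] at this

end Irr

namespace IntData
variable (D : IntData A)

/-- The square of the antipode. -/
def sq : A ≃ₐ[ℂ] A :=
  AlgEquiv.ofBijective (AlgHom.ofLinearMap (antipode ℂ ∘ₗ antipode ℂ) (by simp)
    (fun a b => by simp [antipode_mul_antidistrib]))
    ⟨D.antipode_injective.comp D.antipode_injective, D.antipode_surjective.comp D.antipode_surjective⟩

lemma sq_apply (a : A) : D.sq a = antipode ℂ (antipode ℂ a) := rfl

lemma sq_comm_ell (β : A →ₐ[ℂ] ℂ) : Commute D.sq (ellE β) := by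
  ext a; exact (ell_antipode_sq β a).symm

lemma sq_comm_arr (β : A →ₐ[ℂ] ℂ) : Commute D.sq (arrE β) := by
  ext a; exact (arr_antipode_sq β a).symm

lemma radford' (y : A) : arrE D.al y * D.g = D.g * (D.sq ^ 2 * ellE D.al) y := (D.radford y).symm

lemma radford_pow (k : ℕ) (y : A) :
    (arrE D.al ^ k) y * D.g ^ k = D.g ^ k * ((D.sq ^ 2 * ellE D.al) ^ k) y := by
  have hc : Commute (D.sq ^ 2 * ellE D.al) (arrE D.al) :=
    ((D.sq_comm_arr _).pow_left 2).mul_left (ellE_comm_arrE _ _)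
  induction k generalizing y with
  | zero => simp
  | succ k ih =>
    rw [pow_succ' (arrE D.al), AlgEquiv.mul_apply, pow_succ' D.g, ← mul_assoc, radford', mul_assoc,
      ← AlgEquiv.mul_apply (D.sq ^ 2 * ellE D.al), (hc.pow_right k).eq, AlgEquiv.mul_apply, ih,
      ← AlgEquiv.mul_apply ((D.sq ^ 2 * ellE D.al) ^ k), ← pow_succ, mul_assoc]

lemma perm_arr (I : Irr A) (x) : I.perm (arrE D.al) x = I.perm (D.sq ^ 2 * ellE D.al) x := by
  refine I.perm_eq fun a => ?_
  rw [I.chi_perm]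
  have h : arrE D.al a = D.g * ((D.sq ^ 2 * ellE D.al) a * antipode ℂ D.g) := by
    rw [← mul_assoc, ← radford', mul_assoc, D.g_mul_antipode, mul_one]
  rw [h, I.chi_mul, mul_assoc, D.antipode_g_mul, mul_one]

lemma sq_pow_eq_one {s : ℕ} (hg : D.g ^ s = 1) (hs : ellE D.al ^ s = 1) : D.sq ^ (2 * s) = 1 := by
  have h := D.radford_pow s
  rw [hg, ellE_pow_eq_one.1 hs, (((D.sq_comm_ell _).pow_left 2)).mul_pow, hs, mul_one, ← pow_mul] at h
  ext a
  simpa using (h a).symm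

lemma groupLike_g : IsGroupLikeElem ℂ D.g := ⟨D.counit_g, D.comul_g⟩

variable {D}

lemma algHom_L (hal : D.al ≠ Bialgebra.counitAlgHom ℂ A) (β : A →ₐ[ℂ] ℂ) : β D.L = 0 := by
  by_contra h
  have h1 : ∀ a, β a = counit (R := ℂ) a := fun a => by
    have := congrArg β (D.lint a)
    rw [map_mul, map_smul, smul_eq_mul] at this
    exact mul_right_cancel₀ h this
  have h2 : ∀ a, β a = D.al a := fun a => by
    have := congrArg β (D.L_mul a)
    rw [map_mul, map_smul, smul_eq_mul, mul_comm] at this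
    exact mul_right_cancel₀ h this
  exact hal (AlgHom.ext fun a => (h2 a).symm.trans (h1 a))

lemma trace_sq_eq_zero (hal : D.al ≠ Bialgebra.counitAlgHom ℂ A)
    (β : A →ₐ[ℂ] ℂ) (c : A) (F : Module.End ℂ A)
    (hF : ∀ x, F x = D.sq (ellE β x) * c) : LinearMap.trace ℂ A F = 0 := by
  obtain ⟨c', rfl⟩ := D.antipode_surjective c
  rw [D.trace_eq β c' F hF, algHom_L hal, zero_mul]

lemma two_le_m [Nontrivial A] (hal : D.al ≠ Bialgebra.counitAlgHom ℂ A) (I : Irr A) : 2 ≤ I.m I.triv := by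
  by_contra h
  have h1 : I.m I.triv = 1 := by have := I.m_pos I.triv; omega
  have hm : I.m I.triv = I.n I.triv := h1.trans (I.n_idx _).symm
  have hint : IsLInt (I.e I.triv) := by
    intro a
    have := I.mul_e_eq_zero hm (a := a - counit (R := ℂ) a • 1) (by
      rw [map_sub, map_smul, map_one (I.ρ I.triv), Irr.triv, I.rho_idx]; exact sub_self _)
    rwa [sub_mul, sub_eq_zero, smul_one_mul] at this
  obtain ⟨c, hc⟩ := lint_unique D.lint D.L_ne hint
  have h2 := I.chi_e I.triv I.triv
  rw [Irr.triv, I.chi_idx, if_pos rfl] at h2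
  change Bialgebra.counitAlgHom ℂ A (I.e I.triv) = 1 at h2
  rw [hc, map_smul, algHom_L hal, smul_zero] at h2
  exact zero_ne_one h2

lemma g_pow_eq_one [Nontrivial A] (hal : D.al ≠ Bialgebra.counitAlgHom ℂ A)
    {s t : ℕ} (hs : orderOf (ellE D.al) = s) (ht : t.Prime) (hst : s.Coprime t)
    (hN : Module.finrank ℂ A = s * t) : D.g ^ s = 1 := by
  obtain ⟨I⟩ := exists_irr (A := A)
  by_contra hu
  set u := D.g ^ s with hu'
  have hug : IsGroupLikeElem ℂ u := D.groupLike_g.pow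
  have hut : u ^ t = 1 := by
    rw [hu', ← pow_mul, ← hN]
    exact orderOf_dvd_iff_pow_eq_one.1 (orderOf_groupLike_dvd D.groupLike_g)
  have hord : orderOf u = t := (Nat.Prime.eq_one_or_self_of_dvd ht _ (orderOf_dvd_of_pow_eq_one hut)).resolve_left
    fun h => hu (orderOf_eq_one_iff.1 h)
  have hα : D.al u = 1 := by
    have h1 : D.al u ^ t = 1 := by rw [← map_pow, hut, map_one]
    have h2 : D.al u ^ s = 1 := by
      have h3 : pw D.al s u = 1 := by
        rw [pw_apply, ← hs, pow_orderOf_eq_one]; exact hug.counit_eq_one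
      rwa [pw_groupLike D.al hug] at h3
    rw [← orderOf_eq_one_iff]
    exact Nat.eq_one_of_dvd_coprimes hst (orderOf_dvd_of_pow_eq_one h2) (orderOf_dvd_of_pow_eq_one h1)
  obtain ⟨he1, he⟩ := avg_idem ht.pos hut
  set e := (t : ℂ)⁻¹ • ∑ i ∈ Finset.range t, u ^ i with he'
  have ht0 : (t : ℂ) ≠ 0 := by exact_mod_cast ht.ne_zero
  have hte : tr e = s := by
    have h1 : ∑ i ∈ Finset.range t, tr (u ^ i) = Module.finrank ℂ A := by
      rw [Finset.sum_eq_single_of_mem 0 (by simpa using ht.pos), pow_zero, tr_one]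
      intro i hi hi0
      exact tr_groupLike hug.pow (pow_ne_one_of_lt_orderOf hi0 (by rw [hord]; simpa using hi))
    rw [he', ← trL_apply, map_smul, map_sum]
    simp only [trL_apply]
    rw [h1, hN, Nat.cast_mul, smul_eq_mul]
    field_simp
  have hsum := I.sum_m_le_tr he ((Finset.range s).image fun i => I.idx (pw D.al i)) (by
    intro j hj
    obtain ⟨i, -, rfl⟩ := Finset.mem_image.1 hj
    rw [I.chi_idx, he', map_smul, map_sum]
    simp only [map_pow, pw_groupLike D.al hug, hα, one_pow]
    simp [ht0]) hte
  rw [Finset.sum_image (fun i hi j hj h => pw_inj D.al (by rw [hs]; simpa using hi)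
    (by rw [hs]; simpa using hj) (I.idx_inj h))] at hsum
  simp only [I.m_idx, Finset.sum_const, Finset.card_range, smul_eq_mul] at hsum
  have h2 := two_le_m hal I
  have hs0 : 0 < s := by rw [← hs]; exact (isOfFinOrder_ellE _).orderOf_pos
  nlinarith

end IntData
end Sw

namespace Sw

lemma mem_of_zpow_mem {G : Type*} [Group G] {H : Subgroup G} {T U : G} {s : ℕ} (hs : s.Prime)
    (hc : Commute T U) (hT : T ^ s = 1) {i : ℤ} (hi : ¬ (s : ℤ) ∣ i) {j : ℤ} (h : T ^ i * U ^ j ∈ H) :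
    ∃ k : ℤ, T * U ^ (j * k) ∈ H := by
  have hcop : IsCoprime i (s : ℤ) :=
    ((Nat.prime_iff_prime_int.1 hs).coprime_iff_not_dvd.2 hi).symm
  obtain ⟨a, b, hab⟩ := hcop
  refine ⟨a, ?_⟩
  have h1 := H.zpow_mem h a
  rw [((hc.zpow_left i).zpow_right j).mul_zpow, ← zpow_mul, ← zpow_mul] at h1
  have h2 : T ^ (i * a) = T := by
    have : i * a = 1 + (s : ℤ) * (-b) := by linarith
    rw [this, zpow_add, zpow_mul, zpow_natCast, hT, one_zpow, zpow_one, mul_one]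
  rwa [h2] at h1

lemma mem_of_zpow_mem' {G : Type*} [Group G] {H : Subgroup G} {T : G} {s : ℕ} (hs : s.Prime)
    (hT : T ^ s = 1) {i : ℤ} (hi : ¬ (s : ℤ) ∣ i) (h : T ^ i ∈ H) : T ∈ H := by
  obtain ⟨k, hk⟩ := mem_of_zpow_mem (U := 1) (j := 0) hs (Commute.one_right T) hT hi (H := H) (by simpa using h)
  simpa using hk

variable {A : Type} [Ring A] [HopfAlgebra ℂ A] [Module.Finite ℂ A]

namespace Irr
variable (I : Irr A)

lemma mul_inv_mem_stab {T U : A ≃ₐ[ℂ] A} {x} (h : I.perm T x = I.perm U x) : T * U⁻¹ ∈ I.stab x := by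
  rw [mem_stab, perm_mul, h, ← perm_mul, mul_inv_cancel, perm_one]

/-- A normalised intertwiner for a finite-order automorphism fixing a simple module. -/
lemma exists_normalized {T : A ≃ₐ[ℂ] A} {x} (h : T ∈ I.stab x) {s : ℕ} (hs : 0 < s) (hT : T ^ s = 1) :
    ∃ U : Module.End ℂ (I.V x), U ^ s = 1 ∧ ∀ (i : ℕ) a, U ^ i * I.ρ x a = I.ρ x ((T ^ i) a) * U ^ i := by
  obtain ⟨φ, hφ⟩ := I.exists_tw h
  have h1 : ∀ b, φ.toLinearMap * I.ρ x b = I.ρ x (T b) * φ.toLinearMap := fun b =>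
    LinearMap.ext fun v => (hφ b v).symm
  have key : ∀ U : Module.End ℂ (I.V x), (∀ b, U * I.ρ x b = I.ρ x (T b) * U) →
      ∀ (i : ℕ) a, U ^ i * I.ρ x a = I.ρ x ((T ^ i) a) * U ^ i := by
    intro U hU i
    induction i with
    | zero => intro a; simp
    | succ k ih =>
      intro a
      rw [pow_succ', mul_assoc, ih, ← mul_assoc, hU, mul_assoc, pow_succ' T, AlgEquiv.mul_apply]
  obtain ⟨μ, hμ⟩ := I.schur (φ.toLinearMap ^ s) fun a => by rw [key _ h1, hT]; rfl
  have hμ0 : μ ≠ 0 := by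
    rintro rfl
    rw [map_zero] at hμ
    have h1 : IsNilpotent φ.toLinearMap := ⟨s, hμ⟩
    have h2 : IsUnit φ.toLinearMap := (Module.End.isUnit_iff _).2 φ.bijective
    exact h1.not_isUnit h2
  obtain ⟨c, hc⟩ := IsAlgClosed.exists_pow_nat_eq μ hs
  refine ⟨c⁻¹ • φ.toLinearMap, ?_, key _ fun b => ?_⟩
  · rw [smul_pow, hμ, inv_pow, hc, Algebra.algebraMap_eq_smul_one, smul_smul, inv_mul_cancel₀ hμ0,
      one_smul]
  · rw [smul_mul_assoc, mul_smul_comm, h1]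

lemma trace_normalized_ell {β : A →ₐ[ℂ] ℂ} {s : ℕ} (hs : orderOf (ellE β) = s) {x}
    {U : Module.End ℂ (I.V x)} (hU : ∀ (i : ℕ) a, U ^ i * I.ρ x a = I.ρ x ((ellE β ^ i) a) * U ^ i) (i : ℕ)
    (hi : 0 < i) (his : i < s) : LinearMap.trace ℂ _ (U ^ i) = 0 := by
  have h3 : pw β i ≠ Bialgebra.counitAlgHom ℂ A := by
    rw [Ne, ← ellE_eq_one, ellE_pw]
    exact pow_ne_one_of_lt_orderOf hi.ne' (hs.symm ▸ his)
  refine trace_eq_zero_ell h3 (I.ρ x) _ fun a w => ?_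
  rw [ell_pw]
  exact LinearMap.congr_fun (hU i a) w

lemma trace_normalized_arr {β : A →ₐ[ℂ] ℂ} {s : ℕ} (hs : orderOf (ellE β) = s) {x}
    {U : Module.End ℂ (I.V x)} (hU : ∀ (i : ℕ) a, U ^ i * I.ρ x a = I.ρ x ((arrE β ^ i) a) * U ^ i) (i : ℕ)
    (hi : 0 < i) (his : i < s) : LinearMap.trace ℂ _ (U ^ i) = 0 := by
  have h3 : pw β i ≠ Bialgebra.counitAlgHom ℂ A := by
    rw [Ne, ← ellE_eq_one, ellE_pw]
    exact pow_ne_one_of_lt_orderOf hi.ne' (hs.symm ▸ his)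
  refine trace_eq_zero_arr h3 (I.ρ x) _ fun a w => ?_
  rw [arr_pw]
  exact LinearMap.congr_fun (hU i a) w

lemma dvd_of_mem_stab {β : A →ₐ[ℂ] ℂ} {s : ℕ} (hs : orderOf (ellE β) = s) (hp : s.Prime)
    (ho : Odd s) {x} (h : ellE β ∈ I.stab x) : s ∣ I.n x ∧ s ∣ I.m x := by
  have hT : ellE β ^ s = 1 := by rw [← hs]; exact pow_orderOf_eq_one _
  have hβ : β ≠ Bialgebra.counitAlgHom ℂ A := by
    rintro rfl
    rw [ellE_eq_one.2 rfl, orderOf_one] at hs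
    exact hp.one_lt.ne hs
  constructor
  · obtain ⟨U, hU1, hU⟩ := I.exists_normalized h hp.pos hT
    have := order_dvd_finrank hp.pos hU1 (I.trace_normalized_ell hs hU)
    simpa using this
  · obtain ⟨F, c, μ, hF, hμ, hn, ht⟩ := I.exists_twisted h hp.pos hT
    refine dvd_of_roots hp ho hμ hn ht ?_
    refine trace_eq_zero_ell hβ (Algebra.lmul ℂ A) _ fun a w => ?_
    rw [hF, hF]
    simp [mul_assoc]

lemma orbit_le {β : A →ₐ[ℂ] ℂ} {s : ℕ} (hs : orderOf (ellE β) = s) (hp : s.Prime) {x}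
    (h : ellE β ∉ I.stab x) : Set.InjOn (fun i : ℕ => I.perm (ellE β ^ i) x) (Finset.range s) := by
  have hT : ellE β ^ s = 1 := by rw [← hs]; exact pow_orderOf_eq_one _
  intro i hi j hj hij
  by_contra hne
  have h1 := I.mul_inv_mem_stab hij
  rw [← zpow_natCast, ← zpow_natCast, ← zpow_sub] at h1
  refine h (mem_of_zpow_mem' hp hT (fun hd => hne ?_) h1)
  simp only [Finset.coe_range, Set.mem_Iio] at hi hj
  have := Int.eq_zero_of_abs_lt_dvd hd (by rw [abs_lt]; constructor <;> omega)
  omega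

lemma orbit_card_mul_le {β : A →ₐ[ℂ] ℂ} {s : ℕ} (hs : orderOf (ellE β) = s) (hp : s.Prime) {x}
    (h : ellE β ∉ I.stab x) : s * I.w x ≤ Module.finrank ℂ A := by
  have := I.card_mul_le _ _ (I.orbit_le hs hp h) (c := I.w x) (fun i _ => (I.w_perm _ _).ge)
  rwa [Finset.card_range] at this

lemma arr_mem_of_lt {β : A →ₐ[ℂ] ℂ} {s : ℕ} (hs : orderOf (ellE β) = s) (hp : s.Prime) {x}
    (h : ellE β ∉ I.stab x) (hlt : Module.finrank ℂ A < s * s * I.w x) :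
    ∃ j : ℤ, arrE β * ellE β ^ j ∈ I.stab x := by
  have hT : ellE β ^ s = 1 := by rw [← hs]; exact pow_orderOf_eq_one _
  have hT' : arrE β ^ s = 1 := ellE_pow_eq_one.1 hT
  have hc := ellE_comm_arrE β β
  by_contra hno
  have := I.card_mul_le (Finset.range s ×ˢ Finset.range s)
    (fun i => I.perm (arrE β ^ i.1 * ellE β ^ i.2) x) (c := I.w x) ?_ (fun i _ => (I.w_perm _ _).ge)
  · rw [Finset.card_product, Finset.card_range] at this
    omega
  rintro ⟨i, i'⟩ hi ⟨j, j'⟩ hj hij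
  simp only [Finset.coe_product, Finset.coe_range, Set.mem_prod, Set.mem_Iio] at hi hj
  have h1 := I.mul_inv_mem_stab hij
  have h2 : arrE β ^ i * ellE β ^ i' * (arrE β ^ j * ellE β ^ j')⁻¹ =
      arrE β ^ ((i : ℤ) - j) * ellE β ^ ((i' : ℤ) - j') := by
    rw [zpow_sub, zpow_sub, zpow_natCast, zpow_natCast, zpow_natCast, zpow_natCast, mul_inv_rev]
    have h3 : Commute (ellE β ^ i' * (ellE β ^ j')⁻¹) (arrE β ^ j)⁻¹ :=
      (Commute.mul_left ((hc.pow_left _).pow_right _) (((hc.pow_left _).pow_right _).inv_left)).inv_right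
    rw [mul_assoc, ← mul_assoc (ellE β ^ i'), h3.eq, mul_assoc]
  rw [h2] at h1
  by_cases hd : (s : ℤ) ∣ (i : ℤ) - j
  · have h3 := Int.eq_zero_of_abs_lt_dvd hd (by rw [abs_lt]; constructor <;> omega)
    rw [h3, zpow_zero, one_mul] at h1
    by_cases hd' : (s : ℤ) ∣ (i' : ℤ) - j'
    · have h4 := Int.eq_zero_of_abs_lt_dvd hd' (by rw [abs_lt]; constructor <;> omega)
      exact Prod.ext (by simp only; omega) (by simp only; omega)
    · exact absurd (mem_of_zpow_mem' hp hT hd' h1) h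
  · obtain ⟨k, hk⟩ := mem_of_zpow_mem hp hc.symm hT' hd h1
    exact absurd ⟨_, hk⟩ hno

end Irr

namespace IntData
variable {D : IntData A}

/-- For odd `m x` fixed by a twist of the squared antipode, `m x` is at least the order of `al`. -/
lemma le_m (hal : D.al ≠ Bialgebra.counitAlgHom ℂ A) (I : Irr A) {s : ℕ}
    (hs : orderOf (ellE D.al) = s) (hp : s.Prime) (ho : Odd s) (hsq : D.sq ^ (2 * s) = 1) {x}
    {j : ℤ} (hj : D.sq * ellE D.al ^ j ∈ I.stab x) (hm : Odd (I.m x)) : s ≤ I.m x := by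
  have hT : ellE D.al ^ s = 1 := by rw [← hs]; exact pow_orderOf_eq_one _
  obtain ⟨i, hi⟩ : ∃ i : ℕ, ellE D.al ^ j = ellE D.al ^ i := by
    refine ⟨(j % s).toNat, ?_⟩
    rw [← zpow_natCast, Int.toNat_of_nonneg (Int.emod_nonneg _ (by exact_mod_cast hp.ne_zero)), ← hs,
      zpow_mod_orderOf]
  rw [hi] at hj
  obtain ⟨F, c, μ, hF, hμ, hn, ht⟩ := I.exists_twisted hj (M := 2 * s) (by have := hp.pos; omega) (by
    rw [((D.sq_comm_ell _).pow_right i).mul_pow, hsq, ← pow_mul, mul_comm i, mul_assoc, mul_comm 2,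
      mul_assoc, pow_mul, hT, one_pow, one_mul])
  refine le_of_roots_odd hp ho hμ hn ht (trace_sq_eq_zero hal (pw D.al i) c F fun x => ?_) hm
  rw [hF, ellE_pw]; rfl

lemma exists_sq_mem (I : Irr A) {s : ℕ} (ho : Odd s) {x} (hx : D.sq ^ s ∈ I.stab x)
    {j : ℤ} (hj : arrE D.al * ellE D.al ^ j ∈ I.stab x) :
    ∃ j : ℤ, D.sq * ellE D.al ^ j ∈ I.stab x := by
  have h1 : D.sq ^ 2 * ellE D.al ^ (1 + j) ∈ I.stab x := by
    rw [I.mem_stab, I.perm_mul, D.perm_arr, ← I.perm_mul] at hj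
    rwa [zpow_add, zpow_one, ← mul_assoc]
  obtain ⟨k, rfl⟩ := ho
  refine ⟨-((1 + j) * k), ?_⟩
  have h2 := mul_mem hx (inv_mem ((I.stab x).pow_mem h1 k))
  have hc := D.sq_comm_ell D.al
  rw [((hc.pow_left 2).zpow_right (1 + j)).mul_pow, ← pow_mul, mul_inv_rev, ← mul_assoc,
    ← zpow_natCast (ellE D.al ^ (1 + j)) k, ← zpow_mul] at h2
  rwa [mul_assoc, ((((hc.pow_left (2 * k)).zpow_right ((1 + j) * k)).inv_inv).symm).eq, ← mul_assoc,
    pow_succ', mul_inv_cancel_right, ← zpow_neg] at h2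

/-- Parity: some simple module of odd weight is fixed by an odd power of the squared antipode. -/
lemma exists_odd (I : Irr A) {s : ℕ} (hsq : D.sq ^ (2 * s) = 1) (hN : Odd (Module.finrank ℂ A)) :
    ∃ x, D.sq ^ s ∈ I.stab x ∧ Odd (I.w x) := by
  by_contra hno
  push Not at hno
  have : ∑ i, (I.w i : ZMod 2) = 0 := by
    refine Finset.sum_involution (fun i _ => I.perm (D.sq ^ s) i) (fun i _ => ?_) (fun i _ hi => ?_)
      (fun _ _ => Finset.mem_univ _) (fun i _ => ?_)
    · rw [I.w_perm]; exact CharTwo.add_self_eq_zero _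
    · intro h
      apply hi
      rw [ZMod.natCast_eq_zero_iff_even]
      exact Nat.not_odd_iff_even.1 (hno i h)
    · rw [← I.perm_mul, ← pow_add, ← two_mul, hsq, I.perm_one]
  rw [← Nat.cast_sum, ← I.finrank_eq_w, ZMod.natCast_eq_zero_iff_even] at this
  exact (Nat.not_even_iff_odd.2 hN) this

end IntData
end Sw

namespace Sw

variable {A : Type} [Ring A] [HopfAlgebra ℂ A] [Module.Finite ℂ A]

namespace Irr
variable (I : Irr A)

lemma sum_w_le (t : Finset (Fin I.k)) : ∑ i ∈ t, I.w i ≤ Module.finrank ℂ A := by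
  rw [I.finrank_eq_w]
  exact Finset.sum_le_sum_of_subset (Finset.subset_univ t)

open Classical in
/-- The orbit of a simple module under the left twists by powers of `β`. -/
def orb (β : A →ₐ[ℂ] ℂ) (x : Fin I.k) : Finset (Fin I.k) :=
  (Finset.range (orderOf (ellE β))).image fun i => I.perm (ellE β ^ i) x

variable {I} {β : A →ₐ[ℂ] ℂ}

lemma mem_orb {x y} : y ∈ I.orb β x ↔ ∃ i, i < orderOf (ellE β) ∧ I.perm (ellE β ^ i) x = y := by
  simp [orb]

lemma mem_orb' {x y} : y ∈ I.orb β x ↔ ∃ i : ℕ, I.perm (ellE β ^ i) x = y := by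
  rw [mem_orb]
  refine ⟨fun ⟨i, _, h⟩ => ⟨i, h⟩, fun ⟨i, h⟩ => ⟨i % orderOf (ellE β), Nat.mod_lt _ ?_, ?_⟩⟩
  · exact (isOfFinOrder_ellE β).orderOf_pos
  · rwa [pow_mod_orderOf]

lemma self_mem_orb (x) : x ∈ I.orb β x := mem_orb'.2 ⟨0, by rw [pow_zero, perm_one]⟩

lemma w_orb {x y} (h : y ∈ I.orb β x) : I.w y = I.w x := by
  obtain ⟨i, rfl⟩ := mem_orb'.1 h
  exact I.w_perm _ _

lemma m_orb {x y} (h : y ∈ I.orb β x) : I.m y = I.m x := by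
  obtain ⟨i, rfl⟩ := mem_orb'.1 h
  exact I.m_perm _ _

lemma n_orb {x y} (h : y ∈ I.orb β x) : I.n y = I.n x := by
  obtain ⟨i, rfl⟩ := mem_orb'.1 h
  exact I.n_perm _ _

lemma disjoint_orb {x y} (h : y ∉ I.orb β x) : Disjoint (I.orb β x) (I.orb β y) := by
  rw [Finset.disjoint_left]
  intro z hx hy
  obtain ⟨i, hi⟩ := mem_orb'.1 hx
  obtain ⟨j, hjl, hj⟩ := mem_orb.1 hy
  refine h (mem_orb'.2 ⟨i + (orderOf (ellE β) - j), ?_⟩)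
  rw [pow_add, perm_mul, hi, ← hj, ← perm_mul, ← pow_add, Nat.add_sub_cancel' hjl.le, pow_orderOf_eq_one,
    perm_one]

lemma sum_orb {s : ℕ} (hs : orderOf (ellE β) = s) (hp : s.Prime) {x} (h : ellE β ∉ I.stab x) :
    ∑ i ∈ I.orb β x, I.w i = s * I.w x := by
  rw [Finset.sum_congr rfl fun i hi => w_orb hi, Finset.sum_const, orb,
    Finset.card_image_of_injOn (by rw [hs]; exact I.orbit_le hs hp h), hs, Finset.card_range, smul_eq_mul]

lemma mem_orb_triv {y} : y ∈ I.orb β I.triv ↔ ∃ i : ℕ, i < orderOf (ellE β) ∧ I.idx (pw β i) = y := by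
  rw [mem_orb]
  simp only [← ellE_pw, perm_ell_triv]

lemma triv_free {s : ℕ} (hs : orderOf (ellE β) = s) (hp : s.Prime) : ellE β ∉ I.stab I.triv := by
  intro h
  rw [mem_stab, perm_ell_triv] at h
  rw [ellE_eq_one.2 (I.idx_inj h), orderOf_one] at hs
  exact hp.one_lt.ne hs

end Irr

namespace IntData
variable {D : IntData A}

lemma orderOf_eq [Nontrivial A] {p q : ℕ} (hp : p.Prime) (hq : q.Prime) (hop : Odd p) (hoq : Odd q)
    (hpq : p < q) (hN : Module.finrank ℂ A = p * q) (hal : D.al ≠ Bialgebra.counitAlgHom ℂ A) :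
    orderOf (ellE D.al) = p ∧ D.sq ^ (2 * p) = 1 := by
  obtain ⟨I⟩ := exists_irr (A := A)
  have hc : p.Coprime q := (Nat.coprime_primes hp hq).2 hpq.ne
  obtain ⟨a, b, ha, hb, hab⟩ := (Nat.dvd_mul).1 (hN ▸ orderOf_ellE_dvd D.al)
  have hne : orderOf (ellE D.al) ≠ 1 := by
    rwa [Ne, orderOf_eq_one_iff, ellE_eq_one]
  have hd := two_le_m hal I
  have hle := I.orderOf_mul_le D.al
  have hpos : 0 < p * q := Nat.mul_pos hp.pos hq.pos
  have hsq : ∀ s t : ℕ, orderOf (ellE D.al) = s → t.Prime → s.Coprime t →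
      Module.finrank ℂ A = s * t → D.sq ^ (2 * s) = 1 := fun s t hs ht hst hN' =>
    D.sq_pow_eq_one (g_pow_eq_one hal hs ht hst hN') (hs ▸ pow_orderOf_eq_one _)
  rcases (Nat.dvd_prime hp).1 ha with rfl | rfl <;> rcases (Nat.dvd_prime hq).1 hb with rfl | rfl
  · simp [← hab] at hne
  · exfalso
    rw [one_mul] at hab
    have hsq2 := hsq b p hab.symm hp hc.symm (by rw [hN, mul_comm])
    obtain ⟨x, hx, hw⟩ := exists_odd I hsq2 (by rw [hN]; exact hop.mul hoq)
    by_cases hL : ellE D.al ∈ I.stab x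
    · obtain ⟨h1, h2⟩ := I.dvd_of_mem_stab hab.symm hq hoq hL
      have h3 := I.sum_w_le {x}
      rw [Finset.sum_singleton, hN, Irr.w] at h3
      have h4 := Nat.mul_le_mul (Nat.le_of_dvd (I.m_pos x) h2) (Nat.le_of_dvd (I.n_pos x) h1)
      nlinarith
    · have h1 := I.orbit_card_mul_le hab.symm hq hL
      have h2 : I.w x ≤ p := by
        rw [hN, mul_comm p] at h1
        exact Nat.le_of_mul_le_mul_left h1 hq.pos
      have hwp := hw.pos
      obtain ⟨j, hj⟩ := I.arr_mem_of_lt hab.symm hq hL (by rw [hN]; nlinarith)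
      obtain ⟨j, hj⟩ := exists_sq_mem I hoq hx hj
      have h3 := le_m hal I hab.symm hq hoq hsq2 hj (Nat.odd_mul.1 hw).1
      have h4 : I.m x ≤ I.w x := Nat.le_mul_of_pos_right _ (I.n_pos x)
      omega
  · rw [mul_one] at hab
    exact ⟨hab.symm, hsq a q hab.symm hq hc hN⟩
  · rw [← hab, hN] at hle
    nlinarith

lemma exists_large [Nontrivial A] {p q : ℕ} (hp : p.Prime) (hop : Odd p) (hoq : Odd q)
    (hq2 : q ≤ 2 * p + 1)
    (hN : Module.finrank ℂ A = p * q) (hal : D.al ≠ Bialgebra.counitAlgHom ℂ A)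
    (hs : orderOf (ellE D.al) = p) (hsq : D.sq ^ (2 * p) = 1) (I : Irr A)
    (hfree : ∀ x, ellE D.al ∉ I.stab x) : ∃ x, p ≤ I.m x ∧ Odd (I.w x) := by
  obtain ⟨x, hx, hw⟩ := exists_odd I hsq (by rw [hN]; exact hop.mul hoq)
  have hd := two_le_m hal I
  have hge := I.w_ge D.antipode_surjective x
  have h3 : 3 ≤ I.w x := by
    obtain ⟨k, hk⟩ := hw
    omega
  obtain ⟨j, hj⟩ := I.arr_mem_of_lt hs hp (hfree x) (by
    rw [hN, mul_assoc]
    refine Nat.mul_lt_mul_of_pos_left ?_ hp.pos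
    nlinarith [hp.two_le])
  obtain ⟨j, hj⟩ := exists_sq_mem I hop hx hj
  exact ⟨x, le_m hal I hs hp hop hsq hj (Nat.odd_mul.1 hw).1, hw⟩

/-- Without simple modules fixed by `ellE al`, the algebra is basic with `p` simple modules. -/
lemma basic_of_free [Nontrivial A] {p q : ℕ} (hp : p.Prime) (hq : q.Prime) (hop : Odd p) (hoq : Odd q)
    (hq2 : q ≤ 2 * p + 1)
    (hN : Module.finrank ℂ A = p * q) (hal : D.al ≠ Bialgebra.counitAlgHom ℂ A)
    (hs : orderOf (ellE D.al) = p) (hsq : D.sq ^ (2 * p) = 1) (I : Irr A)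
    (hfree : ∀ x, ellE D.al ∉ I.stab x) : (∀ x, x ∈ I.orb D.al I.triv) ∧ I.m I.triv = q := by
  obtain ⟨x, hm, hw⟩ := exists_large hp hop hoq hq2 hN hal hs hsq I hfree
  have hp3 : 3 ≤ p := by
    have := hp.two_le
    obtain ⟨k, hk⟩ := hop
    omega
  have hsum := fun t => hN ▸ I.sum_w_le t
  have hwx : I.w x ≤ q := by
    have := hsum (I.orb D.al x)
    rw [Irr.sum_orb hs hp (hfree x)] at this
    exact Nat.le_of_mul_le_mul_left this hp.pos
  have hn : I.n x = 1 := by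
    obtain ⟨k, hk⟩ := (Nat.odd_mul.1 hw).2
    rcases Nat.eq_zero_or_pos k with rfl | hk0
    · simpa using hk
    · have : p * 3 ≤ I.w x := Nat.mul_le_mul hm (by omega)
      omega
  have hmd : I.m x = I.m I.triv := by
    obtain ⟨β, rfl⟩ := I.exists_of_n_eq_one hn
    exact I.m_idx β
  set d := I.m I.triv with hd
  have hod : Odd d := hmd ▸ (Nat.odd_mul.1 hw).1
  have hpd : p ≤ d := hmd ▸ hm
  have hwt : I.w I.triv = d := I.w_idx _
  have hall : ∀ y, y ∈ I.orb D.al I.triv := by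
    by_contra hy
    push Not at hy
    obtain ⟨y, hy⟩ := hy
    have hdis := Irr.disjoint_orb hy
    have h2 : ∀ z, z ∈ I.orb D.al I.triv ∨ z ∈ I.orb D.al y := by
      by_contra hz
      push Not at hz
      obtain ⟨z, hz1, hz2⟩ := hz
      have hd1 := Irr.disjoint_orb hz1
      have hd2 := Irr.disjoint_orb hz2
      have h := hsum ((I.orb D.al I.triv ∪ I.orb D.al y) ∪ I.orb D.al z)
      rw [Finset.sum_union (Finset.disjoint_union_left.2 ⟨hd1, hd2⟩), Finset.sum_union hdis,
        Irr.sum_orb hs hp (hfree _), Irr.sum_orb hs hp (hfree _), Irr.sum_orb hs hp (hfree _), hwt,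
        ← mul_add, ← mul_add] at h
      have h' := Nat.le_of_mul_le_mul_left h hp.pos
      have h1 := I.w_ge D.antipode_surjective y
      have h2 := I.w_ge D.antipode_surjective z
      omega
    have huniv : (Finset.univ : Finset (Fin I.k)) = I.orb D.al I.triv ∪ I.orb D.al y := by
      ext z; simpa using h2 z
    have hqd : q = d + I.w y := by
      have h := I.finrank_eq_w
      rw [huniv, Finset.sum_union hdis, Irr.sum_orb hs hp (hfree _), Irr.sum_orb hs hp (hfree _), hN, hwt,
        ← mul_add] at h
      exact Nat.eq_of_mul_eq_mul_left hp.pos h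
    have hny : I.n y ≠ 1 := fun h => by
      obtain ⟨β, rfl⟩ := I.exists_of_n_eq_one h
      rw [I.w_idx, ← hd] at hqd
      obtain ⟨k, hk⟩ := hoq
      omega
    have hsm := I.sum_m_mult y y D.antipode_surjective
    rw [huniv, Finset.sum_union hdis, Finset.sum_congr rfl fun i hi => by rw [Irr.m_orb hi],
      ← Finset.mul_sum, Finset.sum_congr (s₁ := I.orb D.al y) rfl fun i hi => by rw [Irr.m_orb hi],
      ← Finset.mul_sum, Finset.sum_eq_single I.triv] at hsm
    rotate_left
    · intro b hb hbt
      obtain ⟨i, hi, rfl⟩ := Irr.mem_orb_triv.1 hb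
      rw [I.mult_idx_left, if_neg]
      intro hf
      rw [ellE_pw] at hf
      have hi0 : i = 0 := (I.orbit_le hs hp (hfree y)) (by simpa [← hs] using hi)
        (by simpa using hp.pos) (by simpa [I.perm_one] using hf)
      subst hi0
      exact hbt rfl
    · exact fun h => absurd (Irr.self_mem_orb _) h
    have h1 : I.mult I.triv y y = 1 := by
      rw [Irr.triv, I.mult_idx_left, ellE_eq_one.2 rfl, I.perm_one, if_pos rfl]
    rw [h1, mul_one, mul_comm (I.n y)] at hsm
    have hmd : I.m y ∣ d := (Nat.dvd_add_left (Dvd.intro _ rfl)).1 (Dvd.intro _ hsm.symm)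
    have hmq : I.m y ∣ q := by rw [hqd]; exact dvd_add hmd (Dvd.intro _ rfl)
    rcases (Nat.dvd_prime hq).1 hmq with h | h
    · have := I.n_le_m y
      have := I.n_pos y
      omega
    · rw [h] at hmd
      have := Nat.le_of_dvd (by omega) hmd
      have := I.m_pos y
      have : 0 < I.w y := Nat.mul_pos (I.m_pos y) (I.n_pos y)
      omega
  refine ⟨hall, ?_⟩
  have h := I.finrank_eq_w
  rw [show (Finset.univ : Finset (Fin I.k)) = I.orb D.al I.triv from
    (Finset.eq_univ_iff_forall.2 hall).symm, Irr.sum_orb hs hp (hfree _), hN, hwt] at h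
  exact (Nat.eq_of_mul_eq_mul_left hp.pos h).symm

end IntData
end Sw

namespace Sw

variable {A : Type} [Ring A] [HopfAlgebra ℂ A] [Module.Finite ℂ A]

/-- Functionals dual to skew-primitive elements. -/
def IsSkew (β γ : A →ₐ[ℂ] ℂ) (F : A →ₗ[ℂ] ℂ) : Prop := ∀ a b, F (a * b) = β a * F b + F a * γ b

namespace IsSkew
variable {β γ : A →ₐ[ℂ] ℂ} {F : A →ₗ[ℂ] ℂ}

lemma map_one (h : IsSkew β γ F) : F 1 = 0 := by
  have := h 1 1
  simpa using this

lemma antipode_arr (h : IsSkew β γ F) (a : A) : F (antipode ℂ (arr γ a)) = -F (ell (cinv β) a) := by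
  have h1 := sw_antipode_left F a
  rw [h.map_one, smul_zero] at h1
  simp only [h _ _] at h1
  rw [sw_add_fun] at h1
  have h2 := cv_algHom_left (cinv β) F a
  have h3 := cv_algHom_right γ (F ∘ₗ antipode ℂ) a
  rw [cv_apply] at h2 h3
  exact eq_neg_of_add_eq_zero_right ((congrArg₂ (· + ·) h2 h3).symm.trans h1)

lemma antipode_ell (h : IsSkew β γ F) (a : A) : F (antipode ℂ (ell β a)) = -F (arr (cinv γ) a) := by
  have h1 := sw_antipode_right F a
  rw [h.map_one, smul_zero] at h1
  simp only [h _ _] at h1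
  rw [sw_add_fun] at h1
  have h2 := cv_algHom_left β (F ∘ₗ antipode ℂ) a
  have h3 := cv_algHom_right (cinv γ) F a
  rw [cv_apply] at h2 h3
  exact eq_neg_of_add_eq_zero_left ((congrArg₂ (· + ·) h2 h3).symm.trans h1)

lemma comp_antipode (h : IsSkew β γ F) : IsSkew (cinv γ) (cinv β) (F ∘ₗ antipode ℂ) := fun a b => by
  simp only [LinearMap.comp_apply, antipode_mul_antidistrib, h _ _, cinv_apply]
  ring

lemma sq (h : IsSkew β γ F) (a : A) :
    F (antipode ℂ (antipode ℂ (arr (cinv β) (ell (cinv γ) (ell β a))))) = F (arr (cinv γ) a) := by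
  have h1 := h.comp_antipode.antipode_arr (ell (cinv γ) (ell β a))
  rw [cinv_cinv, ell_ell_cinv] at h1
  rw [← neg_eq_iff_eq_neg.2 (h.antipode_ell a), ← LinearMap.comp_apply, ← LinearMap.comp_apply]
  exact h1

end IsSkew

namespace IntData
variable {D : IntData A}

lemma _root_.Sw.IsSkew.sq_pow {i j : ℕ} {F : A →ₗ[ℂ] ℂ} (h : IsSkew (pw D.al i) (pw D.al j) F) {s : ℕ}
    (hs : ellE D.al ^ s = 1) (a : A) : F ((D.sq ^ s) a) = F a := by
  have hr : arrE D.al ^ s = 1 := ellE_pow_eq_one.1 hs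
  have hcl := D.sq_comm_ell D.al
  have hcr := D.sq_comm_arr D.al
  have hlr := ellE_comm_arrE D.al D.al
  set L := ellE D.al with hL
  set R := arrE D.al with hR
  have h1 : ∀ b, F ((D.sq * ((R ^ i)⁻¹ * ((L ^ j)⁻¹ * L ^ i) * R ^ j)) b) = F b := fun b => by
    have h2 := h.sq ((R ^ j) b)
    rw [← arrE_apply (cinv (pw D.al j))] at h2
    have h3 : ∀ β : A →ₐ[ℂ] ℂ, arrE (cinv β) = (arrE β)⁻¹ := fun β => by
      rw [eq_inv_iff_mul_eq_one]; ext a; simp [arr_cinv_arr]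
    have h4 : ∀ β : A →ₐ[ℂ] ℂ, ellE (cinv β) = (ellE β)⁻¹ := fun β => by
      rw [eq_inv_iff_mul_eq_one]; ext a; simp [ell_cinv_ell]
    rw [← arrE_apply (cinv (pw D.al i)), ← ellE_apply, ← ellE_apply, h3, h3, h4, arrE_pw, arrE_pw, ellE_pw,
      ellE_pw, ← AlgEquiv.mul_apply ((arrE D.al ^ j)⁻¹), inv_mul_cancel] at h2
    exact h2
  have hc1 : Commute ((L ^ j)⁻¹) (L ^ i) := ((Commute.refl L).pow_pow j i).inv_left
  have hrl : Commute R L := hlr.symm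
  have hc2 : Commute ((R ^ i)⁻¹) ((L ^ j)⁻¹ * L ^ i) :=
    ((hrl.pow_pow i j).inv_inv).mul_right (hrl.pow_pow i i).inv_left
  have hc3 : Commute ((R ^ i)⁻¹ * ((L ^ j)⁻¹ * L ^ i)) (R ^ j) :=
    (((Commute.refl R).pow_pow i j).inv_left).mul_left
      ((hlr.pow_pow j j).inv_left.mul_left (hlr.pow_pow i j))
  have hc4 : Commute D.sq ((R ^ i)⁻¹ * ((L ^ j)⁻¹ * L ^ i) * R ^ j) :=
    ((hcr.pow_right i).inv_right.mul_right ((hcl.pow_right j).inv_right.mul_right (hcl.pow_right i))).mul_right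
      (hcr.pow_right j)
  have h5 : ((R ^ i)⁻¹ * ((L ^ j)⁻¹ * L ^ i) * R ^ j) ^ s = 1 := by
    rw [hc3.mul_pow, hc2.mul_pow, hc1.mul_pow, inv_pow, inv_pow, pow_right_comm R i, pow_right_comm R j,
      pow_right_comm L i, pow_right_comm L j, hr, hs]
    simp
  have h6 : ∀ (k : ℕ) b, F (((D.sq * ((R ^ i)⁻¹ * ((L ^ j)⁻¹ * L ^ i) * R ^ j)) ^ k) b) = F b := by
    intro k
    induction k with
    | zero => intro b; rfl
    | succ k ih => intro b; rw [pow_succ', AlgEquiv.mul_apply, h1, ih]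
  have h7 := h6 s a
  rwa [hc4.mul_pow, h5, mul_one] at h7

/-- In the basic case the square of the antipode has order dividing the order of `al`. -/
lemma sq_pow_eq_one_of_basic {s : ℕ} (hs : ellE D.al ^ s = 1) (hsq : D.sq ^ (2 * s) = 1) (I : Irr A)
    (hall : ∀ x, x ∈ I.orb D.al I.triv) : D.sq ^ s = 1 := by
  have hb : ∀ x, ∃ i : ℕ, I.idx (pw D.al i) = x := fun x => by
    obtain ⟨i, _, h⟩ := Irr.mem_orb_triv.1 (hall x)
    exact ⟨i, h⟩
  choose c hc using hb
  have hJ : ∀ a, a ∈ I.J ↔ ∀ x, pw D.al (c x) a = 0 := fun a => by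
    rw [I.memJ]
    refine forall_congr' fun x => ⟨fun h => ?_, fun h => ?_⟩
    · rw [← I.chi_idx, hc, I.chi_apply, h, map_zero]
    · have := I.rho_idx (pw D.al (c x)) a
      rw [h, zero_smul, hc] at this
      exact this
  have hsβ : ∀ x a, pw D.al (c x) ((D.sq ^ s) a) = pw D.al (c x) a := fun x => by
    have h1 : ∀ a, pw D.al (c x) (D.sq a) = pw D.al (c x) a := fun a =>
      DFunLike.congr_fun (cinv_cinv (pw D.al (c x))) a
    have h2 : ∀ (k : ℕ) a, pw D.al (c x) ((D.sq ^ k) a) = pw D.al (c x) a := fun k => by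
      induction k with
      | zero => intro a; rfl
      | succ k ih => intro a; rw [pow_succ', AlgEquiv.mul_apply, h1, ih]
    exact h2 s
  have hP1 : ∀ a, a - (D.sq ^ s) a ∈ I.J := fun a => (hJ _).2 fun x => by rw [map_sub, hsβ, sub_self]
  have hsJ : ∀ a ∈ I.J, (D.sq ^ s) a ∈ I.J := fun a ha => by
    have := I.J.sub_mem ha (hP1 a)
    rwa [sub_sub_cancel] at this
  obtain ⟨e, he, hev⟩ : ∃ e : Fin I.k → A, CompleteOrthogonalIdempotents e ∧
      ∀ x z, pw D.al (c z) (e x) = if z = x then 1 else 0 := by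
    obtain ⟨e, he, h⟩ := CompleteOrthogonalIdempotents.lift_of_isNilpotent_ker
      (RingHom.pi fun x => (pw D.al (c x)).toRingHom) (fun a ha => I.isNilpotent_of_mem ((hJ a).2 fun x =>
        congrFun ha x)) (CompleteOrthogonalIdempotents.single fun _ : Fin I.k => ℂ) (fun x => ⟨I.e x, by
          funext z
          change pw D.al (c z) (I.e x) = _
          rw [← I.chi_idx, hc, I.chi_e, Pi.single_apply]⟩)
    refine ⟨e, he, fun x z => ?_⟩
    have := congrFun (congrFun h x) z
    rw [Pi.single_apply] at this
    exact this
  have hdec : ∀ a, a - ∑ z, pw D.al (c z) a • e z ∈ I.J := fun a => (hJ _).2 fun x => by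
    rw [map_sub, map_sum]
    simp [hev]
  have hP2 : ∀ a ∈ I.J, a - (D.sq ^ s) a ∈ I.J ^ 2 := fun a ha => by
    by_contra hno
    obtain ⟨f, hf, hf0⟩ := Submodule.exists_le_ker_of_notMem (p := (I.J ^ 2).restrictScalars ℂ) hno
    have hf2 : ∀ u ∈ I.J, ∀ v ∈ I.J, f (u * v) = 0 := fun u hu v hv =>
      hf0 (by
        change u * v ∈ I.J ^ 2
        rw [Submodule.pow_succ, Submodule.pow_one]
        exact Ideal.mul_mem_mul hu hv)
    have hskew : ∀ x y, IsSkew (pw D.al (c x)) (pw D.al (c y))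
        (f ∘ₗ LinearMap.mulLeft ℂ (e x) ∘ₗ LinearMap.mulRight ℂ (e y) -
          f (e x * e y) • (pw D.al (c x)).toLinearMap) := fun x y a b => by
      set β := pw D.al (c x)
      set γ := pw D.al (c y)
      set a' := a - ∑ z, pw D.al (c z) a • e z with ha'
      set b' := b - ∑ z, pw D.al (c z) b • e z with hb'
      have h1 : e x * a = β a • e x + e x * a' := by
        rw [ha', mul_sub, Finset.mul_sum, Finset.sum_eq_single x, mul_smul_comm, (he.idem x).eq]
        · abel
        · intro z _ hz
          rw [mul_smul_comm, he.ortho hz.symm, smul_zero]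
        · simp
      have h2 : b * e y = γ b • e y + b' * e y := by
        rw [hb', sub_mul, Finset.sum_mul, Finset.sum_eq_single y, smul_mul_assoc, (he.idem y).eq]
        · abel
        · intro z _ hz
          rw [smul_mul_assoc, he.ortho hz, smul_zero]
        · simp
      have h3 : f (e x * a' * (b' * e y)) = 0 :=
        hf2 _ (I.mem_mul_left (hdec a) _) _ (I.mem_mul_right (hdec b) _)
      simp only [LinearMap.sub_apply, LinearMap.comp_apply, LinearMap.mulLeft_apply, LinearMap.mulRight_apply,
        LinearMap.smul_apply, AlgHom.toLinearMap_apply, smul_eq_mul, map_mul]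
      rw [mul_assoc a b, ← mul_assoc (e x) a (b * e y), ← mul_assoc (e x) a (e y), h1, h2]
      simp only [add_mul, mul_add, smul_mul_assoc, mul_smul_comm, map_add, map_smul, smul_eq_mul, h3,
        mul_assoc (e x) a' (e y)]
      ring
    apply hf
    rw [map_sub, sub_eq_zero]
    have hxy : ∀ u ∈ I.J, f u = ∑ x, ∑ y, (f ∘ₗ LinearMap.mulLeft ℂ (e x) ∘ₗ LinearMap.mulRight ℂ (e y) -
          f (e x * e y) • (pw D.al (c x)).toLinearMap) u := fun u hu => by
      have : ∀ x, pw D.al (c x) u = 0 := (hJ u).1 hu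
      simp only [LinearMap.sub_apply, LinearMap.comp_apply, LinearMap.mulLeft_apply, LinearMap.mulRight_apply,
        LinearMap.smul_apply, AlgHom.toLinearMap_apply, this, smul_zero, sub_zero]
      conv_lhs => rw [← one_mul u, ← he.complete, Finset.sum_mul, map_sum]
      refine Finset.sum_congr rfl fun x _ => ?_
      rw [← map_sum, ← Finset.mul_sum, ← Finset.mul_sum, he.complete, mul_one]
    rw [hxy a ha, hxy _ (hsJ a ha)]
    exact Finset.sum_congr rfl fun x _ => Finset.sum_congr rfl fun y _ => ((hskew x y).sq_pow hs a).symm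
  have hT2 : ∀ a, (D.sq ^ s) ((D.sq ^ s) a) = a := fun a => by
    rw [← AlgEquiv.mul_apply, ← pow_add, ← two_mul, hsq, AlgEquiv.one_apply]
  have hP : ∀ (k : ℕ) a, a - (D.sq ^ s) a ∈ I.J ^ (k + 1) := fun k => by
    induction k with
    | zero => intro a; rw [zero_add, Submodule.pow_one]; exact hP1 a
    | succ k ih =>
      intro a
      have h1 : ∀ v ∈ I.J ^ 2, v - (D.sq ^ s) v ∈ I.J ^ (k + 1 + 1) := fun v hv => by
        rw [Submodule.pow_succ, Submodule.pow_one] at hv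
        induction hv using Submodule.mul_induction_on' with
        | mem_mul_mem x hx y hy =>
          have : x * y - (D.sq ^ s) (x * y) = (x - (D.sq ^ s) x) * y + (D.sq ^ s) x * (y - (D.sq ^ s) y) := by
            rw [map_mul]; noncomm_ring
          rw [this]
          refine Submodule.add_mem _ ?_ ?_
          · rw [Submodule.pow_succ]
            exact Ideal.mul_mem_mul (ih x) hy
          · rw [Submodule.pow_succ' _ k.succ_ne_zero]
            exact Ideal.mul_mem_mul (hsJ x hx) (ih y)
        | add x _ y _ hx hy =>
          rw [map_add, add_sub_add_comm]
          exact Submodule.add_mem _ hx hy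
      have h2 : ∀ K : Ideal A, (a - (D.sq ^ s) a) - (D.sq ^ s) (a - (D.sq ^ s) a) ∈ K →
          a - (D.sq ^ s) a ∈ K := fun K h => by
        have h3 := Submodule.smul_of_tower_mem K (2⁻¹ : ℂ) h
        have h4 : (a - (D.sq ^ s) a) - (D.sq ^ s) (a - (D.sq ^ s) a) = (2 : ℂ) • (a - (D.sq ^ s) a) := by
          rw [map_sub, hT2, two_smul]; abel
        rwa [h4, smul_smul, inv_mul_cancel₀ two_ne_zero, one_smul] at h3
      exact h2 _ (h1 _ (h2 _ (hP2 _ (hP1 a))))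
  obtain ⟨k, hk⟩ := I.nilp
  ext a
  have := hP k a
  rw [Submodule.pow_succ, hk, Submodule.zero_eq_bot, Submodule.bot_mul] at this
  exact (sub_eq_zero.1 this).symm

lemma exists_fixed [Nontrivial A] {p q : ℕ} (hp : p.Prime) (hq : q.Prime) (hop : Odd p) (hoq : Odd q)
    (hpq : p < q) (hq2 : q ≤ 2 * p + 1)
    (hN : Module.finrank ℂ A = p * q) (hal : D.al ≠ Bialgebra.counitAlgHom ℂ A)
    (hs : orderOf (ellE D.al) = p) (hsq : D.sq ^ (2 * p) = 1) (I : Irr A) : ∃ x, ellE D.al ∈ I.stab x := by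
  by_contra hfree
  push Not at hfree
  obtain ⟨hall, hm⟩ := basic_of_free hp hq hop hoq hq2 hN hal hs hsq I hfree
  have h1 := sq_pow_eq_one_of_basic (hs ▸ pow_orderOf_eq_one _) hsq I hall
  have h2 : D.sq ∈ I.stab I.triv := by
    rw [I.mem_stab]
    refine I.perm_eq fun a => ?_
    rw [Irr.triv, I.chi_idx, I.chi_idx]
    simp [sq_apply]
  obtain ⟨F, c, μ, hF, hμ, hn, ht⟩ := I.exists_twisted h2 hp.pos h1
  rw [hm] at ht
  have h3 : p ∣ q := dvd_of_roots hp hop hμ hn ht (trace_sq_eq_zero hal (Bialgebra.counitAlgHom ℂ A) c F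
    fun x => by rw [hF, ellE_eq_one.2 rfl]; rfl)
  exact hpq.ne ((Nat.prime_dvd_prime_iff_eq hp hq).1 h3)

end IntData
end Sw

namespace Sw

variable {A : Type} [Ring A] [HopfAlgebra ℂ A] [Module.Finite ℂ A]

namespace IntData
variable {D : IntData A}

/-- Numerical data of a simple module fixed by `ellE al`. -/
lemma fixed_data [Nontrivial A] {p q : ℕ} (hp : p.Prime) (hop : Odd p)
    (hq2 : q ≤ 2 * p + 1)
    (hN : Module.finrank ℂ A = p * q) (hal : D.al ≠ Bialgebra.counitAlgHom ℂ A)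
    (hs : orderOf (ellE D.al) = p) (I : Irr A) {x} (hx : ellE D.al ∈ I.stab x) :
    I.n x = p ∧ I.m x = p ∧ arrE D.al ∈ I.stab x ∧ D.sq ∈ I.stab x ∧ I.mult x x x + q = 2 * p := by
  have hd := two_le_m hal I
  set d := I.m I.triv with hdd
  have hwt : I.w I.triv = d := I.w_idx _
  have hsum := fun t => hN ▸ I.sum_w_le t
  have hdis : ∀ {y}, ellE D.al ∈ I.stab y → Disjoint (I.orb D.al I.triv) {y} := fun {y} hy => by
    rw [Finset.disjoint_singleton_right]
    intro h
    obtain ⟨i, hi⟩ := Irr.mem_orb'.1 h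
    apply Irr.triv_free (I := I) hs hp
    have h1 : I.perm (ellE D.al ^ i) I.triv = I.perm (ellE D.al ^ i) y := by
      rw [hi, I.mem_stab.1 ((I.stab y).pow_mem hy i)]
    rwa [I.perm_inj (ellE D.al ^ i) h1]
  have hst : ∑ i ∈ I.orb D.al I.triv, I.w i = p * d := by
    rw [Irr.sum_orb hs hp (Irr.triv_free hs hp), hwt]
  have hnm : ∀ {y}, ellE D.al ∈ I.stab y → I.n y = p ∧ I.m y = p := fun {y} hy => by
    obtain ⟨⟨a, ha⟩, b, hb⟩ := I.dvd_of_mem_stab hs hp hop hy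
    have h := hsum (I.orb D.al I.triv ∪ {y})
    rw [Finset.sum_union (hdis hy), hst, Finset.sum_singleton, Irr.w, ha, hb, mul_assoc, ← mul_add] at h
    have h1 := Nat.le_of_mul_le_mul_left h hp.pos
    have ha0 : 0 < a := Nat.pos_of_mul_pos_left (ha ▸ I.n_pos y)
    have hb0 : 0 < b := Nat.pos_of_mul_pos_left (hb ▸ I.m_pos y)
    have h2 : b * a < 2 := by
      by_contra h3
      push Not at h3
      have : p * 2 ≤ p * (b * a) := Nat.mul_le_mul_left p h3
      have e : b * (p * a) = p * (b * a) := by ring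
      omega
    have h3 : a < 2 := lt_of_le_of_lt (Nat.le_mul_of_pos_left a hb0) h2
    have h4 : b < 2 := lt_of_le_of_lt (Nat.le_mul_of_pos_right b ha0) h2
    obtain rfl : a = 1 := by omega
    obtain rfl : b = 1 := by omega
    exact ⟨by rw [ha, mul_one], by rw [hb, mul_one]⟩
  have huniq : ∀ {y}, ellE D.al ∈ I.stab y → y = x := fun {y} hy => by
    by_contra hne
    have h := hsum ((I.orb D.al I.triv ∪ {x}) ∪ {y})
    rw [Finset.sum_union (Finset.disjoint_union_left.2 ⟨hdis hy, by simpa using Ne.symm hne⟩),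
      Finset.sum_union (hdis hx), hst, Finset.sum_singleton, Finset.sum_singleton, Irr.w, Irr.w, (hnm hx).1,
      (hnm hx).2, (hnm hy).1, (hnm hy).2, ← mul_add, ← mul_add] at h
    have := Nat.le_of_mul_le_mul_left h hp.pos
    omega
  obtain ⟨hn, hm⟩ := hnm hx
  have harr : arrE D.al ∈ I.stab x := by
    rw [I.mem_stab]
    apply huniq
    rw [I.mem_stab, ← I.perm_mul, ← (ellE_comm_arrE _ _).eq, I.perm_mul, I.mem_stab.1 hx]
  have hsq : D.sq ∈ I.stab x := by
    rw [I.mem_stab]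
    apply huniq
    rw [I.mem_stab, ← I.perm_mul, (D.sq_comm_ell _).eq, I.perm_mul, I.mem_stab.1 hx]
  have hnW : ∀ y, y ≠ x → I.n y * I.n y < p := fun y hy => by
    have hfy : ellE D.al ∉ I.stab y := fun h => hy (huniq h)
    by_cases hyt : y ∈ I.orb D.al I.triv
    · rw [Irr.n_orb hyt, Irr.triv, I.n_idx, mul_one]
      exact hp.one_lt
    · have hxy : Disjoint ({x} : Finset (Fin I.k)) (I.orb D.al y) := by
        rw [Finset.disjoint_singleton_left]
        intro h
        obtain ⟨i, hi⟩ := Irr.mem_orb'.1 h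
        have h1 : I.perm (ellE D.al ^ i) y = I.perm (ellE D.al ^ i) x := by
          rw [hi, I.mem_stab.1 ((I.stab x).pow_mem hx i)]
        exact hy (I.perm_inj (ellE D.al ^ i) h1)
      have h := hsum ((I.orb D.al I.triv ∪ {x}) ∪ I.orb D.al y)
      rw [Finset.sum_union (Finset.disjoint_union_left.2 ⟨Irr.disjoint_orb hyt, hxy⟩),
        Finset.sum_union (hdis hx), hst, Finset.sum_singleton, Irr.sum_orb hs hp hfy, Irr.w, hn, hm,
        ← mul_add, ← mul_add] at h
      have h1 := Nat.le_of_mul_le_mul_left h hp.pos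
      have h2 : I.n y * I.n y ≤ I.w y := Nat.mul_le_mul_right _ (I.n_le_m y)
      omega
  have hnn : ∀ y z, y ≠ x → z ≠ x → I.n y * I.n z < p := fun y z hy hz => by
    rcases le_total (I.n y) (I.n z) with h | h
    · exact (Nat.mul_le_mul_right _ h).trans_lt (hnW z hz)
    · exact (Nat.mul_le_mul_left _ h).trans_lt (hnW y hy)
  have hmult : ∀ y z, y ≠ x → z ≠ x → I.mult y z x = 0 := fun y z hy hz => by
    have h := (I.mult_le y z x).trans_lt (hnn y z hy hz)
    rw [hn] at h
    by_contra h0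
    exact absurd (Nat.le_mul_of_pos_left p (Nat.pos_of_ne_zero h0)) (not_le.2 h)
  have hmx : ∀ y, y ≠ x → I.mult y x x = I.n y := fun y hy => by
    have h := I.sum_m_mult' y x
    rw [Finset.sum_eq_single x (fun z _ hz => by rw [hmult y z hy hz, mul_zero]) (by simp), hm,
      mul_comm (I.n y)] at h
    exact Nat.eq_of_mul_eq_mul_left hp.pos h
  refine ⟨hn, hm, harr, hsq, ?_⟩
  have h := I.sum_m_mult x x D.antipode_surjective
  have h2 := I.finrank_eq_w
  rw [← Finset.add_sum_erase _ _ (Finset.mem_univ x)] at h h2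
  rw [Finset.sum_congr rfl fun i hi => by rw [hmx i (Finset.ne_of_mem_erase hi)]] at h
  change _ = _ + ∑ i ∈ _, I.m i * I.n i at h2
  rw [hm, hn] at h
  rw [Irr.w, hm, hn, hN] at h2
  have h3 : p * (I.mult x x x + q) = p * (2 * p) := by
    rw [mul_add, h2]
    linarith
  exact Nat.eq_of_mul_eq_mul_left hp.pos h3

end IntData
end Sw

namespace Sw

variable {A : Type} [Ring A] [HopfAlgebra ℂ A] [Module.Finite ℂ A]

lemma sw_arr_left {M : Type*} [AddCommGroup M] [Module ℂ M] (β : A →ₐ[ℂ] ℂ) (a : A) {F : A → A → M} (h : Bil F) :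
    sw a (fun x y => F (arr β x) y) = sw a (fun x y => F x (ell β y)) := by
  obtain ⟨h1, h2, h3, h4⟩ := h
  have hT : Tri (fun x y z => β y • F x z) := by
    constructor <;> intros <;> simp [h1, h2, h3, h4, add_smul, smul_smul, mul_comm]
  have e1 : ∀ x y, F (arr β x) y = sw x fun u v => β v • F u y := fun x y => by
    let G : A →ₗ[ℂ] M := ⟨⟨fun t => F t y, fun _ _ => h1 _ _ _⟩, fun _ _ => h3 _ _ _⟩
    change G _ = _
    rw [arr_apply, map_sw]
    exact sw_congr fun u v => map_smul G _ _
  have e2 : ∀ x y, F x (ell β y) = sw y fun u v => β u • F x v := fun x y => by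
    let G : A →ₗ[ℂ] M := ⟨⟨fun t => F x t, fun _ _ => h2 _ _ _⟩, fun _ _ => h4 _ _ _⟩
    change G _ = _
    rw [ell_apply, map_sw]
    exact sw_congr fun u v => map_smul G _ _
  simp only [e1, e2]
  exact sw_assoc a hT

namespace Irr
variable {I : Irr A}

/-- Two normalized intertwiners for `ellE β` and `arrE β` commute up to a scalar. -/
lemma exists_commutator {β : A →ₐ[ℂ] ℂ} {x} {Φ Ψ : Module.End ℂ (I.V x)} {p : ℕ} (hp : 0 < p)
    (hΦ1 : Φ ^ p = 1) (hΨ1 : Ψ ^ p = 1)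
    (hΦ : ∀ a, Φ * I.ρ x a = I.ρ x (ell β a) * Φ) (hΨ : ∀ a, Ψ * I.ρ x a = I.ρ x (arr β a) * Ψ) :
    ∃ c : ℂ, c ^ p = 1 ∧ Ψ * Φ = c • (Φ * Ψ) := by
  obtain ⟨k, rfl⟩ : ∃ k, p = k + 1 := ⟨p - 1, by omega⟩
  have hΦ2 : Φ * Φ ^ k = 1 := by rw [← pow_succ', hΦ1]
  have hΦ3 : Φ ^ k * Φ = 1 := by rw [← pow_succ, hΦ1]
  have hΨ2 : Ψ * Ψ ^ k = 1 := by rw [← pow_succ', hΨ1]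
  have hΨ3 : Ψ ^ k * Ψ = 1 := by rw [← pow_succ, hΨ1]
  have inv : ∀ {T T' : Module.End ℂ (I.V x)} {b c : Module.End ℂ (I.V x)}, T * T' = 1 → T' * T = 1 →
      T * b = c * T → T' * c = b * T' := fun {T T' b c} h1 h2 h => by
    rw [← mul_one (T' * c), ← h1, mul_assoc, ← mul_assoc c, ← h, mul_assoc, ← mul_assoc, h2, one_mul]
  have hQ : Ψ ^ k * Φ ^ k * (Φ * Ψ) = 1 := by
    rw [mul_assoc, ← mul_assoc _ Φ, hΦ3, one_mul, hΨ3]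
  have hQ' : Φ * Ψ * (Ψ ^ k * Φ ^ k) = 1 := by
    rw [mul_assoc, ← mul_assoc _ _ (Φ ^ k), hΨ2, one_mul, hΦ2]
  have hc : ∀ a, (Ψ ^ k * Φ ^ k * (Ψ * Φ)) * I.ρ x a = I.ρ x a * (Ψ ^ k * Φ ^ k * (Ψ * Φ)) := fun a => by
    have h1 : Ψ * Φ * I.ρ x a = I.ρ x (ell β (arr β a)) * (Ψ * Φ) := by
      rw [mul_assoc, hΦ, ← mul_assoc, hΨ, mul_assoc, ell_arr]
    have h2 : Φ * Ψ * I.ρ x a = I.ρ x (ell β (arr β a)) * (Φ * Ψ) := by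
      rw [mul_assoc, hΨ, ← mul_assoc, hΦ, mul_assoc]
    rw [mul_assoc, h1, ← mul_assoc, inv hQ' hQ h2, mul_assoc]
  obtain ⟨c, hc⟩ := I.schur _ hc
  have h : Ψ * Φ = c • (Φ * Ψ) := by
    rw [← one_mul (Ψ * Φ), ← hQ', mul_assoc, hc, Algebra.algebraMap_eq_smul_one, mul_smul_comm, mul_one]
  refine ⟨c, ?_, h⟩
  have hpow : ∀ i : ℕ, Ψ * Φ ^ i = c ^ i • (Φ ^ i * Ψ) := fun i => by
    induction i with
    | zero => simp
    | succ i ih =>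
      rw [pow_succ, ← mul_assoc, ih, smul_mul_assoc, mul_assoc, h, mul_smul_comm, smul_smul, pow_succ,
        mul_assoc]
  have h1 := hpow (k + 1)
  rw [hΦ1, mul_one, one_mul] at h1
  have h2 : (1 : Module.End ℂ (I.V x)) = c ^ (k + 1) • 1 := by
    calc (1 : Module.End ℂ (I.V x)) = Ψ * Ψ ^ k := hΨ2.symm
      _ = c ^ (k + 1) • Ψ * Ψ ^ k := congrArg (· * Ψ ^ k) h1
      _ = _ := by rw [smul_mul_assoc, hΨ2]
  refine (algebraMap ℂ (Module.End ℂ (I.V x))).injective ?_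
  rw [Algebra.algebraMap_eq_smul_one, ← h2, map_one]

/-- If the normalized intertwiners for `ellE β` and `arrE β` do not commute, then `V x` occurs in
its tensor square with multiplicity divisible by `p`. -/
lemma dvd_mult {β : A →ₐ[ℂ] ℂ} {x} {Φ Ψ : Module.End ℂ (I.V x)} {p : ℕ} (hp : p.Prime)
    (hΦ1 : Φ ^ p = 1) (hΨ1 : Ψ ^ p = 1)
    (hΦ : ∀ a, Φ * I.ρ x a = I.ρ x (ell β a) * Φ) (hΨ : ∀ a, Ψ * I.ρ x a = I.ρ x (arr β a) * Ψ)
    (hx : ellE β ∈ I.stab x) {c : ℂ} (hcp : c ^ p = 1) (hc : c ≠ 1) (h : Ψ * Φ = c • (Φ * Ψ)) :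
    p ∣ I.mult x x x := by
  obtain ⟨k, hk⟩ : ∃ k, p = k + 1 := ⟨p - 1, by have := hp.pos; omega⟩
  have hΦ2 : Φ * Φ ^ k = 1 := by rw [← pow_succ', ← hk, hΦ1]
  have hΦ3 : Φ ^ k * Φ = 1 := by rw [← pow_succ, ← hk, hΦ1]
  have hΦk : ∀ a, Φ ^ k * I.ρ x (ell β a) = I.ρ x a * Φ ^ k := fun a => by
    rw [← mul_one (Φ ^ k * I.ρ x (ell β a)), ← hΦ2, mul_assoc, ← mul_assoc (I.ρ x _), ← hΦ, mul_assoc,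
      ← mul_assoc, hΦ3, one_mul]
  set t := tens (I.ρ x) (I.ρ x) with ht
  set U : Module.End ℂ (I.V x ⊗[ℂ] I.V x) := TensorProduct.map Ψ (Φ ^ k) with hU
  set Z : Module.End ℂ (I.V x ⊗[ℂ] I.V x) := TensorProduct.map Φ 1 with hZ
  set Z' : Module.End ℂ (I.V x ⊗[ℂ] I.V x) := TensorProduct.map (Φ ^ k) 1 with hZ'
  have hZZ : Z * Z' = 1 := by rw [hZ, hZ', ← TensorProduct.map_mul, hΦ2, mul_one, TensorProduct.map_one]
  have hZZ' : Z' * Z = 1 := by rw [hZ, hZ', ← TensorProduct.map_mul, hΦ3, mul_one, TensorProduct.map_one]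
  have hUp : U ^ p = 1 := by
    rw [hU, TensorProduct.map_pow, hΨ1, ← pow_mul, mul_comm, pow_mul, hΦ1, one_pow, TensorProduct.map_one]
  have hUt : ∀ a, Commute (t a) U := fun a => by
    have hB : Bil fun u v : A => (TensorProduct.map (I.ρ x u * Ψ) (Φ ^ k * I.ρ x v) :
        Module.End ℂ (I.V x ⊗[ℂ] I.V x)) := by
      constructor <;> intros <;>
        simp [mul_add, add_mul, TensorProduct.map_add_left, TensorProduct.map_add_right,
          TensorProduct.map_smul_left, TensorProduct.map_smul_right]
    have h1 := sw_arr_left β a hB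
    have h2 : U * t a = LinearMap.mulLeft ℂ U (t a) := rfl
    have h3 : t a * U = LinearMap.mulRight ℂ U (t a) := rfl
    rw [commute_iff_eq, h2, h3, ht, tens_apply, map_sw, map_sw]
    simp only [LinearMap.mulLeft_apply, LinearMap.mulRight_apply, hU, ← TensorProduct.map_mul]
    simpa only [← hΨ, hΦk] using h1.symm
  have hZt : ∀ a, Z * t a = t (ell β a) * Z := fun a => by
    have h2 : Z * t a = LinearMap.mulLeft ℂ Z (t a) := rfl
    have h3 : t (ell β a) * Z = LinearMap.mulRight ℂ Z (t (ell β a)) := rfl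
    have hB : Bil fun u v : A => (TensorProduct.map (I.ρ x u) (I.ρ x v) :
        Module.End ℂ (I.V x ⊗[ℂ] I.V x)) := by
      constructor <;> intros <;>
        simp [TensorProduct.map_add_left, TensorProduct.map_add_right,
          TensorProduct.map_smul_left, TensorProduct.map_smul_right]
    rw [h2, h3, ht, tens_apply, tens_apply, sw_ell _ _ hB, map_sw, map_sw]
    simp only [LinearMap.mulLeft_apply, LinearMap.mulRight_apply, hZ, ← TensorProduct.map_mul, hΦ, one_mul,
      mul_one]
  have hUZ : ∀ i : ℕ, U ^ i * Z = c ^ i • (Z * U ^ i) := fun i => by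
    have h1 : ∀ i : ℕ, Ψ ^ i * Φ = c ^ i • (Φ * Ψ ^ i) := fun i => by
      induction i with
      | zero => simp
      | succ i ih =>
        rw [pow_succ', mul_assoc, ih, mul_smul_comm, ← mul_assoc, h, smul_mul_assoc, smul_smul, pow_succ,
          mul_assoc]
    rw [hU, hZ, TensorProduct.map_pow, ← TensorProduct.map_mul, ← TensorProduct.map_mul, h1,
      TensorProduct.map_smul_left, one_mul, mul_one]
  have htr : ∀ (i : ℕ) a, LinearMap.trace ℂ _ (t (ell β a) * U ^ i) =
      c ^ i * LinearMap.trace ℂ _ (t a * U ^ i) := fun i a => by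
    have h1 : t (ell β a) = Z * (t a * Z') := by
      rw [← mul_assoc, hZt, mul_assoc, hZZ, mul_one]
    rw [h1, mul_assoc, LinearMap.trace_mul_comm, mul_assoc, hUZ, mul_smul_comm, mul_assoc,
      map_smul, ← mul_assoc Z', hZZ', one_mul, smul_eq_mul]
  have hf : ∀ i : ℕ, LinearMap.trace ℂ _ (t (ell β (I.e x)) * U ^ i) =
      LinearMap.trace ℂ _ (t (I.e x) * U ^ i) := fun i => by
    set f : A →ₗ[ℂ] ℂ := LinearMap.trace ℂ _ ∘ₗ LinearMap.mulRight ℂ (U ^ i) ∘ₗ t.toLinearMap with hf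
    have hfa : ∀ a, LinearMap.trace ℂ _ (t a * U ^ i) = f a := fun a => rfl
    have h1 := I.eq_sum_chi f (fun a b => by
        rw [← hfa, ← hfa, map_mul t, map_mul t, mul_assoc, LinearMap.trace_mul_comm, mul_assoc,
          ← ((hUt a).pow_right i).eq, mul_assoc])
      (fun a ha => (LinearMap.isNilpotent_trace_of_isNilpotent
        (((hUt a).pow_right i).isNilpotent_mul_right ((I.isNilpotent_of_mem ha).map t))).eq_zero)
    rw [hfa, hfa, h1, Finset.sum_eq_single x]
    · rw [← ellE_apply, ← I.chi_perm, I.mem_stab.1 hx, I.chi_e, if_pos rfl, mul_one]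
    · intro j _ hj
      rw [← ellE_apply, ← I.chi_perm, I.chi_e, if_neg, mul_zero]
      intro h
      exact hj (I.perm_inj (ellE β) (h.trans (I.mem_stab.1 hx).symm))
    · simp
  refine avg_dvd ((I.idem x).map t) (hUt _) hp.pos hUp (fun i h0 hi => ?_) ?_
  · have h1 := hf i
    rw [htr] at h1
    by_contra hne
    have h2 : c ^ i = 1 := mul_right_cancel₀ hne (h1.trans (one_mul _).symm)
    have := Fact.mk hp
    have h3 : orderOf c = p := orderOf_eq_prime hcp hc
    have := Nat.le_of_dvd h0 (h3 ▸ orderOf_dvd_of_pow_eq_one h2)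
    omega
  · rw [← I.cv_e, cv_apply, ht, tens_apply, map_sw]
    refine sw_congr fun u v => ?_
    rw [LinearMap.trace_tensorProduct', I.chi_apply, I.chi_apply]

end Irr
end Sw

namespace Sw

section
variable {V : Type*} [AddCommGroup V] [Module ℂ V] [Module.Finite ℂ V]

lemma comp_eq_smul_of_rank_one {P h : Module.End ℂ V} (hP : IsIdempotentElem P)
    (ht : LinearMap.trace ℂ V P = 1) (hc : Commute h P) : ∃ c : ℂ, h * P = c • P := by
  rw [trace_idem hP, ← Nat.cast_one, Nat.cast_inj] at ht
  obtain ⟨⟨v, hv⟩, -, hspan⟩ := finrank_eq_one_iff'.1 ht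
  have hPv : P v = v := by
    obtain ⟨w, rfl⟩ := hv
    exact congrArg (· w) hP.eq
  have hmem : h v ∈ LinearMap.range P := ⟨h v, by
    change (P * h) v = _
    rw [← hc.eq, Module.End.mul_apply, hPv]⟩
  obtain ⟨c, hcv⟩ := hspan ⟨h v, hmem⟩
  have hcv' : c • v = h v := congrArg Subtype.val hcv
  refine ⟨c, LinearMap.ext fun w => ?_⟩
  obtain ⟨d, hd⟩ := hspan ⟨P w, w, rfl⟩
  have hd' : d • v = P w := congrArg Subtype.val hd
  rw [Module.End.mul_apply, LinearMap.smul_apply, ← hd', map_smul, ← hcv', smul_comm]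

/-- The centralizer of a regular operator of finite order consists of its polynomials. -/
lemma mem_span_of_commute {X h : Module.End ℂ V} {p : ℕ} (hp : 0 < p) (hX : X ^ p = 1)
    (ht : ∀ i, 0 < i → i < p → LinearMap.trace ℂ V (X ^ i) = 0) (hV : Module.finrank ℂ V = p)
    (hc : Commute h X) : h ∈ Submodule.span ℂ (Set.range fun i : ℕ => X ^ i) := by
  have hp0 : (p : ℂ) ≠ 0 := by exact_mod_cast hp.ne'
  have : NeZero p := ⟨hp.ne'⟩
  set ζ := Complex.exp (2 * Real.pi * Complex.I / p)
  have hζ : IsPrimitiveRoot ζ p := Complex.isPrimitiveRoot_exp p hp.ne'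
  set P : ℕ → Module.End ℂ V := fun k => (p : ℂ)⁻¹ • ∑ i ∈ Finset.range p, (ζ ^ k • X) ^ i with hP
  have hPi : ∀ k, IsIdempotentElem (P k) := fun k => by
    refine (avg_idem (R := Module.End ℂ V) hp ?_).2
    rw [smul_pow, hX, ← pow_mul, mul_comm, pow_mul, hζ.pow_eq_one, one_pow, one_smul]
  have hPt : ∀ k, LinearMap.trace ℂ V (P k) = 1 := fun k => by
    rw [hP, map_smul, map_sum, Finset.sum_eq_single 0]
    · rw [pow_zero, LinearMap.trace_one, hV, smul_eq_mul, inv_mul_cancel₀ hp0]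
    · intro i hi h0
      rw [smul_pow, map_smul, ht i (Nat.pos_of_ne_zero h0) (Finset.mem_range.1 hi), smul_zero]
    · intro h; exact absurd (Finset.mem_range.2 hp) h
  have hPc : ∀ k, Commute h (P k) := fun k => by
    apply Commute.smul_right
    apply Commute.sum_right
    intro i _
    exact (hc.smul_right _).pow_right i
  have hPs : ∑ k ∈ Finset.range p, P k = 1 := by
    rw [hP, ← Finset.smul_sum, Finset.sum_comm, Finset.sum_eq_single 0]
    · simp only [pow_zero, Finset.sum_const, Finset.card_range]
      rw [← Nat.cast_smul_eq_nsmul ℂ, smul_smul, inv_mul_cancel₀ hp0, one_smul]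
    · intro i hi h0
      simp only [smul_pow]
      rw [← Finset.sum_smul]
      have h1 : ζ ^ i ≠ 1 := hζ.pow_ne_one_of_pos_of_lt h0 (Finset.mem_range.1 hi)
      have h2 : ∑ k ∈ Finset.range p, (ζ ^ k) ^ i = 0 := by
        have h3 : ∀ k, (ζ ^ k) ^ i = (ζ ^ i) ^ k := fun k => by rw [← pow_mul, mul_comm, pow_mul]
        simp only [h3]
        rw [geom_sum_eq h1, ← pow_mul, mul_comm, pow_mul, hζ.pow_eq_one, one_pow, sub_self, zero_div]
      rw [h2, zero_smul]
    · intro h; exact absurd (Finset.mem_range.2 hp) h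
  rw [← mul_one h, ← hPs, Finset.mul_sum]
  refine Submodule.sum_mem _ fun k _ => ?_
  obtain ⟨c, hc⟩ := comp_eq_smul_of_rank_one (hPi k) (hPt k) (hPc k)
  rw [hc]
  refine Submodule.smul_mem _ _ (Submodule.smul_mem _ _ (Submodule.sum_mem _ fun i _ => ?_))
  rw [smul_pow]
  exact Submodule.smul_mem _ _ (Submodule.subset_span ⟨i, rfl⟩)

end

variable {A : Type} [Ring A] [HopfAlgebra ℂ A] [Module.Finite ℂ A]

lemma sw_arrE_pow {M : Type*} [AddCommGroup M] [Module ℂ M] (β : A →ₐ[ℂ] ℂ) (i : ℕ) (a : A)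
    {F : A → A → M} (hF : Bil F) :
    sw ((arrE β ^ i) a) F = sw a fun u v => F u ((arrE β ^ i) v) := by
  induction i generalizing F with
  | zero => rfl
  | succ i ih =>
    have e : ∀ a, (arrE β ^ (i + 1)) a = arr β ((arrE β ^ i) a) := fun a => by rw [pow_succ']; rfl
    simp only [e]
    rw [sw_arr _ _ hF, ih]
    obtain ⟨h1, h2, h3, h4⟩ := hF
    constructor <;> intros <;> simp [h1, h2, h3, h4]

namespace Irr
variable (I : Irr A)

/-- The averaging operator `f ↦ ∑ ρ(L₁) f ρ(S L₂)`. -/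
def intAvg (L : A) (x : Fin I.k) : Module.End ℂ (I.V x) →ₗ[ℂ] Module.End ℂ (I.V x) where
  toFun f := sw L fun u v => I.ρ x u * f * I.ρ x (antipode ℂ v)
  map_add' f g := by simp only [mul_add, add_mul, sw_add_fun]
  map_smul' c f := by simp only [mul_smul_comm, smul_mul_assoc, sw_smul_fun, RingHom.id_apply]

lemma intAvg_apply (L : A) (x) (f : Module.End ℂ (I.V x)) :
    I.intAvg L x f = sw L fun u v => I.ρ x u * f * I.ρ x (antipode ℂ v) := rfl

lemma intAvg_scalar {L : A} (hL : IsLInt L) (x) (f : Module.End ℂ (I.V x)) :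
    ∃ μ : ℂ, I.intAvg L x f = algebraMap ℂ _ μ := by
  refine I.schur _ fun a => ?_
  have h1 : I.intAvg L x f * I.ρ x a = LinearMap.mulRight ℂ (I.ρ x a) (I.intAvg L x f) := rfl
  have h2 : I.ρ x a * I.intAvg L x f = LinearMap.mulLeft ℂ (I.ρ x a) (I.intAvg L x f) := rfl
  rw [h1, h2, intAvg_apply, map_sw, map_sw]
  have h := lint_move hL (F := fun u v => I.ρ x u * f * I.ρ x v)
    (by constructor <;> intros <;> simp [add_mul, mul_add]) a
  simpa [mul_assoc] using h.symm

lemma intAvg_conj {L : A} (hL : IsLInt L) {β : A →ₐ[ℂ] ℂ} {x} {X X' : Module.End ℂ (I.V x)}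
    (h1 : X * X' = 1) (h2 : X' * X = 1)
    (hX : ∀ a, X * I.ρ x a = I.ρ x (arr β a) * X) (f : Module.End ℂ (I.V x)) :
    I.intAvg L x (X * f * X') = I.intAvg L x f := by
  have hX' : ∀ a, X' * I.ρ x (arr β a) = I.ρ x a * X' := fun a => by
    rw [← mul_one (X' * I.ρ x (arr β a)), ← h1, mul_assoc, ← mul_assoc (I.ρ x _), ← hX, mul_assoc,
      ← mul_assoc, h2, one_mul]
  have hB : Bil fun u v : A => I.ρ x u * (X * f * X') * I.ρ x (antipode ℂ (ell (cinv β) v)) := by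
    constructor <;> intros <;> simp [add_mul, mul_add]
  have h3 : X * I.intAvg L x f * X' = I.intAvg L x (X * f * X') := by
    have e : X * I.intAvg L x f * X' =
        LinearMap.mulRight ℂ X' (LinearMap.mulLeft ℂ X (I.intAvg L x f)) := rfl
    have h := sw_arr_left β L hB
    simp only [ell_cinv_ell] at h
    rw [e, intAvg_apply, intAvg_apply, map_sw, map_sw, ← h]
    refine sw_congr fun u v => ?_
    simp only [LinearMap.mulRight_apply, LinearMap.mulLeft_apply]
    rw [← arr_antipode]
    simp only [← mul_assoc]
    rw [hX]
    simp only [mul_assoc]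
    rw [hX']
  obtain ⟨μ, hμ⟩ := I.intAvg_scalar hL x f
  rw [← h3, hμ, ← Algebra.commutes, mul_assoc, h1, mul_one]

lemma intAvg_pow_eq_zero {L : A} (hL : ∀ γ : A →ₐ[ℂ] ℂ, γ L = 0) {β : A →ₐ[ℂ] ℂ} {x}
    {X : Module.End ℂ (I.V x)} (hX : ∀ a, X * I.ρ x a = I.ρ x (ell β a) * X) (i : ℕ) :
    I.intAvg L x (X ^ i) = 0 := by
  have h1 : ∀ a, X ^ i * I.ρ x (antipode ℂ a) = I.ρ x (antipode ℂ ((arrE (cinv β) ^ i) a)) * X ^ i := by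
    induction i with
    | zero => simp
    | succ i ih =>
      intro a
      rw [pow_succ', mul_assoc, ih, ← mul_assoc, hX, ell_antipode, mul_assoc, pow_succ' (arrE _)]
      rfl
  have h2 := sw_arrE_pow (cinv β) i L (F := fun u v => u * antipode ℂ v)
    (by constructor <;> intros <;> simp [add_mul, mul_add])
  have h3 : I.intAvg L x (X ^ i) = LinearMap.mulRight ℂ (X ^ i)
      (I.ρ x (sw L (fun u v => u * antipode ℂ ((arrE (cinv β) ^ i) v)))) := by
    rw [intAvg_apply, map_sw, map_sw]
    refine sw_congr fun u v => ?_
    rw [mul_assoc, h1, LinearMap.mulRight_apply, map_mul (I.ρ x), mul_assoc]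
  have h4 := hL ((Bialgebra.counitAlgHom ℂ A).comp (arrE (cinv β) ^ i : A ≃ₐ[ℂ] A).toAlgHom)
  have h4 : counit (R := ℂ) ((arrE (cinv β) ^ i) L) = 0 := h4
  rw [h3, ← h2, sw_antipode_right', h4, zero_smul, map_zero, map_zero]

/-- If the normalized intertwiners for `ellE β` and `arrE β` commute, the averaging operator vanishes. -/
lemma intAvg_eq_zero {L : A} (hL : IsLInt L) (hL0 : ∀ γ : A →ₐ[ℂ] ℂ, γ L = 0) {β : A →ₐ[ℂ] ℂ} {p : ℕ}
    (hp : 0 < p) {x} (hn : I.n x = p) {Φ Ψ : Module.End ℂ (I.V x)} (hΦ1 : Φ ^ p = 1) (hΨ1 : Ψ ^ p = 1)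
    (hΦ : ∀ a, Φ * I.ρ x a = I.ρ x (ell β a) * Φ) (hΨ : ∀ a, Ψ * I.ρ x a = I.ρ x (arr β a) * Ψ)
    (hΦt : ∀ i, 0 < i → i < p → LinearMap.trace ℂ _ (Φ ^ i) = 0)
    (hΨt : ∀ i, 0 < i → i < p → LinearMap.trace ℂ _ (Ψ ^ i) = 0) (h : Commute Ψ Φ)
    (f : Module.End ℂ (I.V x)) : I.intAvg L x f = 0 := by
  have hV : Module.finrank ℂ (I.V x) = p := by simpa using hn
  have span : ∀ {X h : Module.End ℂ (I.V x)}, X ^ p = 1 →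
      (∀ i, 0 < i → i < p → LinearMap.trace ℂ _ (X ^ i) = 0) → Commute h X →
      h ∈ Submodule.span ℂ (Set.range fun i : ℕ => X ^ i) := fun h1 h2 h3 =>
    mem_span_of_commute hp h1 h2 hV h3
  obtain ⟨k, hk⟩ : ∃ k, p = k + 1 := ⟨p - 1, by omega⟩
  have hΨ2 : Ψ * Ψ ^ k = 1 := by rw [← pow_succ', ← hk, hΨ1]
  have hΨ3 : Ψ ^ k * Ψ = 1 := by rw [← pow_succ, ← hk, hΨ1]
  let C : Module.End ℂ (Module.End ℂ (I.V x)) := LinearMap.mulLeft ℂ Ψ * LinearMap.mulRight ℂ (Ψ ^ k)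
  have hC : ∀ g, C g = Ψ * g * Ψ ^ k := fun g => (mul_assoc _ _ _).symm
  have hCp : C ^ p = 1 := by
    have e : Commute (LinearMap.mulLeft ℂ Ψ) (LinearMap.mulRight ℂ (Ψ ^ k)) :=
      LinearMap.commute_mulLeft_right _ _
    rw [e.mul_pow, LinearMap.pow_mulLeft, LinearMap.pow_mulRight, hΨ1, ← pow_mul, mul_comm, pow_mul, hΨ1,
      one_pow, LinearMap.mulLeft_one, LinearMap.mulRight_one]
    rfl
  obtain ⟨h1, -⟩ := avg_idem (R := Module.End ℂ (Module.End ℂ (I.V x))) hp hCp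
  set P := (p : ℂ)⁻¹ • ∑ i ∈ Finset.range p, C ^ i with hP
  have hav : I.intAvg L x (P f) = I.intAvg L x f := by
    have e : ∀ i : ℕ, I.intAvg L x ((C ^ i) f) = I.intAvg L x f := fun i => by
      induction i with
      | zero => rfl
      | succ i ih => rw [pow_succ', Module.End.mul_apply, hC, I.intAvg_conj hL hΨ2 hΨ3 hΨ, ih]
    rw [hP, LinearMap.smul_apply, LinearMap.sum_apply, map_smul, map_sum]
    simp only [e]
    rw [Finset.sum_const, Finset.card_range, ← Nat.cast_smul_eq_nsmul ℂ, smul_smul,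
      inv_mul_cancel₀ (by exact_mod_cast hp.ne'), one_smul]
  have hcP : Commute (P f) Ψ := by
    have e : Ψ * P f * Ψ ^ k = P f := by rw [← hC, ← Module.End.mul_apply, h1]
    rw [commute_iff_eq]
    conv_lhs => rw [← e, mul_assoc, hΨ3, mul_one]
  have hcΦ : Commute (P f) Φ := by
    refine Submodule.span_induction (p := fun g _ => Commute g Φ) ?_ (Commute.zero_left _)
      (fun _ _ _ _ => Commute.add_left) (fun c _ _ hg => hg.smul_left c) (span hΨ1 hΨt hcP)
    rintro _ ⟨i, rfl⟩
    exact h.pow_left i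
  rw [← hav]
  refine Submodule.span_induction (p := fun g _ => I.intAvg L x g = 0) ?_ (map_zero _)
    (fun a b _ _ ha hb => by rw [map_add, ha, hb, add_zero]) (fun c a _ ha => by rw [map_smul, ha, smul_zero])
    (span hΦ1 hΦt hcΦ)
  rintro _ ⟨i, rfl⟩
  exact I.intAvg_pow_eq_zero hL0 hΦ i

end Irr

namespace IntData
variable (D : IntData A)

lemma intAvg_ne_zero (I : Irr A) {x} (hm : I.m x = I.n x) (hell : ellE D.al ∈ I.stab x)
    (hsq : D.sq ∈ I.stab x) : ∃ f, I.intAvg D.L x f ≠ 0 := by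
  by_contra hB
  push Not at hB
  let g : A →ₗ[ℂ] I.V x := (I.ρ x).toLinearMap.flip (I.v0 x)
  have hg : ∀ a, g a = I.ρ x a (I.v0 x) := fun _ => rfl
  have hker : ∀ a, g a = 0 → a * I.e x = 0 := fun a ha => by
    have h1 : I.ρ x (a * I.e x) = 0 := LinearMap.ext fun v => by
      rw [map_mul (I.ρ x), Module.End.mul_apply, I.e_self, map_smul, ← hg, ha, smul_zero]; rfl
    have := I.mul_e_eq_zero hm h1
    rwa [mul_assoc, (I.idem x).eq] at this
  have hsurj : Function.Surjective g := fun v => by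
    obtain ⟨φ, hφ⟩ := Module.Projective.exists_dual_eq_one ℂ (I.v0_ne x)
    obtain ⟨a, ha⟩ := I.rho_surj x (φ.smulRight v)
    exact ⟨a, by rw [hg, ha]; simp [hφ]⟩
  obtain ⟨s, hs⟩ := g.exists_rightInverse_of_surjective (LinearMap.range_eq_top.2 hsurj)
  set ψ : I.V x →ₗ[ℂ] ℂ := D.lam ∘ₗ LinearMap.mulRight ℂ (I.e x) ∘ₗ s
  have hψ : ∀ a, D.lam (a * I.e x) = ψ (g a) := fun a => by
    have h1 : (a - s (g a)) * I.e x = 0 := hker _ (by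
      rw [map_sub, sub_eq_zero]
      exact (congrArg (· (g a)) hs).symm)
    rw [sub_mul, sub_eq_zero] at h1
    rw [h1]; rfl
  have h0 : I.ρ x (antipode ℂ (antipode ℂ (ell D.al (I.e x))) * antipode ℂ D.g) = 0 := by
    rw [D.antipode_sq_eq, map_sw]
    refine LinearMap.ext fun v => funext fun j => ?_
    let φ : I.V x →ₗ[ℂ] ℂ := LinearMap.proj j
    let G : Module.End ℂ (I.V x) →ₗ[ℂ] ℂ := ψ ∘ₗ LinearMap.applyₗ v
    let G' : Module.End ℂ (I.V x) →ₗ[ℂ] ℂ := φ ∘ₗ LinearMap.applyₗ v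
    have h1 : G (I.intAvg D.L x (φ.smulRight (I.v0 x))) = 0 := by rw [hB, map_zero]
    change G' _ = 0
    rw [I.intAvg_apply, map_sw] at h1
    rw [map_sw, ← h1]
    refine sw_congr fun u w => ?_
    rw [map_smul, map_smul, hψ]
    change ψ (g u) • φ (I.ρ x (antipode ℂ w) v) =
      ψ (I.ρ x u (φ (I.ρ x (antipode ℂ w) v) • I.v0 x))
    rw [map_smul, map_smul, ← hg, smul_eq_mul, smul_eq_mul, mul_comm]
  have h1 : I.ρ x (D.sq (ellE D.al (I.e x))) = 0 := by
    change I.ρ x (antipode ℂ (antipode ℂ (ell D.al (I.e x)))) = 0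
    rw [← mul_one (antipode ℂ _), ← D.antipode_g_mul, ← mul_assoc, map_mul (I.ρ x), h0, zero_mul]
  have h2 : I.chi x (D.sq (ellE D.al (I.e x))) = 1 := by
    rw [← I.chi_perm, I.mem_stab.1 hsq, ← I.chi_perm, I.mem_stab.1 hell, I.chi_e, if_pos rfl]
  rw [I.chi_apply, h1, map_zero] at h2
  exact zero_ne_one h2

end IntData
end Sw

namespace Sw

variable {A : Type} [Ring A] [HopfAlgebra ℂ A] [Module.Finite ℂ A]

lemma IntData.al_eq_counit [Nontrivial A] (D : IntData A) {p q : ℕ} (hp : p.Prime) (hq : q.Prime) (hop : Odd p)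
    (hoq : Odd q) (hpq : p < q) (hq2 : q ≤ 2 * p + 1) (hN : Module.finrank ℂ A = p * q) :
    D.al = Bialgebra.counitAlgHom ℂ A := by
  by_contra hal
  obtain ⟨hs, hsq⟩ := D.orderOf_eq hp hq hop hoq hpq hN hal
  obtain ⟨I⟩ := exists_irr (A := A)
  obtain ⟨x, hx⟩ := D.exists_fixed hp hq hop hoq hpq hq2 hN hal hs hsq I
  obtain ⟨hn, hm, harr, hS, hκ⟩ := fixed_data hp hop hq2 hN hal hs I hx
  have hL : ellE D.al ^ p = 1 := by rw [← hs]; exact pow_orderOf_eq_one _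
  obtain ⟨Φ, hΦ1, hΦ⟩ := I.exists_normalized hx hp.pos hL
  obtain ⟨Ψ, hΨ1, hΨ⟩ := I.exists_normalized harr hp.pos (ellE_pow_eq_one.1 hL)
  have hΦ' : ∀ a, Φ * I.ρ x a = I.ρ x (ell D.al a) * Φ := fun a => by simpa using hΦ 1 a
  have hΨ' : ∀ a, Ψ * I.ρ x a = I.ρ x (arr D.al a) * Ψ := fun a => by simpa using hΨ 1 a
  obtain ⟨c, hcp, hc⟩ := Irr.exists_commutator hp.pos hΦ1 hΨ1 hΦ' hΨ'
  by_cases h1 : c = 1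
  · obtain ⟨f, hf⟩ := D.intAvg_ne_zero I (hm.trans hn.symm) hx hS
    exact hf (I.intAvg_eq_zero D.lint (D.algHom_L hal) hp.pos hn hΦ1 hΨ1 hΦ' hΨ'
      (I.trace_normalized_ell hs hΦ) (I.trace_normalized_arr hs hΨ) (by rw [h1, one_smul] at hc; exact hc) f)
  · obtain ⟨k, hk⟩ := Irr.dvd_mult hp hΦ1 hΨ1 hΦ' hΨ' hx hcp h1 hc
    rw [hk] at hκ
    rcases Nat.eq_zero_or_pos k with rfl | hk0
    · exact Nat.not_even_iff_odd.2 hoq ⟨p, by omega⟩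
    · have := Nat.le_mul_of_pos_right p hk0
      omega

lemma modular_eq_counit [Nontrivial A] {p q : ℕ} (hp : p.Prime) (hq : q.Prime) (hop : Odd p)
    (hoq : Odd q) (hpq : p < q) (hq2 : q ≤ 2 * p + 1) (hN : Module.finrank ℂ A = p * q) (L : A)
    (al : A →ₐ[ℂ] ℂ) (hL0 : L ≠ 0) (hL : IsLInt L) (hal : ∀ h, L * h = al h • L) (x : A) :
    al x = counit (R := ℂ) x := by
  obtain ⟨D⟩ := exists_intData (A := A)
  obtain ⟨c, rfl⟩ := lint_unique D.lint D.L_ne hL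
  have h1 := hal x
  rw [smul_mul_assoc, D.L_mul, D.al_eq_counit hp hq hop hoq hpq hq2 hN, smul_comm] at h1
  exact (smul_left_injective ℂ hL0 h1).symm

end Sw
end

/-- For a non-semisimple Hopf algebra `H` over `ℂ` of dimension `p·q`, where
`p < q ≤ 2p + 1` are odd primes, the projective cover of the trivial `H`-module
has dimension `< p`. -/
theorem dim_projective_cover_trivial_lt (p q : ℕ) (hp : p.Prime) (hq : q.Prime)
    (hpodd : Odd p) (hqodd : Odd q) (hpq : p < q) (hq2p : q ≤ 2 * p + 1)
    (H : Type) [Ring H] [HopfAlgebra ℂ H]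
    (hdim : Module.finrank ℂ H = p * q)
    (hns : ¬ IsSemisimpleRing H)
    -- the trivial H-module: ℂ with H acting through the counit
    [Module H ℂ]
    (hTriv : ∀ (x : H) (c : ℂ), x • c = Coalgebra.counit (R := ℂ) x * c)
    -- (P, π) is a projective cover of the trivial module
    (P : Type) [AddCommGroup P] [Module ℂ P] [Module H P] [IsScalarTower ℂ H P]
    (hP : Module.Projective H P)
    (π : P →ₗ[H] ℂ) (hπ : Function.Surjective π)
    (hsup : ∀ N : Submodule H P, N ⊔ LinearMap.ker π = ⊤ → N = ⊤) :
    Module.finrank ℂ P < p := by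
  have hpos : 0 < Module.finrank ℂ H := hdim ▸ Nat.mul_pos hp.pos hq.pos
  have := Module.finite_of_finrank_pos hpos
  have := Module.nontrivial_of_finrank_pos hpos
  have hdu : Module.finrank ℂ (Sw.Du H) = p * q := by rw [Sw.finrank_du, hdim]
  have : Nontrivial (Sw.Du H) := Module.nontrivial_of_finrank_pos (R := ℂ) (hdu ▸ hdim ▸ hpos)
  exact absurd (Sw.semisimple_of_unimodular (hdim ▸ hpodd.mul hqodd)
    (Sw.modular_eq_counit hp hq hpodd hqodd hpq hq2p hdim)
    (Sw.modular_eq_counit hp hq hpodd hqodd hpq hq2p hdu)) hns
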